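/- Every 5×5 real matrix A all of whose 4×4 submatrices are tropically singular admits a lift Ã over K with rank(Ã) ≤ 3. Equivalently, the 4×4 minors of a 5×5 matrix of variables form a tropical basis. -/

import Mathlib

noncomputable section

/-- The field of generalized power series over `ℂ` with real exponents and
well-ordered support. -/
abbrev K : Type := HahnSeries ℝ ℂ

/-- An `m × m` real matrix is tropically singular if the minimum over all permutations `σ`
of `∑ i, M i (σ i)` is attained by at least two distinct permutations. -/
def TropSingular {m : ℕ} (M : Matrix (Fin m) (Fin m) ℝ) : Prop :=
  ∃ σ τ : Equiv.Perm (Fin m), σ ≠ τ ∧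
    (∑ i, M i (σ i)) = (∑ i, M i (τ i)) ∧
    ∀ ρ : Equiv.Perm (Fin m), (∑ i, M i (σ i)) ≤ ∑ i, M i (ρ i)

/-- `B` is a lift of the real matrix `A` over `K`: every entry of `B` is nonzero and its
valuation (order, the smallest exponent of the support) equals the corresponding entry of `A`. -/
def IsLift {d n : ℕ} (A : Matrix (Fin d) (Fin n) ℝ) (B : Matrix (Fin d) (Fin n) K) : Prop :=
  ∀ i j, B i j ≠ 0 ∧ (B i j).order = A i j

/-! ### Leading terms of Hahn series -/

/-- `x` has no term below `s`, and its coefficient at `s` is `c` (possibly `0`). -/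
def Lead (x : K) (s : ℝ) (c : ℂ) : Prop := x.coeff s = c ∧ ∀ t < s, x.coeff t = 0

lemma Lead.add {x y : K} {s : ℝ} {c d : ℂ} (hx : Lead x s c) (hy : Lead y s d) :
    Lead (x + y) s (c + d) := by
  refine ⟨by simp [hx.1, hy.1], fun t ht => by simp [hx.2 t ht, hy.2 t ht]⟩

lemma Lead.neg {x : K} {s : ℝ} {c : ℂ} (hx : Lead x s c) : Lead (-x) s (-c) := by
  refine ⟨by simp [hx.1], fun t ht => by simp [hx.2 t ht]⟩

lemma lead_zero (s : ℝ) : Lead 0 s 0 := ⟨by simp, fun t _ => by simp⟩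

lemma lead_single (s : ℝ) (c : ℂ) : Lead (HahnSeries.single s c) s c :=
  ⟨by simp, fun t ht => by simp [HahnSeries.coeff_single_of_ne ht.ne]⟩

lemma Lead.mul {x y : K} {s t : ℝ} {c d : ℂ} (hx : Lead x s c) (hy : Lead y t d) :
    Lead (x * y) (s + t) (c * d) := by
  have key : ∀ a ≤ s + t, (x * y).coeff a = if a = s + t then c * d else 0 := by
    intro a ha
    rw [HahnSeries.coeff_mul]
    have h1 : ∀ ij ∈ Finset.antidiagonal x.isPWO_support y.isPWO_support a,
        ij = (s, t) := by
      intro ij hij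
      rw [Finset.mem_antidiagonal] at hij
      obtain ⟨h1, h2, h3⟩ := hij
      have a1 : s ≤ ij.1 := by
        by_contra h
        exact h1 (hx.2 _ (not_le.mp h))
      have a2 : t ≤ ij.2 := by
        by_contra h
        exact h2 (hy.2 _ (not_le.mp h))
      ext
      · show ij.1 = s
        linarith
      · show ij.2 = t
        linarith
    split_ifs with hat
    · subst hat
      rw [← hx.1, ← hy.1]
      by_cases hmem : (s, t) ∈ Finset.antidiagonal x.isPWO_support y.isPWO_support (s + t)
      · rw [Finset.sum_eq_single_of_mem _ hmem]
        intro b hb hne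
        exact absurd (h1 b hb) hne
      · rw [Finset.sum_eq_zero]
        · rw [Finset.mem_antidiagonal] at hmem
          by_contra hne
          apply hmem
          refine ⟨?_, ?_, rfl⟩
          · intro h0; apply hne; simp [h0]
          · intro h0; apply hne; simp [h0]
        · intro b hb
          exact absurd (h1 b hb ▸ hb) hmem
    · apply Finset.sum_eq_zero
      intro b hb
      have hb2 := h1 b hb
      rw [Finset.mem_antidiagonal] at hb
      exfalso; apply hat
      rw [← hb.2.2, hb2]
  refine ⟨by rw [key _ le_rfl]; simp, fun a ha => by rw [key a ha.le]; simp [ha.ne]⟩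

lemma lead_one : Lead 1 0 1 := by
  have := lead_single 0 1
  simpa using this

lemma Lead.sum {ι : Type*} (S : Finset ι) (f : ι → K) (s : ℝ) (c : ι → ℂ)
    (h : ∀ i ∈ S, Lead (f i) s (c i)) : Lead (∑ i ∈ S, f i) s (∑ i ∈ S, c i) := by
  classical
  induction S using Finset.induction_on with
  | empty => simpa using lead_zero s
  | insert a S ha ih =>
    rw [Finset.sum_insert ha, Finset.sum_insert ha]
    exact (h a (Finset.mem_insert_self _ _)).add
      (ih fun i hi => h i (Finset.mem_insert_of_mem hi))

lemma Lead.prod {ι : Type*} (S : Finset ι) (f : ι → K) (s : ι → ℝ) (c : ι → ℂ)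
    (h : ∀ i ∈ S, Lead (f i) (s i) (c i)) :
    Lead (∏ i ∈ S, f i) (∑ i ∈ S, s i) (∏ i ∈ S, c i) := by
  classical
  induction S using Finset.induction_on with
  | empty => simpa using lead_one
  | insert a S ha ih =>
    rw [Finset.sum_insert ha, Finset.prod_insert ha, Finset.prod_insert ha]
    exact (h a (Finset.mem_insert_self _ _)).mul
      (ih fun i hi => h i (Finset.mem_insert_of_mem hi))

lemma Lead.lower {x : K} {s s' : ℝ} {c : ℂ} (h : Lead x s c) (hs : s' < s) : Lead x s' 0 :=
  ⟨h.2 _ hs, fun t ht => h.2 _ (ht.trans hs)⟩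

lemma Lead.ne_zero {x : K} {s : ℝ} {c : ℂ} (h : Lead x s c) (hc : c ≠ 0) : x ≠ 0 := by
  rintro rfl
  exact hc (by simpa using h.1.symm)

lemma Lead.order_eq {x : K} {s : ℝ} {c : ℂ} (h : Lead x s c) (hc : c ≠ 0) : x.order = s := by
  apply le_antisymm
  · exact HahnSeries.order_le_of_coeff_ne_zero (by rw [h.1]; exact hc)
  · by_contra hlt
    push Not at hlt
    exact (HahnSeries.coeff_order_eq_zero.not.mpr (h.ne_zero hc)) (h.2 _ hlt)

lemma lead_of_order {x : K} (hx : x ≠ 0) : ∃ c, c ≠ 0 ∧ Lead x x.order c :=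
  ⟨x.coeff x.order, HahnSeries.coeff_order_eq_zero.not.mpr hx, rfl,
    fun _ ht => HahnSeries.coeff_eq_zero_of_lt_order ht⟩

lemma Lead.div {x y : K} {s t : ℝ} {c d : ℂ} (hx : Lead x s c) (hc : c ≠ 0)
    (hy : Lead y t d) (hd : d ≠ 0) : ∃ e, e ≠ 0 ∧ Lead (x / y) (s - t) e := by
  have hx0 := hx.ne_zero hc
  have hy0 := hy.ne_zero hd
  have hq : x / y ≠ 0 := div_ne_zero hx0 hy0
  have ho : (x / y).order + y.order = x.order := by
    rw [← HahnSeries.order_mul hq hy0, div_mul_cancel₀ _ hy0]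
  rw [hx.order_eq hc, hy.order_eq hd] at ho
  obtain ⟨e, he, hl⟩ := lead_of_order hq
  refine ⟨e, he, ?_⟩
  rwa [show (x / y).order = s - t by linarith] at hl

lemma lead_sign {n : ℕ} (σ : Equiv.Perm (Fin n)) :
    Lead ((Equiv.Perm.sign σ : ℤ) : K) 0 ((Equiv.Perm.sign σ : ℤ) : ℂ) := by
  rcases Int.units_eq_one_or (Equiv.Perm.sign σ) with h | h
  · rw [h]; simpa using lead_one
  · rw [h]; simpa using lead_one.neg

lemma det_lead {n : ℕ} (M : Matrix (Fin n) (Fin n) K) (a : Fin n → Fin n → ℝ)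
    (c : Fin n → Fin n → ℂ) (hM : ∀ i j, Lead (M i j) (a i j) (c i j)) (s : ℝ)
    (hs : ∀ σ : Equiv.Perm (Fin n), s ≤ ∑ i, a i (σ i)) :
    Lead M.det s (∑ σ : Equiv.Perm (Fin n), if ∑ i, a i (σ i) = s then
      ((Equiv.Perm.sign σ : ℤ) : ℂ) * ∏ i, c i (σ i) else 0) := by
  rw [← Matrix.det_transpose, Matrix.det_apply']
  apply Lead.sum
  intro σ _
  have h1 := (lead_sign σ).mul (Lead.prod Finset.univ (fun i => M i (σ i)) _ _
    (fun i _ => hM i (σ i)))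
  rw [zero_add] at h1
  split_ifs with h
  · rw [← h]; exact h1
  · exact h1.lower (lt_of_le_of_ne (hs σ) (Ne.symm h))

/-! ### Generic coefficients -/

/-- The generic coefficient at position `(i, k)`. -/
def gc (i k : Fin 5) : ℂ := (2 : ℂ) ^ (2 ^ (5 * (i : ℕ) + k))

lemma gc_ne (i k : Fin 5) : gc i k ≠ 0 := pow_ne_zero _ two_ne_zero

lemma signed_pow_ne {ι : Type*} (S : Finset ι) (hS : S.Nonempty) (ε : ι → ℤ)
    (hε : ∀ i, ε i = 1 ∨ ε i = -1) (n : ι → ℕ) (hn : Set.InjOn n S) :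
    ∑ i ∈ S, ε i * (2 : ℤ) ^ n i ≠ 0 := by
  classical
  obtain ⟨i0, hi0, hmin⟩ := Finset.exists_min_image S n hS
  rw [← Finset.add_sum_erase S _ hi0]
  have hd : (2 : ℤ) ^ (n i0 + 1) ∣ ∑ i ∈ S.erase i0, ε i * (2 : ℤ) ^ n i := by
    apply Finset.dvd_sum
    intro i hi
    rw [Finset.mem_erase] at hi
    apply Dvd.dvd.mul_left
    apply pow_dvd_pow
    have h1 := hmin i hi.2
    have h2 : n i ≠ n i0 := fun h => hi.1 (hn hi.2 hi0 h)
    omega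
  obtain ⟨q, hq⟩ := hd
  rw [hq]
  intro h0
  have h3 : (2 : ℤ) ^ n i0 * (ε i0 + 2 * q) = 0 := by rw [← h0]; ring
  have h4 : (2 : ℤ) ^ n i0 ≠ 0 := by positivity
  have h5 := (mul_eq_zero.mp h3).resolve_left h4
  rcases hε i0 with h | h <;> omega

lemma gc_sum_ne {n : ℕ} (ρ κ : Fin n → Fin 5) (hρ : Function.Injective ρ)
    (hκ : Function.Injective κ) (S : Finset (Equiv.Perm (Fin n))) (hS : S.Nonempty) :
    ∑ σ ∈ S, ((Equiv.Perm.sign σ : ℤ) : ℂ) * ∏ i, gc (ρ i) (κ (σ i)) ≠ 0 := by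
  classical
  have h1 : ∀ σ : Equiv.Perm (Fin n), ∏ i, gc (ρ i) (κ (σ i)) =
      (2 : ℂ) ^ (∑ i, 2 ^ (5 * (ρ i : ℕ) + κ (σ i))) := by
    intro σ
    simp only [gc]
    rw [Finset.prod_pow_eq_pow_sum]
  have h2 := signed_pow_ne S hS (fun σ => (Equiv.Perm.sign σ : ℤ))
    (fun σ => by
      rcases Int.units_eq_one_or (Equiv.Perm.sign σ) with h | h <;> simp [h])
    (fun σ => ∑ i, 2 ^ (5 * (ρ i : ℕ) + κ (σ i))) (by
      intro σ _ τ _ h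
      have hinj : ∀ σ : Equiv.Perm (Fin n),
          Function.Injective (fun i => 5 * (ρ i : ℕ) + κ (σ i)) := by
        intro σ i j hij
        apply hρ
        apply Fin.ext
        have := (κ (σ i)).2
        have := (κ (σ j)).2
        simp only at hij
        omega
      have himg : ∀ σ : Equiv.Perm (Fin n), (∑ i, 2 ^ (5 * (ρ i : ℕ) + κ (σ i))) =
          ∑ s ∈ Finset.univ.image (fun i => 5 * (ρ i : ℕ) + κ (σ i)), 2 ^ s := by
        intro σ
        rw [Finset.sum_image (fun a _ b _ hab => hinj σ hab)]
      simp only at h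
      rw [himg σ, himg τ] at h
      have h' := Finset.geomSum_injective (le_refl 2) h
      ext i
      have hi : 5 * (ρ i : ℕ) + κ (σ i) ∈
          Finset.univ.image (fun i => 5 * (ρ i : ℕ) + κ (τ i)) := by
        rw [← h']
        exact Finset.mem_image_of_mem _ (Finset.mem_univ i)
      rw [Finset.mem_image] at hi
      obtain ⟨j, _, hj⟩ := hi
      have e1 := (κ (σ i)).2
      have e2 := (κ (τ j)).2
      have hij : ρ j = ρ i := Fin.ext (by omega)
      have hji := hρ hij
      subst hji
      have : κ (τ j) = κ (σ j) := Fin.ext (by omega)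
      rw [hκ this])
  simp_rw [h1]
  exact_mod_cast h2

/-! ### Minimal permutations in a class -/

/-- `π` is minimal among the permutations sending `b` to `d`. -/
def IsMinP (A : Matrix (Fin 5) (Fin 5) ℝ) (b d : Fin 5) (π : Equiv.Perm (Fin 5)) : Prop :=
  π b = d ∧ ∀ π' : Equiv.Perm (Fin 5), π' b = d → ∑ k, A k (π k) ≤ ∑ k, A k (π' k)

/-- The class `(b, d)` has minimal permutations using `(a, k)` and not using `(a, k)`. -/
def HasArc (A : Matrix (Fin 5) (Fin 5) ℝ) (b d a k : Fin 5) : Prop :=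
  (∃ π, IsMinP A b d π ∧ π a = k) ∧ ∃ π, IsMinP A b d π ∧ π a ≠ k

lemma cons_bij {ρ : Fin 4 → Fin 5} (hρ : Function.Injective ρ) {b : Fin 5}
    (hb : ∀ i, ρ i ≠ b) : Function.Bijective (Fin.cons b ρ : Fin 5 → Fin 5) := by
  apply Finite.injective_iff_bijective.mp
  rw [Fin.cons_injective_iff]
  exact ⟨fun ⟨i, hi⟩ => hb i hi, hρ⟩

lemma sum_avoid {ρ : Fin 4 → Fin 5} (hρ : Function.Injective ρ) {b : Fin 5}
    (hb : ∀ i, ρ i ≠ b) (f : Fin 5 → ℝ) : ∑ k, f k = f b + ∑ i, f (ρ i) := by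
  rw [← (cons_bij hρ hb).sum_comp, Fin.sum_univ_succ]
  simp

lemma ext_perm {ρ κ : Fin 4 → Fin 5} (hρ : Function.Injective ρ) (hκ : Function.Injective κ)
    {b d : Fin 5} (hb : ∀ i, ρ i ≠ b) (hd : ∀ i, κ i ≠ d) (σ : Equiv.Perm (Fin 4)) :
    ∃ π : Equiv.Perm (Fin 5), π b = d ∧ ∀ i, π (ρ i) = κ (σ i) := by
  let e1 := Equiv.ofBijective _ (cons_bij hρ hb)
  let e2 := Equiv.ofBijective _ (cons_bij hκ hd)
  have h10 : e1.symm b = 0 := by rw [Equiv.symm_apply_eq]; rfl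
  have h1 : ∀ i, e1.symm (ρ i) = Fin.succ i := by
    intro i; rw [Equiv.symm_apply_eq]; rfl
  refine ⟨(e1.symm.trans (Equiv.Perm.decomposeFin.symm (0, σ))).trans e2, ?_, ?_⟩
  · simp only [Equiv.trans_apply, h10]
    rw [Equiv.Perm.decomposeFin_symm_apply_zero]; rfl
  · intro i
    simp only [Equiv.trans_apply, h1]
    rw [Equiv.Perm.decomposeFin_symm_apply_succ]
    simp; rfl

lemma restr_perm {ρ κ : Fin 4 → Fin 5} (hρ : Function.Injective ρ) (hκ : Function.Injective κ)
    {b d : Fin 5} (hb : ∀ i, ρ i ≠ b) (hd : ∀ i, κ i ≠ d) (π : Equiv.Perm (Fin 5))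
    (hπ : π b = d) : ∃ σ : Equiv.Perm (Fin 4), ∀ i, π (ρ i) = κ (σ i) := by
  have h1 : ∀ i, ∃ j, κ j = π (ρ i) := by
    intro i
    obtain ⟨j, hj⟩ := (cons_bij hκ hd).2 (π (ρ i))
    revert hj
    refine Fin.cases ?_ (fun j' => ?_) j
    · intro hj
      exfalso
      simp only [Fin.cons_zero] at hj
      rw [← hπ] at hj
      exact hb i (π.injective hj).symm
    · intro hj; exact ⟨j', by simpa using hj⟩
  choose f hf using h1
  have hinj : Function.Injective f := by
    intro i j hij
    apply hρ; apply π.injective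
    rw [← hf, ← hf, hij]
  exact ⟨Equiv.ofBijective f (Finite.injective_iff_bijective.mp hinj), fun i => (hf i).symm⟩

lemma exists_isMin (A : Matrix (Fin 5) (Fin 5) ℝ) (b d : Fin 5) : ∃ π, IsMinP A b d π := by
  obtain ⟨π, h1, h2⟩ := Finset.exists_min_image
    (Finset.univ.filter fun π : Equiv.Perm (Fin 5) => π b = d) (fun π => ∑ k, A k (π k))
    ⟨Equiv.swap b d, by simp⟩
  exact ⟨π, by simpa using h1, fun π' h' => h2 π' (by simpa using h')⟩

lemma class_corr (A : Matrix (Fin 5) (Fin 5) ℝ) {ρ κ : Fin 4 → Fin 5}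
    (hρ : Function.Injective ρ) (hκ : Function.Injective κ)
    {b d : Fin 5} (hb : ∀ i, ρ i ≠ b) (hd : ∀ i, κ i ≠ d) :
    ∃ s : ℝ, (∀ σ : Equiv.Perm (Fin 4), s ≤ ∑ i, A (ρ i) (κ (σ i))) ∧
      (∀ π, IsMinP A b d π → ∃ σ : Equiv.Perm (Fin 4),
        ∑ i, A (ρ i) (κ (σ i)) = s ∧ ∀ i, π (ρ i) = κ (σ i)) ∧
      (∀ σ : Equiv.Perm (Fin 4), ∑ i, A (ρ i) (κ (σ i)) = s →
        ∃ π, IsMinP A b d π ∧ ∀ i, π (ρ i) = κ (σ i)) := by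
  obtain ⟨π0, h0, hmin⟩ := exists_isMin A b d
  have hsum : ∀ (π : Equiv.Perm (Fin 5)) (σ : Equiv.Perm (Fin 4)), π b = d →
      (∀ i, π (ρ i) = κ (σ i)) → ∑ k, A k (π k) = A b d + ∑ i, A (ρ i) (κ (σ i)) := by
    intro π σ hπ h
    rw [sum_avoid hρ hb, hπ]
    simp [h]
  refine ⟨∑ k, A k (π0 k) - A b d, ?_, ?_, ?_⟩
  · intro σ
    obtain ⟨π, hπ, h⟩ := ext_perm hρ hκ hb hd σ
    have := hmin π hπ
    rw [hsum π σ hπ h] at this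
    linarith
  · intro π hπ
    obtain ⟨σ, h⟩ := restr_perm hρ hκ hb hd π hπ.1
    refine ⟨σ, ?_, h⟩
    have h1 := hmin π hπ.1
    have h2 := hπ.2 π0 h0
    have h3 := hsum π σ hπ.1 h
    linarith
  · intro σ hσ
    obtain ⟨π, hπ, h⟩ := ext_perm hρ hκ hb hd σ
    refine ⟨π, ⟨hπ, fun π' h' => ?_⟩, h⟩
    have h1 := hmin π' h'
    have h3 := hsum π σ hπ h
    linarith

/-- Data extracted from the tropical `4 × 4` minor. -/
lemma min_sub {a : Fin 5} {r : Fin 3 → Fin 5} {k : Fin 5} {C : Fin 3 → Fin 5}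
    (A : Matrix (Fin 5) (Fin 5) ℝ) {s : ℝ}
    (hs : ∀ σ : Equiv.Perm (Fin 4), s ≤ ∑ i, A ((Fin.cons a r : Fin 4 → Fin 5) i)
      ((Fin.cons k C : Fin 4 → Fin 5) (σ i)))
    (h0 : ∃ σ : Equiv.Perm (Fin 4), σ 0 = 0 ∧ ∑ i, A ((Fin.cons a r : Fin 4 → Fin 5) i)
      ((Fin.cons k C : Fin 4 → Fin 5) (σ i)) = s) :
    (∀ τ : Equiv.Perm (Fin 3), s - A a k ≤ ∑ i, A (r i) (C (τ i))) ∧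
    ∃ τ : Equiv.Perm (Fin 3), ∑ i, A (r i) (C (τ i)) = s - A a k := by
  have key : ∀ τ : Equiv.Perm (Fin 3), ∑ i, A ((Fin.cons a r : Fin 4 → Fin 5) i)
      ((Fin.cons k C : Fin 4 → Fin 5) (Equiv.Perm.decomposeFin.symm (0, τ) i)) =
      A a k + ∑ i, A (r i) (C (τ i)) := by
    intro τ
    rw [Fin.sum_univ_succ]
    rw [Equiv.Perm.decomposeFin_symm_apply_zero]
    simp [Equiv.Perm.decomposeFin_symm_apply_succ]
  constructor
  · intro τ
    have := hs (Equiv.Perm.decomposeFin.symm (0, τ))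
    rw [key] at this
    linarith
  · obtain ⟨σ, h1, h2⟩ := h0
    obtain ⟨⟨p, τ⟩, rfl⟩ := Equiv.Perm.decomposeFin.symm.surjective σ
    rw [Equiv.Perm.decomposeFin_symm_apply_zero] at h1
    subst h1
    rw [key] at h2
    exact ⟨τ, by linarith⟩

/-! ### Bordered determinants -/

/-- The `4 × 4` matrix with first row `(y₀, yC)` and further rows the columns `k, C` of `R`. -/
def bm (y₀ : K) (yC : Fin 3 → K) (R : Fin 3 → Fin 5 → K) (k : Fin 5) (C : Fin 3 → Fin 5) :
    Matrix (Fin 4) (Fin 4) K :=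
  Fin.cons (Fin.cons y₀ yC : Fin 4 → K)
    (fun i => (Fin.cons (R i k) (fun j => R i (C j)) : Fin 4 → K))

/-- The `3 × 3` minor. -/
def mm (R : Fin 3 → Fin 5 → K) (C : Fin 3 → Fin 5) : Matrix (Fin 3) (Fin 3) K :=
  fun i j => R i (C j)

lemma bm_det (y₀ : K) (yC : Fin 3 → K) (R : Fin 3 → Fin 5 → K) (k : Fin 5)
    (C : Fin 3 → Fin 5) :
    (bm y₀ yC R k C).det = y₀ * (mm R C).det + (bm 0 yC R k C).det := by
  rw [Matrix.det_succ_row_zero, Matrix.det_succ_row_zero (bm 0 yC R k C)]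
  rw [Fin.sum_univ_succ, Fin.sum_univ_succ (n := 3)]
  have h1 : ∀ z : K, (bm z yC R k C).submatrix Fin.succ (Fin.succAbove 0) = mm R C := by
    intro z; ext i j; rfl
  have h2 : ∀ j : Fin 3, (bm y₀ yC R k C).submatrix Fin.succ (Fin.succAbove j.succ) =
      (bm 0 yC R k C).submatrix Fin.succ (Fin.succAbove j.succ) := by
    intro j; ext i j; rfl
  simp only [h1, h2]
  simp [bm]

lemma neg_div_mul_aux {F : Type*} [Field F] (a b c : F) (hb : b ≠ 0) :
    -(a / b) * c * b = -(a * c) := by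
  field_simp

lemma span_of_det (y : Fin 5 → K) (R : Fin 3 → Fin 5 → K) (C : Fin 3 → Fin 5)
    (hD : (mm R C).det ≠ 0) (h : ∀ k, (bm (y k) (fun j => y (C j)) R k C).det = 0) :
    ∃ c : Fin 3 → K, ∀ k, y k = ∑ i, c i * R i k := by
  have h1 : ∀ k, ∃ c : Fin 3 → K, y k = ∑ i, c i * R i k ∧
      ∀ j, y (C j) = ∑ i, c i * R i (C j) := by
    intro k
    obtain ⟨v, hv, h0⟩ := Matrix.exists_vecMul_eq_zero_iff.mpr (h k)
    have hc0 := congrFun h0 0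
    have hcj := fun j : Fin 3 => congrFun h0 j.succ
    simp only [Matrix.vecMul, dotProduct, Fin.sum_univ_succ (n := 3), bm, Fin.cons_zero,
      Fin.cons_succ, Pi.zero_apply] at hc0 hcj
    have hv0 : v 0 ≠ 0 := by
      intro hv0
      apply hD
      rw [← Matrix.exists_vecMul_eq_zero_iff]
      refine ⟨fun i => v i.succ, ?_, ?_⟩
      · intro hz
        apply hv
        funext i
        refine Fin.cases hv0 (fun i => ?_) i
        exact congrFun hz i
      · funext j
        have := hcj j
        rw [hv0, zero_mul, zero_add] at this
        simpa [Matrix.vecMul, dotProduct, mm] using this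
    refine ⟨fun i => -(v i.succ / v 0), ?_, ?_⟩
    · have : ∑ i : Fin 3, -(v i.succ / v 0) * R i k =
        -(∑ i : Fin 3, v i.succ * R i k) / v 0 := by
        rw [eq_div_iff hv0, Finset.sum_mul, ← Finset.sum_neg_distrib]
        apply Finset.sum_congr rfl; intro i _
        exact neg_div_mul_aux _ _ _ hv0
      rw [this, eq_div_iff hv0]
      linear_combination hc0
    · intro j
      have : ∑ i : Fin 3, -(v i.succ / v 0) * R i (C j) =
        -(∑ i : Fin 3, v i.succ * R i (C j)) / v 0 := by
        rw [eq_div_iff hv0, Finset.sum_mul, ← Finset.sum_neg_distrib]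
        apply Finset.sum_congr rfl; intro i _
        exact neg_div_mul_aux _ _ _ hv0
      rw [this, eq_div_iff hv0]
      linear_combination hcj j
  obtain ⟨c, _, hc⟩ := h1 0
  refine ⟨c, fun k => ?_⟩
  obtain ⟨c', hk, hc'⟩ := h1 k
  have : c' = c := by
    have hz : Matrix.vecMul (c' - c) (mm R C) = 0 := by
      funext j
      simp only [Matrix.vecMul, dotProduct, mm, Pi.sub_apply, sub_mul, Finset.sum_sub_distrib,
        Pi.zero_apply]
      rw [← hc', ← hc, sub_self]
    by_contra hne
    exact hD (Matrix.exists_vecMul_eq_zero_iff.mp ⟨c' - c, sub_ne_zero.mpr hne, hz⟩)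
  rw [hk, this]

lemma bm_repeat (yC : Fin 3 → K) (R : Fin 3 → Fin 5 → K) (C : Fin 3 → Fin 5) (j : Fin 3) :
    (bm (yC j) yC R (C j) C).det = 0 := by
  apply Matrix.det_zero_of_column_eq (i := 0) (j := j.succ) (Fin.succ_ne_zero j).symm
  intro i
  refine Fin.cases ?_ (fun i => ?_) i <;> simp [bm]

/-- Completing a row which is given on the columns `C`. -/
lemma row_complete (x : Fin 5 → ℝ) (R : Fin 3 → Fin 5 → K) (C : Fin 3 → Fin 5)
    (yC : Fin 3 → K)
    (hyC : ∀ j, ∃ c, c ≠ 0 ∧ Lead (yC j) (x (C j)) c)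
    (q : ℝ) (hq : ∃ c, c ≠ 0 ∧ Lead (mm R C).det q c)
    (hk : ∀ k, (∀ j, C j ≠ k) → ∃ c, c ≠ 0 ∧ Lead (bm 0 yC R k C).det (x k + q) c) :
    ∃ y : Fin 5 → K, (∀ k, y k ≠ 0 ∧ (y k).order = x k) ∧
      ∃ c : Fin 3 → K, ∀ k, y k = ∑ i, c i * R i k := by
  classical
  obtain ⟨δ, hδ, hD⟩ := hq
  have hD0 := hD.ne_zero hδ
  have hdet : ∀ k, (bm (-(bm 0 yC R k C).det / (mm R C).det) yC R k C).det = 0 := by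
    intro k
    rw [bm_det, div_mul_cancel₀ _ hD0]; ring
  set y : Fin 5 → K := fun k => -(bm 0 yC R k C).det / (mm R C).det with hy
  have hyj : ∀ j, y (C j) = yC j := by
    intro j
    have h1 := bm_repeat yC R C j
    rw [bm_det] at h1
    simp only [hy]
    rw [div_eq_iff hD0]
    linear_combination -h1
  refine ⟨y, ?_, ?_⟩
  · intro k
    have : ∃ c, c ≠ 0 ∧ Lead (y k) (x k) c := by
      by_cases hkC : ∃ j, C j = k
      · obtain ⟨j, rfl⟩ := hkC
        rw [hyj]; exact hyC j
      · push Not at hkC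
        obtain ⟨c, hc, hl⟩ := hk k hkC
        obtain ⟨e, he, hl'⟩ := hl.neg.div (neg_ne_zero.mpr hc) hD hδ
        refine ⟨e, he, ?_⟩
        rwa [add_sub_cancel_right] at hl'
    obtain ⟨c, hc, hl⟩ := this
    exact ⟨hl.ne_zero hc, hl.order_eq hc⟩
  · apply span_of_det y R C hD0
    intro k
    simp only [hyj]
    exact hdet k

/-! ### The lifting recipes -/

/-- `r` enumerates the complement of `{a, b}`. -/
structure Comp (r : Fin 3 → Fin 5) (a b : Fin 5) : Prop where
  ne : a ≠ b
  inj : Function.Injective r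
  av : ∀ i, r i ≠ a ∧ r i ≠ b
  cover : ∀ k, (∀ i, r i ≠ k) → k = a ∨ k = b

lemma Comp.symm {r : Fin 3 → Fin 5} {a b : Fin 5} (h : Comp r a b) : Comp r b a :=
  ⟨h.ne.symm, h.inj, fun i => (h.av i).symm, fun k hk => (h.cover k hk).symm⟩

lemma comp_aux : ∀ a b c : Fin 5, a ≠ b → a ≠ c → b ≠ c → ∃ x y : Fin 5,
    (x ≠ y ∧ x ≠ c ∧ y ≠ c) ∧ (a ≠ x ∧ a ≠ y ∧ b ≠ x ∧ b ≠ y) ∧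
      ∀ k, k = a ∨ k = b ∨ k = c ∨ k = x ∨ k = y := by
  decide

lemma comp_exists3 {a b c : Fin 5} (h1 : a ≠ b) (h2 : c ≠ a) (h3 : c ≠ b) :
    ∃ r : Fin 3 → Fin 5, Comp r a b ∧ r 0 = c := by
  obtain ⟨x, y, ⟨hxy, hxc, hyc⟩, ⟨hax, hay, hbx, hby⟩, hk⟩ := comp_aux a b c h1 h2.symm h3.symm
  refine ⟨![c, x, y], ⟨h1, ?_, ?_, ?_⟩, rfl⟩
  · intro i j hij
    fin_cases i <;> fin_cases j <;> simp_all
  · intro i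
    fin_cases i
    · exact ⟨h2, h3⟩
    · exact ⟨hax.symm, hbx.symm⟩
    · exact ⟨hay.symm, hby.symm⟩
  · intro k hk'
    have e0 := hk' 0
    have e1 := hk' 1
    have e2 := hk' 2
    rcases hk k with h | h | h | h | h
    · exact Or.inl h
    · exact Or.inr h
    · exact absurd h.symm e0
    · exact absurd h.symm e1
    · exact absurd h.symm e2

lemma comp_exists {a b : Fin 5} (h1 : a ≠ b) : ∃ r : Fin 3 → Fin 5, Comp r a b := by
  have : ∀ a b : Fin 5, ∃ c, c ≠ a ∧ c ≠ b := by decide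
  obtain ⟨c, h2, h3⟩ := this a b
  obtain ⟨r, hr, _⟩ := comp_exists3 h1 h2 h3
  exact ⟨r, hr⟩

lemma Comp.inj4 {r : Fin 3 → Fin 5} {a b : Fin 5} (h : Comp r a b) :
    Function.Injective (Fin.cons a r : Fin 4 → Fin 5) := by
  rw [Fin.cons_injective_iff]
  exact ⟨fun ⟨i, hi⟩ => (h.av i).1 hi, h.inj⟩

lemma Comp.av4 {r : Fin 3 → Fin 5} {a b : Fin 5} (h : Comp r a b) :
    ∀ i, (Fin.cons a r : Fin 4 → Fin 5) i ≠ b := by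
  intro i
  refine Fin.cases ?_ (fun i => ?_) i
  · exact h.ne
  · exact (h.av i).2

/-- `q` is the tropical determinant of the rows `r` and columns `C`. -/
def QMin (A : Matrix (Fin 5) (Fin 5) ℝ) (r C : Fin 3 → Fin 5) (q : ℝ) : Prop :=
  (∀ τ : Equiv.Perm (Fin 3), q ≤ ∑ i, A (r i) (C (τ i))) ∧
    ∃ τ : Equiv.Perm (Fin 3), ∑ i, A (r i) (C (τ i)) = q

lemma QMin.unique {A : Matrix (Fin 5) (Fin 5) ℝ} {r C : Fin 3 → Fin 5} {q q' : ℝ}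
    (h : QMin A r C q) (h' : QMin A r C q') : q = q' := by
  obtain ⟨h1, τ, h2⟩ := h
  obtain ⟨h1', τ', h2'⟩ := h'
  have := h1 τ'
  have := h1' τ
  linarith

/-- The weight of a permutation in the `4 × 4` submatrix. -/
def S4 (A : Matrix (Fin 5) (Fin 5) ℝ) (a : Fin 5) (r : Fin 3 → Fin 5) (k : Fin 5)
    (C : Fin 3 → Fin 5) (σ : Equiv.Perm (Fin 4)) : ℝ :=
  ∑ i, A ((Fin.cons a r : Fin 4 → Fin 5) i) ((Fin.cons k C : Fin 4 → Fin 5) (σ i))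

lemma arc_q (A : Matrix (Fin 5) (Fin 5) ℝ) {a b c d : Fin 5} {r C : Fin 3 → Fin 5}
    (hr : Comp r a b) (hC : Comp C c d) (h : HasArc A b d a c) :
    ∃ q, QMin A r C q ∧ (∀ σ, A a c + q ≤ S4 A a r c C σ) ∧
      (∃ σ, S4 A a r c C σ = A a c + q ∧ σ 0 ≠ 0) ∧
      (∀ π, IsMinP A b d π → ∃ σ, S4 A a r c C σ = A a c + q ∧
        ∀ i, π ((Fin.cons a r : Fin 4 → Fin 5) i) = (Fin.cons c C : Fin 4 → Fin 5) (σ i)) ∧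
      (∀ σ, S4 A a r c C σ = A a c + q → ∃ π, IsMinP A b d π ∧
        ∀ i, π ((Fin.cons a r : Fin 4 → Fin 5) i) = (Fin.cons c C : Fin 4 → Fin 5) (σ i)) := by
  obtain ⟨s, h1, h2, h3⟩ := class_corr A hr.inj4 hC.inj4 hr.av4 hC.av4
  obtain ⟨⟨π, hπ, hπa⟩, π', hπ', hπa'⟩ := h
  obtain ⟨σ, hσ, hσa⟩ := h2 π hπ
  obtain ⟨σ', hσ', hσa'⟩ := h2 π' hπ'
  have e0 : σ 0 = 0 := by
    have := hσa 0
    apply hC.inj4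
    rw [← this]
    simpa using hπa
  have e1 : σ' 0 ≠ 0 := by
    intro h0
    have := hσa' 0
    rw [h0] at this
    exact hπa' (by simpa using this)
  have hm := min_sub A h1 ⟨σ, e0, hσ⟩
  have hs : A a c + (s - A a c) = s := by ring
  refine ⟨s - A a c, hm, ?_, ⟨σ', ?_, e1⟩, ?_, ?_⟩
  · intro σ; rw [hs]; exact h1 σ
  · rw [hs]; exact hσ'
  · rw [hs]; exact h2
  · rw [hs]; exact h3

/-- The generic lift. -/
def G (A : Matrix (Fin 5) (Fin 5) ℝ) (i k : Fin 5) : K := HahnSeries.single (A i k) (gc i k)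

lemma lead_G (A : Matrix (Fin 5) (Fin 5) ℝ) (i k : Fin 5) : Lead (G A i k) (A i k) (gc i k) :=
  lead_single _ _

lemma mm_lead (A : Matrix (Fin 5) (Fin 5) ℝ) {r C : Fin 3 → Fin 5} (hr : Function.Injective r)
    (hC : Function.Injective C) {q : ℝ} (hq : QMin A r C q) (R : Fin 3 → Fin 5 → K)
    (hR : ∀ i j, R i (C j) = G A (r i) (C j)) :
    ∃ c, c ≠ 0 ∧ Lead (mm R C).det q c := by
  have h := det_lead (mm R C) (fun i j => A (r i) (C j)) (fun i j => gc (r i) (C j))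
    (fun i j => by simp only [mm]; rw [hR]; exact lead_G A _ _) q hq.1
  refine ⟨_, ?_, h⟩
  rw [← Finset.sum_filter]
  apply gc_sum_ne r C hr hC
  obtain ⟨τ, hτ⟩ := hq.2
  exact ⟨τ, by simpa using hτ⟩

lemma bm_lead_gen (A : Matrix (Fin 5) (Fin 5) ℝ) {a b c d : Fin 5} {r C : Fin 3 → Fin 5}
    (hr : Comp r a b) (hC : Comp C c d) {s : ℝ} (hs : ∀ σ, s ≤ S4 A a r c C σ)
    (h0 : ∃ σ, S4 A a r c C σ = s ∧ σ 0 ≠ 0) (R : Fin 3 → Fin 5 → K)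
    (hR : ∀ i j, R i (C j) = G A (r i) (C j)) (hR' : ∀ i, R i c = G A (r i) c) :
    ∃ δ, δ ≠ 0 ∧ Lead (bm 0 (fun j => G A a (C j)) R c C).det s δ := by
  classical
  have h := det_lead (bm 0 (fun j => G A a (C j)) R c C)
    (fun i j => A ((Fin.cons a r : Fin 4 → Fin 5) i) ((Fin.cons c C : Fin 4 → Fin 5) j))
    (fun i j => if i = 0 ∧ j = 0 then 0 else
      gc ((Fin.cons a r : Fin 4 → Fin 5) i) ((Fin.cons c C : Fin 4 → Fin 5) j))
    (fun i j => by
      refine Fin.cases ?_ (fun i => ?_) i <;> refine Fin.cases ?_ (fun j => ?_) j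
      · simpa [bm] using lead_zero _
      · simpa [bm] using lead_G A _ _
      · simp only [bm, Fin.cons_succ, Fin.cons_zero, hR']; simpa using lead_G A _ _
      · simp only [bm, Fin.cons_succ, hR]; simpa using lead_G A _ _) s hs
  refine ⟨_, ?_, h⟩
  rw [← Finset.sum_filter]
  have := gc_sum_ne _ _ hr.inj4 hC.inj4 (Finset.univ.filter fun σ => S4 A a r c C σ = s ∧ σ 0 ≠ 0)
    (by obtain ⟨σ, hσ⟩ := h0; exact ⟨σ, by simpa using hσ⟩)
  convert this using 1
  rw [Finset.sum_filter, Finset.sum_filter]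
  apply Finset.sum_congr rfl
  intro σ _
  by_cases hσ : S4 A a r c C σ = s
  · have hσ1 := hσ
    simp only [S4] at hσ1
    simp only [hσ1, hσ, if_true, true_and]
    by_cases h0 : σ 0 = 0
    · simp only [h0, ne_eq, not_true_eq_false, if_false]
      rw [Finset.prod_eq_zero (Finset.mem_univ 0)]
      · simp
      · simp [h0]
    · simp only [h0, ne_eq, not_false_eq_true, if_true]
      congr 1
      apply Finset.prod_congr rfl
      intro i _
      rw [if_neg]
      rintro ⟨rfl, h⟩
      exact h0 h
  · have hσ1 := hσ
    simp only [S4] at hσ1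
    simp [hσ1, hσ]

/-- Bordered determinant with one scaled entry. -/
lemma bm_lead_u (A : Matrix (Fin 5) (Fin 5) ℝ) {a b k d : Fin 5} {r C : Fin 3 → Fin 5}
    (hr : Comp r a b) (hC : Comp C k d) {s : ℝ} (hs : ∀ σ, s ≤ S4 A a r k C σ)
    (R : Fin 3 → Fin 5 → K) (c : Fin 3 → Fin 4 → ℂ) (e₀ : Fin 3)
    (hR : ∀ i j, Lead (R i ((Fin.cons k C : Fin 4 → Fin 5) j))
      (A (r i) ((Fin.cons k C : Fin 4 → Fin 5) j)) (c i j))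
    (h1 : ∀ σ, S4 A a r k C σ = s → σ 0 = e₀.succ →
      ∀ i, c i (σ i.succ) = gc (r i) ((Fin.cons k C : Fin 4 → Fin 5) (σ i.succ)))
    (h2 : (∃ σ, S4 A a r k C σ = s ∧ σ 0 = e₀.succ) ∨
      ((∃ σ, S4 A a r k C σ = s ∧ σ 0 ≠ 0) ∧
        ∀ i j, c i j = gc (r i) ((Fin.cons k C : Fin 4 → Fin 5) j))) :
    ∃ L₁ L₂ : ℂ, (L₁ ≠ 0 ∨ L₂ ≠ 0) ∧ ∀ u : ℂ, Lead (bm 0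
      (fun j => HahnSeries.single (A a (C j)) ((if j = e₀ then u else 1) * gc a (C j)))
      R k C).det s (u * L₁ + L₂) := by
  classical
  -- the coefficients without the scaling
  let cc : Fin 4 → Fin 4 → ℂ := fun i j =>
    (Fin.cons (fun j => gc a ((Fin.cons k C : Fin 4 → Fin 5) j)) c : Fin 4 → Fin 4 → ℂ) i j
  let T : Equiv.Perm (Fin 4) → ℂ := fun σ => ((Equiv.Perm.sign σ : ℤ) : ℂ) * ∏ i, cc i (σ i)
  let g : Equiv.Perm (Fin 4) → ℂ := fun σ => ((Equiv.Perm.sign σ : ℤ) : ℂ) *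
    ∏ i, gc ((Fin.cons a r : Fin 4 → Fin 5) i) ((Fin.cons k C : Fin 4 → Fin 5) (σ i))
  let F₁ := Finset.univ.filter fun σ => S4 A a r k C σ = s ∧ σ 0 = e₀.succ
  let F₂ := Finset.univ.filter fun σ => S4 A a r k C σ = s ∧ σ 0 ≠ 0 ∧ σ 0 ≠ e₀.succ
  have hTg : ∀ σ, (∀ i, c i (σ i.succ) = gc (r i) ((Fin.cons k C : Fin 4 → Fin 5) (σ i.succ))) →
      T σ = g σ := by
    intro σ h
    simp only [T, g]
    congr 1
    rw [Fin.prod_univ_succ, Fin.prod_univ_succ (n := 3)]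
    simp only [cc, Fin.cons_zero, Fin.cons_succ, h]
  have hF₁ : F₁.Nonempty → ∑ σ ∈ F₁, T σ ≠ 0 := by
    intro hne
    rw [Finset.sum_congr rfl (g := g)]
    · exact gc_sum_ne _ _ hr.inj4 hC.inj4 F₁ hne
    · intro σ hσ
      simp only [F₁, Finset.mem_filter, Finset.mem_univ, true_and] at hσ
      exact hTg σ (h1 σ hσ.1 hσ.2)
  refine ⟨∑ σ ∈ F₁, T σ, ∑ σ ∈ F₂, T σ, ?_, ?_⟩
  · rcases h2 with ⟨σ, hσ⟩ | ⟨⟨σ, hσ, hσ0⟩, hc⟩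
    · exact Or.inl (hF₁ ⟨σ, by simpa [F₁] using hσ⟩)
    · by_cases he : σ 0 = e₀.succ
      · exact Or.inl (hF₁ ⟨σ, by simpa [F₁] using ⟨hσ, he⟩⟩)
      · right
        rw [Finset.sum_congr rfl (g := g)]
        · exact gc_sum_ne _ _ hr.inj4 hC.inj4 F₂ ⟨σ, by simpa [F₂] using ⟨hσ, hσ0, he⟩⟩
        · intro σ _
          exact hTg σ (fun i => hc _ _)
  · intro u
    let f : Fin 4 → ℂ := Fin.cons 0 (fun j => if j = e₀ then u else 1)
    have h := det_lead (bm 0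
      (fun j => HahnSeries.single (A a (C j)) ((if j = e₀ then u else 1) * gc a (C j))) R k C)
      (fun i j => A ((Fin.cons a r : Fin 4 → Fin 5) i) ((Fin.cons k C : Fin 4 → Fin 5) j))
      (fun i j => (if i = 0 then f j else 1) * cc i j)
      (fun i j => by
        refine Fin.cases ?_ (fun i => ?_) i
        · refine Fin.cases ?_ (fun j => ?_) j
          · simpa [bm, f] using lead_zero _
          · simpa [bm, f, cc] using lead_single _ _
        · have := hR i j
          revert this
          refine Fin.cases ?_ (fun j => ?_) j <;> intro this
          · simpa [bm, cc] using this
          · simpa [bm, cc] using this) s hs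
    convert h using 1
    rw [Finset.mul_sum, Finset.sum_filter, Finset.sum_filter, ← Finset.sum_add_distrib]
    apply Finset.sum_congr rfl
    intro σ _
    have hp : ∏ i, ((if i = 0 then f (σ i) else 1) * cc i (σ i)) = f (σ 0) * ∏ i, cc i (σ i) := by
      rw [Finset.prod_mul_distrib, Finset.prod_ite_eq' Finset.univ (0 : Fin 4)]
      simp
    rw [hp]
    by_cases hσ : S4 A a r k C σ = s
    · have hσ1 := hσ
      simp only [S4] at hσ1
      simp only [hσ1, hσ, if_true, true_and]
      by_cases h0 : σ 0 = 0
      · have : (0 : Fin 4) ≠ e₀.succ := (Fin.succ_ne_zero e₀).symm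
        simp [h0, f, this]
      · obtain ⟨j, hj⟩ := Fin.exists_succ_eq.mpr h0
        rw [← hj]
        by_cases hje : j = e₀
        · subst hje
          simp [f, T]; ring
        · simp [f, hje, T]
    · have hσ1 := hσ
      simp only [S4] at hσ1
      simp [hσ1, hσ]

lemma exists_u (L₁ L₂ M₁ M₂ : ℂ) (hL : L₁ ≠ 0 ∨ L₂ ≠ 0) (hM : M₁ ≠ 0 ∨ M₂ ≠ 0) :
    ∃ u : ℂ, u ≠ 0 ∧ u * L₁ + L₂ ≠ 0 ∧ u * M₁ + M₂ ≠ 0 := by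
  classical
  obtain ⟨u, hu⟩ := Infinite.exists_notMem_finset ({0, -L₂ / L₁, -M₂ / M₁} : Finset ℂ)
  simp only [Finset.mem_insert, Finset.mem_singleton, not_or] at hu
  have key : ∀ X Y : ℂ, (X ≠ 0 ∨ Y ≠ 0) → u ≠ -Y / X → u * X + Y ≠ 0 := by
    intro X Y h h' h0
    by_cases hX : X = 0
    · subst hX
      simp only [mul_zero, zero_add] at h0
      simp [h0] at h
    · apply h'
      rw [eq_div_iff hX]
      linear_combination h0
  exact ⟨u, hu.1, key _ _ hL hu.2.1, key _ _ hM hu.2.2⟩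

lemma row_u (A : Matrix (Fin 5) (Fin 5) ℝ) {a c d : Fin 5} {C : Fin 3 → Fin 5}
    (hC : Comp C c d) (R : Fin 3 → Fin 5 → K) (e₀ : Fin 3) (q : ℝ)
    (hq : ∃ δ, δ ≠ 0 ∧ Lead (mm R C).det q δ)
    (hc : ∃ L₁ L₂ : ℂ, (L₁ ≠ 0 ∨ L₂ ≠ 0) ∧ ∀ u : ℂ, Lead (bm 0
      (fun j => HahnSeries.single (A a (C j)) ((if j = e₀ then u else 1) * gc a (C j)))
      R c C).det (A a c + q) (u * L₁ + L₂))
    (hd : ∃ L₁ L₂ : ℂ, (L₁ ≠ 0 ∨ L₂ ≠ 0) ∧ ∀ u : ℂ, Lead (bm 0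
      (fun j => HahnSeries.single (A a (C j)) ((if j = e₀ then u else 1) * gc a (C j)))
      R d C).det (A a d + q) (u * L₁ + L₂)) :
    ∃ y : Fin 5 → K, (∀ k, y k ≠ 0 ∧ (y k).order = A a k) ∧
      ∃ c : Fin 3 → K, ∀ k, y k = ∑ i, c i * R i k := by
  obtain ⟨L₁, L₂, hL, hc⟩ := hc
  obtain ⟨M₁, M₂, hM, hd⟩ := hd
  obtain ⟨u, hu, huL, huM⟩ := exists_u L₁ L₂ M₁ M₂ hL hM
  refine row_complete (A a) R C
    (fun j => HahnSeries.single (A a (C j)) ((if j = e₀ then u else 1) * gc a (C j)))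
    (fun j => ⟨_, ?_, lead_single _ _⟩) q hq (fun k hk => ?_)
  · refine mul_ne_zero ?_ (gc_ne _ _)
    split_ifs
    · exact hu
    · exact one_ne_zero
  · rcases hC.cover k hk with rfl | rfl
    · exact ⟨_, huL, hc u⟩
    · exact ⟨_, huM, hd u⟩

lemma rank_of_rows (B : Matrix (Fin 5) (Fin 5) K) (R : Fin 3 → Fin 5 → K)
    (h : ∀ i, ∃ c : Fin 3 → K, ∀ k, B i k = ∑ j, c j * R j k) : B.rank ≤ 3 := by
  choose c hc using h
  have : B = (Matrix.of c : Matrix (Fin 5) (Fin 3) K) * (Matrix.of R : Matrix (Fin 3) (Fin 5) K) := by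
    ext i k
    rw [Matrix.mul_apply, hc]
    rfl
  rw [this]
  refine (Matrix.rank_mul_le_left _ _).trans ?_
  exact Matrix.rank_le_width _

/-- The conclusion of the main theorem. -/
def Goal (A : Matrix (Fin 5) (Fin 5) ℝ) : Prop :=
  ∃ B : Matrix (Fin 5) (Fin 5) K, IsLift A B ∧ B.rank ≤ 3

lemma G_ok (A : Matrix (Fin 5) (Fin 5) ℝ) (i k : Fin 5) :
    G A i k ≠ 0 ∧ (G A i k).order = A i k :=
  ⟨(lead_G A i k).ne_zero (gc_ne i k), (lead_G A i k).order_eq (gc_ne i k)⟩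

lemma row_in_self (R : Fin 3 → Fin 5 → K) (j : Fin 3) :
    ∃ c : Fin 3 → K, ∀ k, R j k = ∑ i, c i * R i k :=
  ⟨Pi.single j 1, fun k => by simp [Pi.single_apply]⟩

lemma row_generic (A : Matrix (Fin 5) (Fin 5) ℝ) {a b c d : Fin 5} {r C : Fin 3 → Fin 5}
    (hr : Comp r a b) (hC : Comp C c d) (h1 : HasArc A b d a c) (h2 : HasArc A b c a d) :
    ∃ y : Fin 5 → K, (∀ k, y k ≠ 0 ∧ (y k).order = A a k) ∧
      ∃ c : Fin 3 → K, ∀ k, y k = ∑ i, c i * G A (r i) k := by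
  obtain ⟨q, hq, hs, h0, _, _⟩ := arc_q A hr hC h1
  obtain ⟨q', hq', hs', h0', _, _⟩ := arc_q A hr hC.symm h2
  have := hq'.unique hq
  subst this
  refine row_u A hC (fun i => G A (r i)) 0 q' (mm_lead A hr.inj hC.inj hq _ fun _ _ => rfl) ?_ ?_
  · exact bm_lead_u A hr hC hs _ (fun i j => gc (r i) ((Fin.cons c C : Fin 4 → Fin 5) j)) 0
      (fun i j => lead_G A _ _) (fun _ _ _ _ => rfl) (Or.inr ⟨h0, fun _ _ => rfl⟩)
  · exact bm_lead_u A hr hC.symm hs' _ (fun i j => gc (r i) ((Fin.cons d C : Fin 4 → Fin 5) j)) 0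
      (fun i j => lead_G A _ _) (fun _ _ _ _ => rfl) (Or.inr ⟨h0', fun _ _ => rfl⟩)

theorem row_recipe (A : Matrix (Fin 5) (Fin 5) ℝ) {a b c d c' d' : Fin 5}
    (hab : a ≠ b) (hcd : c ≠ d) (hcd' : c' ≠ d')
    (h1 : HasArc A b d a c) (h2 : HasArc A b c a d)
    (h3 : HasArc A a d' b c') (h4 : HasArc A a c' b d') : Goal A := by
  obtain ⟨r, hr⟩ := comp_exists hab
  obtain ⟨C, hC⟩ := comp_exists hcd
  obtain ⟨C', hC'⟩ := comp_exists hcd'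
  obtain ⟨ya, hya, hya'⟩ := row_generic A hr hC h1 h2
  obtain ⟨yb, hyb, hyb'⟩ := row_generic A hr.symm hC' h3 h4
  refine ⟨fun i k => if i = a then ya k else if i = b then yb k else G A i k, ?_, ?_⟩
  · intro i k
    by_cases hia : i = a
    · subst hia; simpa using hya k
    · by_cases hib : i = b
      · subst hib; simpa [hia] using hyb k
      · simpa [hia, hib] using G_ok A i k
  · apply rank_of_rows _ (fun i => G A (r i))
    intro i
    by_cases hia : i = a
    · subst hia; simpa using hya'
    · by_cases hib : i = b
      · subst hib; simpa [hia] using hyb'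
      · have : ∃ j, r j = i := by
          by_contra hne
          push Not at hne
          rcases hr.cover i hne with h | h
          · exact hia h
          · exact hib h
        obtain ⟨j, rfl⟩ := this
        simpa [hia, hib] using row_in_self (fun i => G A (r i)) j

/-! ### Transposition -/

lemma sum_perm_inv (A : Matrix (Fin 5) (Fin 5) ℝ) (π : Equiv.Perm (Fin 5)) :
    ∑ k, A.transpose k (π⁻¹ k) = ∑ k, A k (π k) := by
  rw [← Equiv.sum_comp π]
  simp

lemma isMinP_transpose {A : Matrix (Fin 5) (Fin 5) ℝ} {b d : Fin 5} {π : Equiv.Perm (Fin 5)}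
    (h : IsMinP A b d π) : IsMinP A.transpose d b π⁻¹ := by
  refine ⟨by rw [Equiv.Perm.inv_eq_iff_eq]; exact h.1.symm, fun π' h' => ?_⟩
  have h2 := h.2 π'⁻¹ (by rw [Equiv.Perm.inv_eq_iff_eq]; exact h'.symm)
  rw [sum_perm_inv]
  have h3 := sum_perm_inv A π'⁻¹
  rw [inv_inv] at h3
  rw [h3]; exact h2

lemma hasArc_transpose {A : Matrix (Fin 5) (Fin 5) ℝ} {b d a k : Fin 5} (h : HasArc A b d a k) :
    HasArc A.transpose d b k a := by
  obtain ⟨⟨π, h1, h2⟩, π', h3, h4⟩ := h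
  refine ⟨⟨_, isMinP_transpose h1, ?_⟩, _, isMinP_transpose h3, ?_⟩
  · rw [Equiv.Perm.inv_eq_iff_eq]; exact h2.symm
  · rw [Ne, Equiv.Perm.inv_eq_iff_eq]; exact fun h => h4 h.symm

lemma goal_transpose {A : Matrix (Fin 5) (Fin 5) ℝ} (h : Goal A.transpose) : Goal A := by
  obtain ⟨B, h1, h2⟩ := h
  exact ⟨B.transpose, fun i j => h1 j i, by rw [Matrix.rank_transpose]; exact h2⟩

theorem col_recipe (A : Matrix (Fin 5) (Fin 5) ℝ) {a b c d c' d' : Fin 5}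
    (hab : a ≠ b) (hcd : c ≠ d) (hcd' : c' ≠ d')
    (h1 : HasArc A d b c a) (h2 : HasArc A c b d a)
    (h3 : HasArc A d' a c' b) (h4 : HasArc A c' a d' b) : Goal A :=
  goal_transpose (row_recipe A.transpose hab hcd hcd' (hasArc_transpose h1) (hasArc_transpose h2)
    (hasArc_transpose h3) (hasArc_transpose h4))

/-! ### The third recipe -/

lemma bm_swap (x y : K) (vx vy w₁ w₂ : Fin 5 → K) (k : Fin 5) (C : Fin 3 → Fin 5)
    (hx : vx k = x) (hy : vy k = y) :
    (bm y (fun j => vy (C j)) ![vx, w₁, w₂] k C).det =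
      -(bm x (fun j => vx (C j)) ![vy, w₁, w₂] k C).det := by
  have h := Matrix.det_permute (Equiv.swap (0 : Fin 4) 1)
    (bm x (fun j => vx (C j)) ![vy, w₁, w₂] k C)
  have h2 : (bm x (fun j => vx (C j)) ![vy, w₁, w₂] k C).submatrix (Equiv.swap (0 : Fin 4) 1) id =
      bm y (fun j => vy (C j)) ![vx, w₁, w₂] k C := by
    ext i j : 2
    subst hx hy
    fin_cases i <;> fin_cases j <;> rfl
  rw [h2] at h
  rw [h, Equiv.Perm.sign_swap (by decide)]
  simp only [Units.val_neg, Units.val_one, Int.cast_neg, Int.cast_one]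
  ring

theorem p4_recipe (A : Matrix (Fin 5) (Fin 5) ℝ) {i₁ i₂ r k₀ m k₁ e : Fin 5}
    (h12 : i₁ ≠ i₂) (h1r : i₁ ≠ r) (h2r : i₂ ≠ r) (hmk : m ≠ k₀) (hk : k₁ ≠ k₀)
    (hek0 : e ≠ k₀) (hek1 : e ≠ k₁)
    (hA : HasArc A i₁ m r k₀) (hB : HasArc A i₁ k₀ i₂ m) (hC : HasArc A i₂ k₀ i₁ k₁)
    (hD : ∃ π, IsMinP A i₂ k₁ π ∧ π i₁ = k₀) (hE : ∃ π, IsMinP A i₂ k₁ π ∧ π i₁ = e)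
    (hbad : ∀ π, IsMinP A i₂ k₁ π → π i₁ = e → π r ≠ k₀) : Goal A := by
  obtain ⟨r1, r2, ⟨hr12, hr1r, hr2r⟩, ⟨ha1, ha2, hb1, hb2⟩, hall⟩ := comp_aux i₁ i₂ r h12 h1r h2r
  have hrR : Comp ![r, r1, r2] i₁ i₂ := by
    refine ⟨h12, ?_, ?_, ?_⟩
    · intro i j hij
      fin_cases i <;> fin_cases j <;> simp_all
    · intro i
      fin_cases i
      · exact ⟨h1r.symm, h2r.symm⟩
      · exact ⟨ha1.symm, hb1.symm⟩
      · exact ⟨ha2.symm, hb2.symm⟩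
    · intro k hk'
      have e0 := hk' 0
      have e1 := hk' 1
      have e2 := hk' 2
      rcases hall k with h | h | h | h | h
      · exact Or.inl h
      · exact Or.inr h
      · exact absurd h.symm e0
      · exact absurd h.symm e1
      · exact absurd h.symm e2
  have hrA : Comp ![i₂, r1, r2] r i₁ := by
    refine ⟨h1r.symm, ?_, ?_, ?_⟩
    · intro i j hij
      fin_cases i <;> fin_cases j <;> simp_all
    · intro i
      fin_cases i
      · exact ⟨h2r, h12.symm⟩
      · exact ⟨hr1r, ha1.symm⟩
      · exact ⟨hr2r, ha2.symm⟩
    · intro k hk'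
      have e0 := hk' 0
      have e1 := hk' 1
      have e2 := hk' 2
      rcases hall k with h | h | h | h | h
      · exact Or.inr h
      · exact absurd h.symm e0
      · exact Or.inl h
      · exact absurd h.symm e1
      · exact absurd h.symm e2
  obtain ⟨C, hCC⟩ := comp_exists hmk.symm
  obtain ⟨C1, hC1, hC1e⟩ := comp_exists3 hk.symm hek0 hek1
  -- Step A
  obtain ⟨q, hq, hs, h0, _, _⟩ := arc_q A hrA hCC hA
  obtain ⟨δ, hδ, hDA⟩ := mm_lead A hrA.inj hCC.inj hq ![G A i₂, G A r1, G A r2]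
    (fun i j => by fin_cases i <;> rfl)
  obtain ⟨η, hη, hNA⟩ := bm_lead_gen A hrA hCC hs h0 ![G A i₂, G A r1, G A r2]
    (fun i j => by fin_cases i <;> rfl) (fun i => by fin_cases i <;> rfl)
  obtain ⟨ξ, hξ, hx⟩ := hNA.neg.div (neg_ne_zero.mpr hη) hDA hδ
  rw [add_sub_cancel_right] at hx
  have hdetA : (bm (-(bm 0 (fun j => G A r (C j)) ![G A i₂, G A r1, G A r2] k₀ C).det /
      (mm ![G A i₂, G A r1, G A r2] C).det) (fun j => G A r (C j))
        ![G A i₂, G A r1, G A r2] k₀ C).det = 0 := by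
    rw [bm_det, div_mul_cancel₀ _ (hDA.ne_zero hδ)]; ring
  generalize -(bm 0 (fun j => G A r (C j)) ![G A i₂, G A r1, G A r2] k₀ C).det /
      (mm ![G A i₂, G A r1, G A r2] C).det = x at hx hdetA
  let Vr : Fin 5 → K := fun k => if k = k₀ then x else G A r k
  have hVr : ∀ k, k ≠ k₀ → Vr k = G A r k := fun k hk => if_neg hk
  have hVr0 : Vr k₀ = x := if_pos rfl
  have hVrC : (fun j => Vr (C j)) = fun j => G A r (C j) :=
    funext fun j => hVr _ (hCC.av j).1
  -- Step B
  obtain ⟨q', hq', hs', h0', _, _⟩ := arc_q A hrR.symm hCC.symm hB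
  have hRgen : ∀ i k, k ≠ k₀ → (![Vr, G A r1, G A r2] : Fin 3 → Fin 5 → K) i k =
      G A ((![r, r1, r2] : Fin 3 → Fin 5) i) k := by
    intro i k hk
    fin_cases i
    · exact hVr k hk
    · rfl
    · rfl
  obtain ⟨δ', hδ', hDB⟩ := mm_lead A hrR.inj hCC.inj hq' ![Vr, G A r1, G A r2]
    (fun i j => hRgen i _ (hCC.av j).1)
  obtain ⟨η', hη', hNB⟩ := bm_lead_gen A hrR.symm hCC.symm hs' h0' ![Vr, G A r1, G A r2]
    (fun i j => hRgen i _ (hCC.av j).1) (fun i => hRgen i _ hmk)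
  obtain ⟨ζ, hζ, hy⟩ := hNB.neg.div (neg_ne_zero.mpr hη') hDB hδ'
  rw [add_sub_cancel_right] at hy
  have hdetB : (bm (-(bm 0 (fun j => G A i₂ (C j)) ![Vr, G A r1, G A r2] m C).det /
      (mm ![Vr, G A r1, G A r2] C).det) (fun j => G A i₂ (C j))
        ![Vr, G A r1, G A r2] m C).det = 0 := by
    rw [bm_det, div_mul_cancel₀ _ (hDB.ne_zero hδ')]; ring
  generalize -(bm 0 (fun j => G A i₂ (C j)) ![Vr, G A r1, G A r2] m C).det /
      (mm ![Vr, G A r1, G A r2] C).det = y at hy hdetB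
  let V2 : Fin 5 → K := fun k => if k = m then y else G A i₂ k
  have hV2 : ∀ k, k ≠ m → V2 k = G A i₂ k := fun k hk => if_neg hk
  have hV2m : V2 m = y := if_pos rfl
  have hV2C : (fun j => V2 (C j)) = fun j => G A i₂ (C j) :=
    funext fun j => hV2 _ (hCC.av j).2
  have hV2span : ∃ c : Fin 3 → K, ∀ k, V2 k =
      ∑ i, c i * (![Vr, G A r1, G A r2] : Fin 3 → Fin 5 → K) i k := by
    apply span_of_det _ _ C (hDB.ne_zero hδ')
    intro k
    rw [hV2C]
    by_cases hkC : ∃ j, C j = k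
    · obtain ⟨j, rfl⟩ := hkC
      rw [hV2 _ (hCC.av j).2]
      exact bm_repeat (fun j => G A i₂ (C j)) _ C j
    · push Not at hkC
      rcases hCC.cover k hkC with rfl | rfl
      · rw [hV2 _ hmk.symm]
        rw [bm_swap x (G A i₂ k) Vr (G A i₂) (G A r1) (G A r2) k C hVr0 rfl, hVrC, hdetA, neg_zero]
      · rw [hV2m]; exact hdetB
  -- Step C
  have hDC : HasArc A i₂ k₁ i₁ k₀ := by
    refine ⟨hD, ?_⟩
    obtain ⟨π, h1, h2⟩ := hE
    exact ⟨π, h1, by rw [h2]; exact hek0⟩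
  obtain ⟨q1, hq1, hs1, h01, _, _⟩ := arc_q A hrR hC1.symm hC
  obtain ⟨q0, hq0, hs0, _, hf0, hb0⟩ := arc_q A hrR hC1 hDC
  have := hq1.unique hq0
  subst this
  obtain ⟨Y, hY, hYspan⟩ := row_u A (a := i₁) hC1 ![Vr, G A r1, G A r2] 0 q1
    (mm_lead A hrR.inj hC1.inj hq0 _ (fun i j => hRgen i _ (hC1.av j).1))
    (by
      refine bm_lead_u A hrR hC1 hs0 _ (fun i j => if i = 0 ∧ j = 0 then ξ else
        gc ((![r, r1, r2] : Fin 3 → Fin 5) i) ((Fin.cons k₀ C1 : Fin 4 → Fin 5) j)) 0 ?_ ?_ ?_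
      · intro i j
        by_cases hij : i = 0 ∧ j = 0
        · obtain ⟨rfl, rfl⟩ := hij
          simpa [hVr0] using hx
        · rw [if_neg hij]
          by_cases hj : j = 0
          · subst hj
            have hi : i ≠ 0 := fun h => hij ⟨h, rfl⟩
            fin_cases i
            · exact absurd rfl hi
            · exact lead_G A _ _
            · exact lead_G A _ _
          · obtain ⟨j', rfl⟩ := Fin.exists_succ_eq.mpr hj
            rw [Fin.cons_succ, hRgen i _ (hC1.av j').1]
            exact lead_G A _ _
      · intro σ hσ hσ0 i
        rw [if_neg]
        rintro ⟨rfl, hj⟩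
        obtain ⟨π, hπ, hπσ⟩ := hb0 σ hσ
        have e1 := hπσ 0
        have e2 := hπσ (Fin.succ 0)
        rw [hσ0] at e1
        rw [hj] at e2
        simp only [Fin.cons_zero, Fin.cons_succ, hC1e] at e1 e2
        exact hbad π hπ e1 e2
      · left
        obtain ⟨π, hπ, hπe⟩ := hE
        obtain ⟨σ, hσ, hσπ⟩ := hf0 π hπ
        refine ⟨σ, hσ, ?_⟩
        have e1 := hσπ 0
        apply hC1.inj4
        rw [← e1]
        simp [hπe, hC1e])
    (by
      refine bm_lead_u A hrR hC1.symm hs1 _ (fun i j =>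
        gc ((![r, r1, r2] : Fin 3 → Fin 5) i) ((Fin.cons k₁ C1 : Fin 4 → Fin 5) j)) 0 ?_
        (fun _ _ _ _ => rfl) (Or.inr ⟨h01, fun _ _ => rfl⟩)
      intro i j
      refine Fin.cases ?_ (fun j => ?_) j
      · rw [Fin.cons_zero, hRgen i _ hk]; exact lead_G A _ _
      · rw [Fin.cons_succ, hRgen i _ (hC1.av j).1]; exact lead_G A _ _)
  refine ⟨fun i k => if i = i₁ then Y k else if i = i₂ then V2 k else if i = r then Vr k else
    G A i k, ?_, ?_⟩
  · intro i k
    by_cases hi1 : i = i₁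
    · subst hi1; simpa using hY k
    simp only [hi1, if_false]
    by_cases hi2 : i = i₂
    · subst hi2
      simp only [if_true]
      by_cases hkm : k = m
      · subst hkm; rw [hV2m]; exact ⟨hy.ne_zero hζ, hy.order_eq hζ⟩
      · rw [hV2 k hkm]; exact G_ok A _ _
    simp only [hi2, if_false]
    by_cases hi3 : i = r
    · subst hi3
      simp only [if_true]
      by_cases hkm : k = k₀
      · subst hkm; rw [hVr0]; exact ⟨hx.ne_zero hξ, hx.order_eq hξ⟩
      · rw [hVr k hkm]; exact G_ok A _ _
    simp only [hi3, if_false]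
    exact G_ok A _ _
  · apply rank_of_rows _ (![Vr, G A r1, G A r2] : Fin 3 → Fin 5 → K)
    intro i
    by_cases hi1 : i = i₁
    · subst hi1; simpa using hYspan
    simp only [hi1, if_false]
    by_cases hi2 : i = i₂
    · subst hi2
      simpa using hV2span
    simp only [hi2, if_false]
    by_cases hi3 : i = r
    · subst hi3
      simp only [if_true]
      exact row_in_self ![Vr, G A r1, G A r2] 0
    simp only [hi3, if_false]
    rcases hall i with h | h | h | h | h
    · exact absurd h hi1
    · exact absurd h hi2
    · exact absurd h hi3
    · subst h; exact row_in_self ![Vr, G A i, G A r2] 1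
    · subst h; exact row_in_self ![Vr, G A r1, G A i] 2

/-! ### Singularity and invariance -/

/-- Every class has two minimal permutations. -/
def Sing (A : Matrix (Fin 5) (Fin 5) ℝ) : Prop :=
  ∀ i j, ∃ π π', π ≠ π' ∧ IsMinP A i j π ∧ IsMinP A i j π'

lemma sing_of_minors (A : Matrix (Fin 5) (Fin 5) ℝ)
    (hsing : ∀ (r : Fin 4 → Fin 5) (c : Fin 4 → Fin 5),
      Function.Injective r → Function.Injective c → TropSingular (A.submatrix r c)) : Sing A := by
  intro i j
  have hr := Fin.succAbove_right_injective (p := i)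
  have hc := Fin.succAbove_right_injective (p := j)
  have hi : ∀ x, i.succAbove x ≠ i := fun x => Fin.succAbove_ne i x
  have hj : ∀ x, j.succAbove x ≠ j := fun x => Fin.succAbove_ne j x
  obtain ⟨σ, τ, hne, heq, hmin⟩ := hsing i.succAbove j.succAbove hr hc
  obtain ⟨s, h1, h2, h3⟩ := class_corr A hr hc hi hj
  simp only [Matrix.submatrix_apply] at heq hmin
  obtain ⟨π0, hπ0⟩ := exists_isMin A i j
  obtain ⟨σ0, hσ0, _⟩ := h2 π0 hπ0
  have hσs : ∑ x, A (i.succAbove x) (j.succAbove (σ x)) = s :=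
    le_antisymm (hσ0 ▸ hmin σ0) (h1 σ)
  obtain ⟨π, hπ, hπσ⟩ := h3 σ hσs
  obtain ⟨π', hπ', hπτ⟩ := h3 τ (heq ▸ hσs)
  refine ⟨π, π', ?_, hπ, hπ'⟩
  rintro rfl
  apply hne
  ext x : 1
  apply hc
  rw [← hπσ, ← hπτ]

lemma goal_of_renum (A : Matrix (Fin 5) (Fin 5) ℝ) (e f : Equiv.Perm (Fin 5))
    (h : Goal (A.submatrix e f)) : Goal A := by
  obtain ⟨B, h1, h2⟩ := h
  refine ⟨B.submatrix e.symm f.symm, fun i j => ?_, ?_⟩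
  · have := h1 (e.symm i) (f.symm j)
    simpa using this
  · rw [Matrix.rank_submatrix]; exact h2

lemma isMinP_renum (A : Matrix (Fin 5) (Fin 5) ℝ) (e f : Equiv.Perm (Fin 5)) {i j : Fin 5}
    {π : Equiv.Perm (Fin 5)} (h : IsMinP A (e i) (f j) π) :
    IsMinP (A.submatrix e f) i j (f⁻¹ * π * e) := by
  have hs : ∀ ρ : Equiv.Perm (Fin 5), ∑ k, (A.submatrix e f) k ((f⁻¹ * ρ * e) k) =
      ∑ k, A k (ρ k) := by
    intro ρ
    rw [← Equiv.sum_comp e (fun k => A k (ρ k))]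
    simp
  refine ⟨by simp [h.1], fun π' h' => ?_⟩
  rw [hs]
  have h2 := h.2 (f * π' * e⁻¹) (by simp [h'])
  rw [← hs (f * π' * e⁻¹)] at h2
  simpa [mul_assoc] using h2

lemma sing_renum {A : Matrix (Fin 5) (Fin 5) ℝ} (e f : Equiv.Perm (Fin 5)) (h : Sing A) :
    Sing (A.submatrix e f) := by
  intro i j
  obtain ⟨π, π', hne, h1, h2⟩ := h (e i) (f j)
  refine ⟨_, _, ?_, isMinP_renum A e f h1, isMinP_renum A e f h2⟩
  intro h
  apply hne
  simpa using h

/-- Subtracting potentials. -/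
def potM (A : Matrix (Fin 5) (Fin 5) ℝ) (u v : Fin 5 → ℝ) : Matrix (Fin 5) (Fin 5) ℝ :=
  fun i j => A i j - u i - v j

lemma goal_of_pot (A : Matrix (Fin 5) (Fin 5) ℝ) (u v : Fin 5 → ℝ)
    (h : Goal (potM A u v)) : Goal A := by
  obtain ⟨B, h1, h2⟩ := h
  refine ⟨Matrix.diagonal (fun i => HahnSeries.single (u i) (1 : ℂ)) * B *
    Matrix.diagonal (fun i => HahnSeries.single (v i) (1 : ℂ)), fun i j => ?_, ?_⟩
  · rw [Matrix.mul_diagonal, Matrix.diagonal_mul]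
    obtain ⟨h3, h4⟩ := h1 i j
    obtain ⟨c, hc, hl⟩ := lead_of_order h3
    have h5 := ((lead_single (u i) 1).mul hl).mul (lead_single (v j) 1)
    have hc' : 1 * c * 1 ≠ 0 := by simpa using hc
    refine ⟨h5.ne_zero hc', ?_⟩
    rw [h5.order_eq hc', h4]
    simp only [potM]; ring
  · refine (Matrix.rank_mul_le_left _ _).trans ((Matrix.rank_mul_le_right _ _).trans h2)

lemma sing_pot {A : Matrix (Fin 5) (Fin 5) ℝ} (u v : Fin 5 → ℝ) (h : Sing A) :
    Sing (potM A u v) := by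
  have hs : ∀ ρ : Equiv.Perm (Fin 5), ∑ k, potM A u v k (ρ k) =
      ∑ k, A k (ρ k) - ∑ k, u k - ∑ k, v k := by
    intro ρ
    simp only [potM, Finset.sum_sub_distrib]
    rw [Equiv.sum_comp ρ v]
  have hm : ∀ i j π, IsMinP A i j π → IsMinP (potM A u v) i j π := by
    intro i j π hπ
    refine ⟨hπ.1, fun π' h' => ?_⟩
    rw [hs, hs]
    linarith [hπ.2 π' h']
  intro i j
  obtain ⟨π, π', hne, h1, h2⟩ := h i j
  exact ⟨π, π', hne, hm _ _ _ h1, hm _ _ _ h2⟩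

/-- Codes (base 5) of the permutations of five letters. -/
def permCodes : List Nat :=
  [2930, 2430, 2830, 1830, 2230, 1730, 2910, 2410, 2710, 1210, 2110, 1110, 2790, 1790, 2690, 1190, 1490, 990, 2170, 1670, 2070, 1070, 1470, 970, 2926, 2426, 2826, 1826, 2226, 1726, 2886, 2386, 2586, 586, 1986, 486, 2766, 1766, 2566, 566, 1366, 366, 2146, 1646, 1946, 446, 1346, 346, 2902, 2402, 2702, 1202, 2102, 1102, 2882, 2382, 2582, 582, 1982, 482, 2642, 1142, 2542, 542, 742, 242, 2022, 1022, 1922, 422, 722, 222, 2778, 1778, 2678, 1178, 1478, 978, 2758, 1758, 2558, 558, 1358, 358, 2638, 1138, 2538, 538, 738, 238, 1398, 898, 1298, 298, 698, 198, 2154, 1654, 2054, 1054, 1454, 954, 2134, 1634, 1934, 434, 1334, 334, 2014, 1014, 1914, 414, 714, 214, 1394, 894, 1294, 294, 694, 194]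

/-- For every class `(i, j)` the bit masks of the permutations with `i ↦ j` (bit `(i, j)` removed). -/
def maskTab : List (List (List Nat)) :=
  [[[17043520, 8917056, 16916544, 4726848, 8536128, 4472896, 17041536, 8915072, 16851072, 2629760, 8470656, 2375808, 16910592, 4720896, 16847104, 2625792, 4276480, 2244864, 8522240, 4459008, 8458752, 2363904, 4268544, 2236928],
    [17043488, 8917024, 16916512, 4726816, 8536096, 4472864, 17040512, 8914048, 16818304, 1581184, 8437888, 1327232, 16909568, 4719872, 16814336, 1577216, 4243712, 1196288, 8521216, 4457984, 8425984, 1315328, 4235776, 1188352],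
    [17041440, 8914976, 16850976, 2629664, 8470560, 2375712, 17040448, 8913984, 16818240, 1581120, 8437824, 1327168, 16844032, 2622720, 16812288, 1575168, 2146560, 1130752, 8455680, 2360832, 8423936, 1313280, 2138624, 1122816],
    [16910368, 4720672, 16846880, 2625568, 4276256, 2244640, 16909376, 4719680, 16814144, 1577024, 4243520, 1196096, 16843904, 2622592, 16812160, 1575040, 2146432, 1130624, 4261376, 2229760, 4229632, 1182208, 2134528, 1118720],
    [8521760, 4458528, 8458272, 2363424, 4268064, 2236448, 8520768, 4457536, 8425536, 1314880, 4235328, 1187904, 8455296, 2360448, 8423552, 1312896, 2138240, 1122432, 4261120, 2229504, 4229376, 1181952, 2134272, 1118464]],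
   [[17043458, 8916994, 16916482, 4726786, 8536066, 4472834, 17041412, 8914948, 16850948, 2629636, 8470532, 2375684, 16910344, 4720648, 16846856, 2625544, 4276232, 2244616, 8521744, 4458512, 8458256, 2363408, 4268048, 2236432],
    [17043457, 8916993, 16916481, 4726785, 8536065, 4472833, 17040388, 8913924, 16818180, 1581060, 8437764, 1327108, 16909320, 4719624, 16814088, 1576968, 4243464, 1196040, 8520720, 4457488, 8425488, 1314832, 4235280, 1187856],
    [17041409, 8914945, 16850945, 2629633, 8470529, 2375681, 17040386, 8913922, 16818178, 1581058, 8437762, 1327106, 16843784, 2622472, 16812040, 1574920, 2146312, 1130504, 8455184, 2360336, 8423440, 1312784, 2138128, 1122320],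
    [16910337, 4720641, 16846849, 2625537, 4276225, 2244609, 16909314, 4719618, 16814082, 1576962, 4243458, 1196034, 16843780, 2622468, 16812036, 1574916, 2146308, 1130500, 4260880, 2229264, 4229136, 1181712, 2134032, 1118224],
    [8521729, 4458497, 8458241, 2363393, 4268033, 2236417, 8520706, 4457474, 8425474, 1314818, 4235266, 1187842, 8455172, 2360324, 8423428, 1312772, 2138116, 1122308, 4260872, 2229256, 4229128, 1181704, 2134024, 1118216]],
   [[17039490, 8913026, 16908546, 4718850, 8520194, 4456962, 17039428, 8912964, 16843012, 2621700, 8454660, 2359812, 16908360, 4718664, 16842888, 2621576, 4260360, 2228744, 8519760, 4456528, 8454288, 2359440, 4260112, 2228496],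
    [17039489, 8913025, 16908545, 4718849, 8520193, 4456961, 17039396, 8912932, 16810244, 1573124, 8421892, 1311236, 16908328, 4718632, 16810120, 1573000, 4227592, 1180168, 8519728, 4456496, 8421520, 1310864, 4227344, 1179920],
    [17039425, 8912961, 16843009, 2621697, 8454657, 2359809, 17039394, 8912930, 16810242, 1573122, 8421890, 1311234, 16842792, 2621480, 16810056, 1572936, 2130440, 1114632, 8454192, 2359344, 8421456, 1310800, 2130192, 1114384],
    [16908353, 4718657, 16842881, 2621569, 4260353, 2228737, 16908322, 4718626, 16810114, 1572994, 4227586, 1180162, 16842788, 2621476, 16810052, 1572932, 2130436, 1114628, 4259888, 2228272, 4227152, 1179728, 2130064, 1114256],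
    [8519745, 4456513, 8454273, 2359425, 4260097, 2228481, 8519714, 4456482, 8421506, 1310850, 4227330, 1179906, 8454180, 2359332, 8421444, 1310788, 2130180, 1114372, 4259880, 2228264, 4227144, 1179720, 2130056, 1114248]],
   [[16785538, 8405122, 16781570, 4210946, 8393218, 4203010, 16785476, 8405060, 16779524, 2113796, 8391172, 2105860, 16781384, 4210760, 16779400, 2113672, 4196872, 2101768, 8392784, 4202576, 8390800, 2105488, 4196624, 2101520],
    [16785537, 8405121, 16781569, 4210945, 8393217, 4203009, 16785444, 8405028, 16778500, 1065220, 8390148, 1057284, 16781352, 4210728, 16778376, 1065096, 4195848, 1053192, 8392752, 4202544, 8389776, 1056912, 4195600, 1052944],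
    [16785473, 8405057, 16779521, 2113793, 8391169, 2105857, 16785442, 8405026, 16778498, 1065218, 8390146, 1057282, 16779304, 2113576, 16778312, 1065032, 2098696, 1051144, 8390704, 2105392, 8389712, 1056848, 2098448, 1050896],
    [16781377, 4210753, 16779393, 2113665, 4196865, 2101761, 16781346, 4210722, 16778370, 1065090, 4195842, 1053186, 16779300, 2113572, 16778308, 1065028, 2098692, 1051140, 4196400, 2101296, 4195408, 1052752, 2098320, 1050768],
    [8392769, 4202561, 8390785, 2105473, 4196609, 2101505, 8392738, 4202530, 8389762, 1056898, 4195586, 1052930, 8390692, 2105380, 8389700, 1056836, 2098436, 1050884, 4196392, 2101288, 4195400, 1052744, 2098312, 1050760]],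
   [[532610, 278658, 528642, 147714, 266754, 139778, 532548, 278596, 526596, 82180, 264708, 74244, 528456, 147528, 526472, 82056, 133640, 70152, 266320, 139344, 264336, 73872, 133392, 69904],
    [532609, 278657, 528641, 147713, 266753, 139777, 532516, 278564, 525572, 49412, 263684, 41476, 528424, 147496, 525448, 49288, 132616, 37384, 266288, 139312, 263312, 41104, 132368, 37136],
    [532545, 278593, 526593, 82177, 264705, 74241, 532514, 278562, 525570, 49410, 263682, 41474, 526376, 81960, 525384, 49224, 67080, 35336, 264240, 73776, 263248, 41040, 66832, 35088],
    [528449, 147521, 526465, 82049, 133633, 70145, 528418, 147490, 525442, 49282, 132610, 37378, 526372, 81956, 525380, 49220, 67076, 35332, 133168, 69680, 132176, 36944, 66704, 34960],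
    [266305, 139329, 264321, 73857, 133377, 69889, 266274, 139298, 263298, 41090, 132354, 37122, 264228, 73764, 263236, 41028, 66820, 35076, 133160, 69672, 132168, 36936, 66696, 34952]]]

/-- Kernel friendly list lookup. -/
def look {α : Type} (d : α) (l : List α) : Nat → α :=
  List.rec (motive := fun _ => Nat → α) (fun _ => d)
    (fun h _ ih n => Nat.rec (motive := fun _ => α) h (fun n' _ => ih n') n) l

/-- Evaluate a natural number before passing it on. -/
def forceN {α : Type} (x : Nat) (f : Nat → α) : α :=
  Nat.rec (motive := fun _ => α) (f 0) (fun n _ => f (Nat.succ n)) x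

def subm (m Q : Nat) : Bool := Nat.beq (Nat.land m Q) m

def tb (m n : Nat) : Bool := Nat.beq (Nat.land (Nat.shiftRight m n) 1) 1

def anyB (p : Nat → Bool) (l : List Nat) : Bool :=
  List.rec (motive := fun _ => Bool) false (fun h _ ih => cond (p h) true ih) l

/-- Number of list elements disjoint from `N`, as a unary check `≤ 1`. -/
def atMostOne (N : Nat) (l : List Nat) : Nat → Bool :=
  List.rec (motive := fun _ => Nat → Bool) (fun _ => true)
    (fun h _ ih c => cond (Nat.beq (Nat.land h N) 0)
      (Nat.rec (motive := fun _ => Bool) false (fun c' _ => ih c') c) (ih c)) l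

def cellM (i j : Nat) : List Nat := look [] (look [] maskTab i) j

def cellB (bl : List (List Nat)) (i j : Nat) : Nat := look 0 (look [] bl i) j

/-- There are tight permutations in class `(i, j)` using `(a, b)` and not using it. -/
def hasB (bl : List (List Nat)) (P i j a b : Nat) : Bool :=
  forceN (Nat.land P (cellB bl i j)) fun Q =>
  forceN (Nat.add (Nat.mul 5 a) b) fun e =>
    cond (anyB (fun m => cond (subm m Q) (tb m e) false) (cellM i j))
      (anyB (fun m => cond (subm m Q) (not (tb m e)) false) (cellM i j)) false

def exB (bl : List (List Nat)) (P i j a b : Nat) : Bool :=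
  forceN (Nat.land P (cellB bl i j)) fun Q =>
  forceN (Nat.add (Nat.mul 5 a) b) fun e =>
    anyB (fun m => cond (subm m Q) (tb m e) false) (cellM i j)

def badB (bl : List (List Nat)) (N i j a b c d : Nat) : Bool :=
  forceN (cellB bl i j) fun Q =>
  forceN (Nat.add (Nat.mul 5 a) b) fun e =>
  forceN (Nat.add (Nat.mul 5 c) d) fun f =>
    anyB (fun m => cond (tb m e) (cond (tb m f)
      (cond (subm m Q) (Nat.beq (Nat.land m N) 0) false) false) false) (cellM i j)

def all4 (a b c d : Bool) : Bool := cond a (cond b (cond c d false) false) false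

def rowB (bl : List (List Nat)) (P a b c d c' d' : Nat) : Bool :=
  cond (Nat.beq a b) false (cond (Nat.beq c d) false (cond (Nat.beq c' d') false
    (all4 (hasB bl P b d a c) (hasB bl P b c a d) (hasB bl P a d' b c') (hasB bl P a c' b d'))))

def colB (bl : List (List Nat)) (P a b c d c' d' : Nat) : Bool :=
  cond (Nat.beq a b) false (cond (Nat.beq c d) false (cond (Nat.beq c' d') false
    (all4 (hasB bl P d b c a) (hasB bl P c b d a) (hasB bl P d' a c' b) (hasB bl P c' a d' b))))

def p4B (bl : List (List Nat)) (P N i1 i2 r k0 m k1 e : Nat) : Bool :=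
  cond (Nat.beq i1 i2) false (cond (Nat.beq i1 r) false (cond (Nat.beq i2 r) false
  (cond (Nat.beq m k0) false (cond (Nat.beq k1 k0) false (cond (Nat.beq e k0) false
  (cond (Nat.beq e k1) false
    (cond (all4 (hasB bl P i1 m r k0) (hasB bl P i1 k0 i2 m) (hasB bl P i2 k0 i1 k1)
      (exB bl P i2 k1 i1 k0))
      (cond (exB bl P i2 k1 i1 e) (not (badB bl N i2 k1 i1 e r k0)) false) false)))))))

def goalB (P t s0 s1 s2 s3 s4 : Nat) : Bool :=
  all4 (tb P (5 * s0 + s1)) (tb P (5 * s1 + s0)) (tb P (5 * s2 + s3))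
    (cond (Nat.beq t 0) (tb P (5 * s3 + s2)) (cond (tb P (5 * s3 + s4)) (tb P (5 * s4 + s2)) false))

/-- Result of a partial run: failure, or the remaining certificate. -/
inductive Res where
  | bad : Res
  | ok : Nat → List Nat → Res

def guardR (b : Bool) (c : Nat) (r : List Nat) : Res := cond b (Res.ok c r) Res.bad

def dig (c s : Nat) : Nat := Nat.land (Nat.shiftRight c s) 31

/-- Check a leaf with tag `t` and remaining digits `c`. -/
def leafR (bl : List (List Nat)) (H : Nat) (fl : Bool) (P N t c : Nat) (r : List Nat) : Res :=
  forceN (dig c 0) fun x => forceN (dig c 5) fun y => forceN (dig c 10) fun w =>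
  cond (Nat.beq t 25)
    (guardR (all4 (Nat.blt x 25) (Nat.blt y 25) (Nat.blt w 25)
      (rowB bl P (x / 5) (x % 5) (y / 5) (y % 5) (w / 5) (w % 5))) (Nat.shiftRight c 15) r)
  (cond (Nat.beq t 27)
    (guardR (cond (Nat.blt x 25) (cond (tb H x)
      (forceN (cellB bl (x / 5) (x % 5)) fun B =>
        atMostOne N (List.rec (motive := fun _ => List Nat) []
          (fun h _ ih => cond (subm h B) (h :: ih) ih) (cellM (x / 5) (x % 5))) 1) false) false)
      (Nat.shiftRight c 5) r)
  (cond (Nat.beq t 26)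
    (guardR (all4 (Nat.blt x 25) (Nat.blt y 25) (Nat.blt w 25)
      (colB bl P (x / 5) (x % 5) (y / 5) (y % 5) (w / 5) (w % 5))) (Nat.shiftRight c 15) r)
  (cond (Nat.beq t 28)
    (guardR (all4 (Nat.blt x 25) (Nat.blt y 25) (Nat.blt w 25) (cond (Nat.blt (dig c 15) 5)
      (p4B bl P N (x / 5) (x % 5) (y / 5) (y % 5) (w / 5) (w % 5) (dig c 15)) false))
      (Nat.shiftRight c 20) r)
  (cond (Nat.beq t 29)
    (guardR (cond fl (cond (Nat.blt (x + 32 * (y % 4)) 120)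
      (forceN (look 0 permCodes (x + 32 * (y % 4))) fun s =>
      goalB P (y / 4) (s % 5) (s / 5 % 5) (s / 25 % 5) (s / 125 % 5) (s / 625 % 5)) false) false)
      (Nat.shiftRight c 10) r) Res.bad))))

/-- Run a certificate. -/
def runC (bl : List (List Nat)) (H : Nat) (fl : Bool) (fuel : Nat) :
    Nat → Nat → Nat → List Nat → Res :=
  Nat.rec (motive := fun _ => Nat → Nat → Nat → List Nat → Res) (fun _ _ _ _ => Res.bad)
    (fun _ ih P0 N0 c0 r0 =>
      forceN P0 fun P => forceN N0 fun N => forceN c0 fun c1 =>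
      (fun k : Nat → List Nat → Res => cond (Nat.beq c1 1)
          (List.rec (motive := fun _ => Res) Res.bad (fun h t _ => k h t) r0) (k c1 r0))
      fun c r =>
        forceN (dig c 0) fun t => forceN (Nat.shiftRight c 5) fun c' =>
          cond (Nat.blt t 25)
            (Res.rec (motive := fun _ => Res) Res.bad
              (fun c2 r2 => ih P (Nat.lor N (Nat.shiftLeft 1 t)) c2 r2)
              (ih (Nat.lor P (Nat.shiftLeft 1 t)) N c' r))
            (leafR bl H fl P N t c' r))
    fuel

def Res.isOk (r : Res) : Bool := Res.rec (motive := fun _ => Bool) false (fun _ _ => true) r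

def runOK (bl : List (List Nat)) (H : Nat) (fl : Bool) (fuel P N : Nat) (cert : List Nat) : Bool :=
  (runC bl H fl fuel P N 1 cert).isOk

/-! ### Soundness of the checker -/

lemma tb_eq (m n : Nat) : tb m n = m.testBit n := by
  unfold tb
  have h : Nat.land (Nat.shiftRight m n) 1 = (m >>> n) % 2 := by
    have := Nat.and_one_is_mod (m >>> n)
    exact this
  rw [h, Nat.testBit_eq_decide_div_mod_eq, Nat.shiftRight_eq_div_pow]
  rw [Bool.eq_iff_iff]
  simp

lemma forceN_eq {α : Type} (x : Nat) (f : Nat → α) : forceN x f = f x := by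
  cases x <;> rfl

lemma subm_iff (m Q : Nat) : subm m Q = true ↔ ∀ n, m.testBit n = true → Q.testBit n = true := by
  unfold subm
  rw [Nat.beq_eq]
  constructor
  · intro h n hn
    have h' : m &&& Q = m := h
    rw [← h', Nat.testBit_and] at hn
    simp_all
  · intro h
    show m &&& Q = m
    apply Nat.eq_of_testBit_eq
    intro n
    rw [Nat.testBit_and]
    cases hm : m.testBit n
    · simp
    · simp [h n hm]

lemma disj_iff (m N : Nat) : Nat.beq (Nat.land m N) 0 = true ↔
    ∀ n, m.testBit n = true → N.testBit n = false := by
  rw [Nat.beq_eq]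
  constructor
  · intro h n hn
    have h' : m &&& N = 0 := h
    have := congrArg (fun x => x.testBit n) h'
    simp [Nat.testBit_and, hn] at this
    exact this
  · intro h
    show m &&& N = 0
    apply Nat.eq_of_testBit_eq
    intro n
    rw [Nat.testBit_and]
    cases hm : m.testBit n
    · simp
    · simp [h n hm]

lemma anyB_iff (p : Nat → Bool) (l : List Nat) : anyB p l = true ↔ ∃ m ∈ l, p m = true := by
  induction l with
  | nil => simp [anyB]
  | cons h t ih =>
    have : anyB p (h :: t) = cond (p h) true (anyB p t) := rfl
    rw [this]
    cases hp : p h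
    · simp [hp, ih]
    · simp [hp]

lemma atMostOne_zero (N : Nat) (l : List Nat) (h : atMostOne N l 0 = true) :
    ∀ m ∈ l, Nat.beq (Nat.land m N) 0 = false := by
  induction l with
  | nil => simp
  | cons a t ih =>
    have e : atMostOne N (a :: t) 0 = cond (Nat.beq (Nat.land a N) 0) false (atMostOne N t 0) := rfl
    rw [e] at h
    cases hb : Nat.beq (Nat.land a N) 0
    · rw [hb] at h
      intro m hm
      rcases List.mem_cons.mp hm with rfl | hm
      · exact hb
      · exact ih h m hm
    · rw [hb] at h; simp at h

lemma atMostOne_one (N : Nat) (l : List Nat) (h : atMostOne N l 1 = true) :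
    ∀ m ∈ l, ∀ m' ∈ l, Nat.beq (Nat.land m N) 0 = true → Nat.beq (Nat.land m' N) 0 = true →
      m = m' := by
  induction l with
  | nil => simp
  | cons a t ih =>
    have e : atMostOne N (a :: t) 1 =
      cond (Nat.beq (Nat.land a N) 0) (atMostOne N t 0) (atMostOne N t 1) := rfl
    rw [e] at h
    intro m hm m' hm' h1 h2
    cases hb : Nat.beq (Nat.land a N) 0
    · rw [hb] at h
      rcases List.mem_cons.mp hm with rfl | hm
      · rw [h1] at hb; exact absurd hb (by simp)
      rcases List.mem_cons.mp hm' with rfl | hm'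
      · rw [h2] at hb; exact absurd hb (by simp)
      exact ih h m hm m' hm' h1 h2
    · rw [hb] at h
      have h0 := atMostOne_zero N t h
      rcases List.mem_cons.mp hm with rfl | hm
      · rcases List.mem_cons.mp hm' with rfl | hm'
        · rfl
        · rw [h0 m' hm'] at h2; exact absurd h2 (by simp)
      · rw [h0 m hm] at h1; exact absurd h1 (by simp)

/-! Facts about the tables. -/

/-- The mask of a permutation code, with row `i` removed. -/
def mkMask (i c : Nat) : Nat :=
  ((List.range 5).map fun k => if k = i then 0 else 2 ^ (5 * k + c / 5 ^ k % 5)).sum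

theorem tab_mask : ∀ i < 5, ∀ j < 5, cellM i j =
    (permCodes.filter fun c => c / 5 ^ i % 5 == j).map (mkMask i) := by decide +kernel

theorem tab_bits : ∀ c ∈ permCodes, ∀ i < 5, mkMask i c < 2 ^ 25 ∧ ∀ k < 5, ∀ l < 5,
    tb (mkMask i c) (5 * k + l) = (k != i && c / 5 ^ k % 5 == l) := by decide +kernel

theorem tab_inj : ∀ c ∈ permCodes, ∀ k < 5, ∀ l < 5, c / 5 ^ k % 5 = c / 5 ^ l % 5 → k = l := by
  decide +kernel

/-- Completeness of the list of codes, as a Boolean. -/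
def allCodesB : Bool :=
  (List.range 5).all fun a => (List.range 5).all fun b => (List.range 5).all fun c =>
    (List.range 5).all fun d => (List.range 5).all fun e =>
      a == b || a == c || a == d || a == e || b == c || b == d || b == e || c == d || c == e ||
        d == e || permCodes.contains (a + 5 * b + 25 * c + 125 * d + 625 * e)

theorem allCodesB_true : allCodesB = true := by decide +kernel

theorem tab_all (a b c d e : Nat) (ha : a < 5) (hb : b < 5) (hc : c < 5) (hd : d < 5) (he : e < 5)
    (h : a ≠ b ∧ a ≠ c ∧ a ≠ d ∧ a ≠ e ∧ b ≠ c ∧ b ≠ d ∧ b ≠ e ∧ c ≠ d ∧ c ≠ e ∧ d ≠ e) :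
    (a + 5 * b + 25 * c + 125 * d + 625 * e) ∈ permCodes := by
  have h0 := allCodesB_true
  unfold allCodesB at h0
  simp only [List.all_eq_true, List.mem_range] at h0
  have h1 := h0 a ha b hb c hc d hd e he
  simp only [Bool.or_eq_true, beq_iff_eq, List.contains_iff_mem] at h1
  tauto

theorem tab_len : permCodes.length = 120 := by decide +kernel

/-- `m` is the mask of `π` in the class with row `i`. -/
def MaskOf (i : Fin 5) (π : Equiv.Perm (Fin 5)) (m : Nat) : Prop :=
  (∀ k l : Fin 5, m.testBit (5 * k + l) = true ↔ (k ≠ i ∧ π k = l)) ∧ m < 2 ^ 25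

lemma code_perm {c : Nat} (hc : c ∈ permCodes) :
    ∃ π : Equiv.Perm (Fin 5), ∀ k : Fin 5, (π k : ℕ) = c / 5 ^ (k : ℕ) % 5 := by
  let f : Fin 5 → Fin 5 := fun k => ⟨c / 5 ^ (k : ℕ) % 5, Nat.mod_lt _ (by norm_num)⟩
  have hf : Function.Injective f := by
    intro k l h
    apply Fin.ext
    exact tab_inj c hc k k.2 l l.2 (by simpa [f] using h)
  exact ⟨Equiv.ofBijective f (Finite.injective_iff_bijective.mp hf), fun k => rfl⟩

lemma perm_code (π : Equiv.Perm (Fin 5)) :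
    ∃ c ∈ permCodes, ∀ k : Fin 5, c / 5 ^ (k : ℕ) % 5 = (π k : ℕ) := by
  have hne : ∀ a b : Fin 5, a ≠ b → (π a : ℕ) ≠ (π b : ℕ) := by
    intro a b hab h
    exact hab (π.injective (Fin.ext h))
  have h0 := (π 0).2
  have h1 := (π 1).2
  have h2 := (π 2).2
  have h3 := (π 3).2
  have h4 := (π 4).2
  refine ⟨_, tab_all (π 0) (π 1) (π 2) (π 3) (π 4) h0 h1 h2 h3 h4
    ⟨hne _ _ (by decide), hne _ _ (by decide), hne _ _ (by decide), hne _ _ (by decide),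
      hne _ _ (by decide), hne _ _ (by decide), hne _ _ (by decide), hne _ _ (by decide),
      hne _ _ (by decide), hne _ _ (by decide)⟩, ?_⟩
  intro k
  fin_cases k
  · show _ / 5 ^ 0 % 5 = ((π 0 : Fin 5) : ℕ); omega
  · show _ / 5 ^ 1 % 5 = ((π 1 : Fin 5) : ℕ); omega
  · show _ / 5 ^ 2 % 5 = ((π 2 : Fin 5) : ℕ); omega
  · show _ / 5 ^ 3 % 5 = ((π 3 : Fin 5) : ℕ); omega
  · show _ / 5 ^ 4 % 5 = ((π 4 : Fin 5) : ℕ); omega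

lemma mkMask_of {c : Nat} (hc : c ∈ permCodes) (π : Equiv.Perm (Fin 5)) (i : Fin 5)
    (h : ∀ k : Fin 5, c / 5 ^ (k : ℕ) % 5 = (π k : ℕ)) : MaskOf i π (mkMask i c) := by
  obtain ⟨h1, h2⟩ := tab_bits c hc i i.2
  refine ⟨fun k l => ?_, h1⟩
  rw [← tb_eq, h2 k k.2 l l.2, h k]
  simp [Fin.ext_iff]

lemma cell_sound (i j : Fin 5) {m : Nat} (hm : m ∈ cellM i j) :
    ∃ π : Equiv.Perm (Fin 5), π i = j ∧ MaskOf i π m := by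
  rw [tab_mask i i.2 j j.2, List.mem_map] at hm
  obtain ⟨c, hc, rfl⟩ := hm
  rw [List.mem_filter] at hc
  obtain ⟨π, hπ⟩ := code_perm hc.1
  refine ⟨π, ?_, mkMask_of hc.1 π i fun k => (hπ k).symm⟩
  apply Fin.ext
  rw [hπ]
  simpa using hc.2

lemma cell_complete (i j : Fin 5) (π : Equiv.Perm (Fin 5)) (h : π i = j) :
    ∃ m ∈ cellM i j, MaskOf i π m := by
  obtain ⟨c, hc, hπ⟩ := perm_code π
  refine ⟨mkMask i c, ?_, mkMask_of hc π i hπ⟩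
  rw [tab_mask i i.2 j j.2, List.mem_map]
  refine ⟨c, ?_, rfl⟩
  rw [List.mem_filter]
  refine ⟨hc, ?_⟩
  rw [hπ, h]; simp

/-- A tight permutation. -/
def TightP (z : Fin 5 → Fin 5 → Prop) (bl : List (List Nat)) (i j : Fin 5)
    (π : Equiv.Perm (Fin 5)) : Prop :=
  π i = j ∧ ∀ k, k ≠ i → z k (π k) ∧ (cellB bl i j).testBit (5 * k + π k) = true

/-- A configuration the checker talks about. -/
structure Cfg (w : Matrix (Fin 5) (Fin 5) ℝ) (z : Fin 5 → Fin 5 → Prop) (bl : List (List Nat))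
    (H : Nat) : Prop where
  sing : Sing w
  pot : ∀ i j : Fin 5, cellB bl i j ≠ 0 → ∃ u v : Fin 5 → ℝ, ∀ k l, k ≠ i → l ≠ j →
    u k + v l ≤ w k l ∧
      (u k + v l = w k l ↔ (z k l ∧ (cellB bl i j).testBit (5 * k + l) = true))
  ex : ∀ i j : Fin 5, H.testBit (5 * i + j) = true → ∃ π, TightP z bl i j π

lemma TightP.ne_zero {z : Fin 5 → Fin 5 → Prop} {bl : List (List Nat)} {i j : Fin 5}
    {π : Equiv.Perm (Fin 5)} (h : TightP z bl i j π) : cellB bl i j ≠ 0 := by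
  intro h0
  have hex : ∀ i : Fin 5, ∃ k : Fin 5, k ≠ i := by decide
  obtain ⟨k, hk⟩ := hex i
  have := (h.2 k hk).2
  rw [h0] at this
  simp at this

lemma sum_class (f : Fin 5 → Fin 5 → ℝ) {i j : Fin 5} {π : Equiv.Perm (Fin 5)} (h : π i = j) :
    ∑ k, f k (π k) = f i j + ∑ k ∈ Finset.univ.erase i, f k (π k) := by
  rw [← Finset.add_sum_erase Finset.univ _ (Finset.mem_univ i), h]

lemma sum_pot (u v : Fin 5 → ℝ) {i j : Fin 5} {π : Equiv.Perm (Fin 5)} (h : π i = j) :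
    ∑ k ∈ Finset.univ.erase i, (u k + v (π k)) = ∑ k, u k + ∑ k, v k - u i - v j := by
  have h1 := sum_class (fun k l => u k + v l) h
  rw [Finset.sum_add_distrib, Equiv.sum_comp π v] at h1
  linarith

lemma tight_isMin {w : Matrix (Fin 5) (Fin 5) ℝ} {z : Fin 5 → Fin 5 → Prop}
    {bl : List (List Nat)} {H : Nat} (hc : Cfg w z bl H) {i j : Fin 5}
    {π : Equiv.Perm (Fin 5)} (h : TightP z bl i j π) : IsMinP w i j π := by
  obtain ⟨u, v, hp⟩ := hc.pot i j h.ne_zero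
  refine ⟨h.1, fun π' h' => ?_⟩
  rw [sum_class (fun k l => w k l) h.1, sum_class (fun k l => w k l) h']
  have e1 : ∑ k ∈ Finset.univ.erase i, w k (π k) =
      ∑ k ∈ Finset.univ.erase i, (u k + v (π k)) := by
    apply Finset.sum_congr rfl
    intro k hk
    have hk := Finset.ne_of_mem_erase hk
    refine (((hp k (π k) hk ?_).2).mpr (h.2 k hk)).symm
    rw [← h.1]; exact fun hh => hk (π.injective hh)
  have e2 : ∑ k ∈ Finset.univ.erase i, (u k + v (π' k)) ≤
      ∑ k ∈ Finset.univ.erase i, w k (π' k) := by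
    apply Finset.sum_le_sum
    intro k hk
    have hk := Finset.ne_of_mem_erase hk
    refine (hp k (π' k) hk ?_).1
    rw [← h']; exact fun hh => hk (π'.injective hh)
  rw [sum_pot u v h'] at e2
  rw [sum_pot u v h.1] at e1
  linarith

lemma isMin_tight {w : Matrix (Fin 5) (Fin 5) ℝ} {z : Fin 5 → Fin 5 → Prop}
    {bl : List (List Nat)} {H : Nat} (hc : Cfg w z bl H) {i j : Fin 5}
    {π0 π : Equiv.Perm (Fin 5)} (h : TightP z bl i j π0) (hπ : IsMinP w i j π) :
    TightP z bl i j π := by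
  obtain ⟨u, v, hp⟩ := hc.pot i j h.ne_zero
  have hle : ∀ k ∈ Finset.univ.erase i, u k + v (π k) ≤ w k (π k) := by
    intro k hk
    have hk := Finset.ne_of_mem_erase hk
    refine (hp k (π k) hk ?_).1
    rw [← hπ.1]; exact fun hh => hk (π.injective hh)
  have e1 : ∑ k ∈ Finset.univ.erase i, w k (π0 k) =
      ∑ k ∈ Finset.univ.erase i, (u k + v (π0 k)) := by
    apply Finset.sum_congr rfl
    intro k hk
    have hk := Finset.ne_of_mem_erase hk
    refine (((hp k (π0 k) hk ?_).2).mpr (h.2 k hk)).symm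
    rw [← h.1]; exact fun hh => hk (π0.injective hh)
  have e3 := hπ.2 π0 h.1
  rw [sum_class (fun k l => w k l) h.1, sum_class (fun k l => w k l) hπ.1] at e3
  rw [sum_pot u v h.1] at e1
  have e4 := sum_pot u v hπ.1
  have e5 := Finset.sum_le_sum hle
  have e6 : ∑ k ∈ Finset.univ.erase i, (u k + v (π k)) =
      ∑ k ∈ Finset.univ.erase i, w k (π k) := by linarith
  rw [Finset.sum_eq_sum_iff_of_le hle] at e6
  refine ⟨hπ.1, fun k hk => ?_⟩
  refine (hp k (π k) hk ?_).2.mp (e6 k (Finset.mem_erase.mpr ⟨hk, Finset.mem_univ k⟩))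
  rw [← hπ.1]; exact fun hh => hk (π.injective hh)

/-- The state of the checker: positions in `P` satisfy `z`, positions in `N` do not. -/
def Holds (z : Fin 5 → Fin 5 → Prop) (P N : Nat) : Prop :=
  (∀ k l : Fin 5, P.testBit (5 * k + l) = true → z k l) ∧
    ∀ k l : Fin 5, N.testBit (5 * k + l) = true → ¬ z k l

lemma tight_of_sub {z : Fin 5 → Fin 5 → Prop} {bl : List (List Nat)} {P N : Nat}
    (hh : Holds z P N) {i j : Fin 5} {π : Equiv.Perm (Fin 5)} (hπ : π i = j) {m : Nat}
    (hm : MaskOf i π m) (hs : subm m (Nat.land P (cellB bl i j)) = true) : TightP z bl i j π := by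
  rw [subm_iff] at hs
  refine ⟨hπ, fun k hk => ?_⟩
  have h1 := hs _ ((hm.1 k (π k)).mpr ⟨hk, rfl⟩)
  have h2 : (P &&& cellB bl i j).testBit (5 * k + π k) = true := h1
  rw [Nat.testBit_and, Bool.and_eq_true] at h2
  exact ⟨hh.1 k _ h2.1, h2.2⟩

lemma maskOf_bit {i : Fin 5} {π : Equiv.Perm (Fin 5)} {m : Nat} (hm : MaskOf i π m) {n : Nat}
    (hn : m.testBit n = true) : ∃ k, k ≠ i ∧ n = 5 * (k : ℕ) + (π k : ℕ) := by
  have h25 : n < 25 := by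
    by_contra h
    push Not at h
    have : m < 2 ^ n := hm.2.trans_le (Nat.pow_le_pow_right (by norm_num) h)
    rw [Nat.testBit_lt_two_pow this] at hn
    exact absurd hn (by simp)
  have h := hm.1 ⟨n / 5, by omega⟩ ⟨n % 5, by omega⟩
  simp only at h
  rw [Nat.div_add_mod] at h
  obtain ⟨h1, h2⟩ := h.mp hn
  refine ⟨_, h1, ?_⟩
  rw [h2]
  simp only
  omega

lemma sub_of_tight {z : Fin 5 → Fin 5 → Prop} {bl : List (List Nat)} {P N : Nat}
    (hh : Holds z P N) {i j : Fin 5} {π : Equiv.Perm (Fin 5)} (ht : TightP z bl i j π) {m : Nat}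
    (hm : MaskOf i π m) : subm m (cellB bl i j) = true ∧ Nat.beq (Nat.land m N) 0 = true := by
  constructor
  · rw [subm_iff]
    intro n hn
    obtain ⟨k, hk, rfl⟩ := maskOf_bit hm hn
    exact (ht.2 k hk).2
  · rw [disj_iff]
    intro n hn
    obtain ⟨k, hk, rfl⟩ := maskOf_bit hm hn
    by_contra hne
    rw [Bool.not_eq_false] at hne
    exact hh.2 _ _ hne (ht.2 k hk).1

section
variable {w : Matrix (Fin 5) (Fin 5) ℝ} {z : Fin 5 → Fin 5 → Prop} {bl : List (List Nat)}
  {H P N : Nat}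

lemma exB_tight (hh : Holds z P N) (i j a b : Fin 5)
    (h : exB bl P i j a b = true) : ∃ π, TightP z bl i j π ∧ π a = b := by
  simp only [exB, forceN_eq] at h
  rw [anyB_iff] at h
  obtain ⟨m, hm, h⟩ := h
  rw [Bool.cond_false_right, Bool.and_eq_true, tb_eq] at h
  obtain ⟨π, hπ, hmask⟩ := cell_sound i j hm
  exact ⟨π, tight_of_sub hh hπ hmask h.1, ((hmask.1 a b).mp h.2).2⟩

lemma hasB_sound (hc : Cfg w z bl H) (hh : Holds z P N) (i j a b : Fin 5) (hai : a ≠ i)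
    (h : hasB bl P i j a b = true) : HasArc w i j a b := by
  simp only [hasB, forceN_eq] at h
  rw [Bool.cond_false_right, Bool.and_eq_true, anyB_iff, anyB_iff] at h
  obtain ⟨⟨m, hm, h⟩, m', hm', h'⟩ := h
  rw [Bool.cond_false_right, Bool.and_eq_true, tb_eq] at h
  rw [Bool.cond_false_right, Bool.and_eq_true, tb_eq] at h'
  obtain ⟨π, hπ, hmask⟩ := cell_sound i j hm
  obtain ⟨π', hπ', hmask'⟩ := cell_sound i j hm'
  refine ⟨⟨π, tight_isMin hc (tight_of_sub hh hπ hmask h.1), ((hmask.1 a b).mp h.2).2⟩,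
    π', tight_isMin hc (tight_of_sub hh hπ' hmask' h'.1), ?_⟩
  intro hab
  have := (hmask'.1 a b).mpr ⟨hai, hab⟩
  have h2 := h'.2
  have e : Nat.add (Nat.mul 5 a) b = 5 * (a : ℕ) + b := rfl
  rw [e, this] at h2
  exact absurd h2 (by simp)

lemma badB_sound (hc : Cfg w z bl H) (hh : Holds z P N) (i j a b c d : Fin 5) (hai : a ≠ i)
    (hci : c ≠ i) {π0 : Equiv.Perm (Fin 5)} (ht : TightP z bl i j π0)
    (h : badB bl N i j a b c d = false) :
    ∀ π, IsMinP w i j π → π a = b → π c ≠ d := by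
  intro π hπ hab hcd
  have htπ := isMin_tight hc ht hπ
  obtain ⟨m, hm, hmask⟩ := cell_complete i j π hπ.1
  obtain ⟨h1, h2⟩ := sub_of_tight hh htπ hmask
  have : badB bl N i j a b c d = true := by
    simp only [badB, forceN_eq]
    rw [anyB_iff]
    refine ⟨m, hm, ?_⟩
    have e1 : tb m (Nat.add (Nat.mul 5 a) b) = true := by
      rw [tb_eq]; exact (hmask.1 a b).mpr ⟨hai, hab⟩
    have e2 : tb m (Nat.add (Nat.mul 5 c) d) = true := by
      rw [tb_eq]; exact (hmask.1 c d).mpr ⟨hci, hcd⟩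
    rw [e1, e2, h1, h2]; rfl
  rw [this] at h
  exact absurd h (by simp)

lemma all4_iff (a b c d : Bool) : all4 a b c d = true ↔
    a = true ∧ b = true ∧ c = true ∧ d = true := by
  cases a <;> cases b <;> cases c <;> cases d <;> simp [all4]

lemma guard_ne (b : Fin 5) (c : Fin 5) (x : Bool)
    (h : cond (Nat.beq b c) false x = true) : b ≠ c ∧ x = true := by
  cases hb : Nat.beq b c
  · rw [hb] at h
    refine ⟨?_, h⟩
    rintro rfl
    rw [Nat.beq_refl] at hb
    exact absurd hb (by simp)
  · rw [hb] at h; exact absurd h (by simp)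

lemma rowB_sound (hc : Cfg w z bl H) (hh : Holds z P N) (a b c d c' d' : Fin 5)
    (h : rowB bl P a b c d c' d' = true) : Goal w := by
  unfold rowB at h
  obtain ⟨hab, h⟩ := guard_ne _ _ _ h
  obtain ⟨hcd, h⟩ := guard_ne _ _ _ h
  obtain ⟨hcd', h⟩ := guard_ne _ _ _ h
  rw [all4_iff] at h
  obtain ⟨h1, h2, h3, h4⟩ := h
  exact row_recipe w hab hcd hcd' (hasB_sound hc hh _ _ _ _ hab h1)
    (hasB_sound hc hh _ _ _ _ hab h2) (hasB_sound hc hh _ _ _ _ hab.symm h3)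
    (hasB_sound hc hh _ _ _ _ hab.symm h4)

lemma colB_sound (hc : Cfg w z bl H) (hh : Holds z P N) (a b c d c' d' : Fin 5)
    (h : colB bl P a b c d c' d' = true) : Goal w := by
  unfold colB at h
  obtain ⟨hab, h⟩ := guard_ne _ _ _ h
  obtain ⟨hcd, h⟩ := guard_ne _ _ _ h
  obtain ⟨hcd', h⟩ := guard_ne _ _ _ h
  rw [all4_iff] at h
  obtain ⟨h1, h2, h3, h4⟩ := h
  exact col_recipe w hab hcd hcd' (hasB_sound hc hh _ _ _ _ hcd h1)
    (hasB_sound hc hh _ _ _ _ hcd.symm h2) (hasB_sound hc hh _ _ _ _ hcd' h3)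
    (hasB_sound hc hh _ _ _ _ hcd'.symm h4)

lemma p4B_sound (hc : Cfg w z bl H) (hh : Holds z P N) (i₁ i₂ r k₀ m k₁ e : Fin 5)
    (h : p4B bl P N i₁ i₂ r k₀ m k₁ e = true) : Goal w := by
  unfold p4B at h
  obtain ⟨h12, h⟩ := guard_ne _ _ _ h
  obtain ⟨h1r, h⟩ := guard_ne _ _ _ h
  obtain ⟨h2r, h⟩ := guard_ne _ _ _ h
  obtain ⟨hmk, h⟩ := guard_ne _ _ _ h
  obtain ⟨hk, h⟩ := guard_ne _ _ _ h
  obtain ⟨hek0, h⟩ := guard_ne _ _ _ h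
  obtain ⟨hek1, h⟩ := guard_ne _ _ _ h
  rw [Bool.cond_false_right, Bool.and_eq_true, all4_iff, Bool.cond_false_right,
    Bool.and_eq_true, Bool.not_eq_true'] at h
  obtain ⟨⟨h1, h2, h3, h4⟩, h5, h6⟩ := h
  obtain ⟨π, hπ, hπ'⟩ := exB_tight hh _ _ _ _ h4
  obtain ⟨π', hp, hp'⟩ := exB_tight hh _ _ _ _ h5
  exact p4_recipe w h12 h1r h2r hmk hk hek0 hek1 (hasB_sound hc hh _ _ _ _ h1r.symm h1)
    (hasB_sound hc hh _ _ _ _ h12.symm h2) (hasB_sound hc hh _ _ _ _ h12 h3)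
    ⟨π, tight_isMin hc hπ, hπ'⟩ ⟨π', tight_isMin hc hp, hp'⟩
    (badB_sound hc hh _ _ _ _ _ _ h12 h2r.symm hπ h6)

/-- The zero pattern contains a 2-cycle and a disjoint 2-cycle or 3-cycle. -/
def Cyc (z : Fin 5 → Fin 5 → Prop) : Prop :=
  ∃ s : Equiv.Perm (Fin 5), z (s 0) (s 1) ∧ z (s 1) (s 0) ∧
    ((z (s 2) (s 3) ∧ z (s 3) (s 2)) ∨ (z (s 2) (s 3) ∧ z (s 3) (s 4) ∧ z (s 4) (s 2)))

lemma look_mem {α : Type} (d : α) (l : List α) (n : Nat) (h : n < l.length) : look d l n ∈ l := by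
  induction l generalizing n with
  | nil => simp at h
  | cons a t ih =>
    cases n with
    | zero => exact List.mem_cons_self
    | succ n => exact List.mem_cons_of_mem _ (ih n (by simpa using h))

lemma goalB_sound (hh : Holds z P N) (t c : Nat) (hcode : c ∈ permCodes)
    (h : goalB P t (c % 5) (c / 5 % 5) (c / 25 % 5) (c / 125 % 5) (c / 625 % 5) = true) :
    Cyc z := by
  obtain ⟨π, hπ⟩ := code_perm hcode
  have e0 : (π 0 : ℕ) = c % 5 := by have := hπ 0; simpa using this
  have e1 : (π 1 : ℕ) = c / 5 % 5 := by have := hπ 1; simpa using this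
  have e2 : (π 2 : ℕ) = c / 25 % 5 := by have := hπ 2; simpa using this
  have e3 : (π 3 : ℕ) = c / 125 % 5 := by have := hπ 3; simpa using this
  have e4 : (π 4 : ℕ) = c / 625 % 5 := by have := hπ 4; simpa using this
  rw [← e0, ← e1, ← e2, ← e3, ← e4] at h
  unfold goalB at h
  rw [all4_iff] at h
  simp only [tb_eq] at h
  obtain ⟨h1, h2, h3, h4⟩ := h
  refine ⟨π, hh.1 _ _ h1, hh.1 _ _ h2, ?_⟩
  cases ht : Nat.beq t 0
  · rw [ht] at h4
    simp only [cond_false, Bool.cond_false_right, Bool.and_eq_true] at h4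
    exact Or.inr ⟨hh.1 _ _ h3, hh.1 _ _ h4.1, hh.1 _ _ h4.2⟩
  · rw [ht] at h4
    exact Or.inl ⟨hh.1 _ _ h3, hh.1 _ _ h4⟩

lemma contra_sound (hc : Cfg w z bl H) (hh : Holds z P N) (i j : Fin 5)
    (hH : H.testBit (5 * i + j) = true)
    (h : atMostOne N (List.rec (motive := fun _ => List Nat) []
          (fun h _ ih => cond (subm h (cellB bl i j)) (h :: ih) ih) (cellM i j)) 1 = true) :
    False := by
  obtain ⟨π0, h0⟩ := hc.ex i j hH
  obtain ⟨π, π', hne, h1, h2⟩ := hc.sing i j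
  have t1 := isMin_tight hc h0 h1
  have t2 := isMin_tight hc h0 h2
  obtain ⟨m, hm, hmask⟩ := cell_complete i j π h1.1
  obtain ⟨m', hm', hmask'⟩ := cell_complete i j π' h2.1
  have hfil : ∀ (B : Nat) (l : List Nat) (m : Nat), m ∈ l → subm m B = true →
      m ∈ (List.rec (motive := fun _ => List Nat) []
          (fun h _ ih => cond (subm h B) (h :: ih) ih) l : List Nat) := by
    intro B l m hm hs
    induction l with
    | nil => simp at hm
    | cons a t ih =>
      simp only
      rcases List.mem_cons.mp hm with rfl | hm
      · rw [hs]; exact List.mem_cons_self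
      · cases subm a B
        · exact ih hm
        · exact List.mem_cons_of_mem _ (ih hm)
  obtain ⟨a1, a2⟩ := sub_of_tight hh t1 hmask
  obtain ⟨b1, b2⟩ := sub_of_tight hh t2 hmask'
  have heq := atMostOne_one N _ h m (hfil _ _ _ hm a1) m' (hfil _ _ _ hm' b1) a2 b2
  subst heq
  apply hne
  ext k : 1
  by_cases hk : k = i
  · subst hk; rw [h1.1, h2.1]
  · exact (((hmask'.1 k (π k)).mp ((hmask.1 k (π k)).mpr ⟨hk, rfl⟩)).2).symm

end

lemma guardR_ok {b : Bool} {c : Nat} {r : List Nat} {c2 : Nat} {r2 : List Nat}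
    (h : guardR b c r = Res.ok c2 r2) : b = true := by
  cases b
  · exact absurd h (by simp [guardR])
  · rfl

lemma dig_fin {x : Nat} (h : Nat.blt x 25 = true) :
    ∃ i j : Fin 5, (i : ℕ) = x / 5 ∧ (j : ℕ) = x % 5 := by
  have h' : x < 25 := by
    rw [Nat.blt_eq] at h; exact h
  exact ⟨⟨x / 5, by omega⟩, ⟨x % 5, by omega⟩, rfl, rfl⟩

lemma leafR_sound {w : Matrix (Fin 5) (Fin 5) ℝ} {z : Fin 5 → Fin 5 → Prop}
    {bl : List (List Nat)} {H P N : Nat} (hc : Cfg w z bl H) (hh : Holds z P N) (fl : Bool)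
    (t c : Nat) (r : List Nat) (c2 : Nat) (r2 : List Nat)
    (h : leafR bl H fl P N t c r = Res.ok c2 r2) : Goal w ∨ (fl = true ∧ Cyc z) := by
  simp only [leafR, forceN_eq] at h
  generalize dig c 0 = x at h
  generalize dig c 5 = y at h
  generalize dig c 10 = v at h
  generalize dig c 15 = e at h
  cases h25 : Nat.beq t 25
  swap
  · rw [h25] at h
    have h := guardR_ok h
    rw [all4_iff] at h
    obtain ⟨hx, hy, hv, h⟩ := h
    obtain ⟨i1, i2, e1, e2⟩ := dig_fin hx
    obtain ⟨j1, j2, f1, f2⟩ := dig_fin hy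
    obtain ⟨k1, k2, g1, g2⟩ := dig_fin hv
    rw [← e1, ← e2, ← f1, ← f2, ← g1, ← g2] at h
    exact Or.inl (rowB_sound hc hh _ _ _ _ _ _ h)
  rw [h25, cond_false] at h
  cases h27 : Nat.beq t 27
  swap
  · rw [h27] at h
    have h := guardR_ok h
    rw [Bool.cond_false_right, Bool.cond_false_right, Bool.and_eq_true, Bool.and_eq_true] at h
    obtain ⟨hx, hH, h⟩ := h
    obtain ⟨i, j, e1, e2⟩ := dig_fin hx
    rw [← e1, ← e2] at h
    exfalso
    refine contra_sound hc hh i j ?_ h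
    rw [tb_eq] at hH
    rw [e1, e2, Nat.div_add_mod]; exact hH
  rw [h27, cond_false] at h
  cases h26 : Nat.beq t 26
  swap
  · rw [h26] at h
    have h := guardR_ok h
    rw [all4_iff] at h
    obtain ⟨hx, hy, hv, h⟩ := h
    obtain ⟨i1, i2, e1, e2⟩ := dig_fin hx
    obtain ⟨j1, j2, f1, f2⟩ := dig_fin hy
    obtain ⟨k1, k2, g1, g2⟩ := dig_fin hv
    rw [← e1, ← e2, ← f1, ← f2, ← g1, ← g2] at h
    exact Or.inl (colB_sound hc hh _ _ _ _ _ _ h)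
  rw [h26, cond_false] at h
  cases h28 : Nat.beq t 28
  swap
  · rw [h28] at h
    have h := guardR_ok h
    rw [all4_iff, Bool.cond_false_right, Bool.and_eq_true] at h
    obtain ⟨hx, hy, hv, he, h⟩ := h
    obtain ⟨i1, i2, e1, e2⟩ := dig_fin hx
    obtain ⟨j1, j2, f1, f2⟩ := dig_fin hy
    obtain ⟨k1, k2, g1, g2⟩ := dig_fin hv
    rw [Nat.blt_eq] at he
    have e3 : ((⟨e, he⟩ : Fin 5) : ℕ) = e := rfl
    rw [← e1, ← e2, ← f1, ← f2, ← g1, ← g2, ← e3] at h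
    exact Or.inl (p4B_sound hc hh _ _ _ _ _ _ _ h)
  rw [h28, cond_false] at h
  cases h29 : Nat.beq t 29
  swap
  · rw [h29] at h
    have h := guardR_ok h
    rw [Bool.cond_false_right, Bool.cond_false_right, Bool.and_eq_true, Bool.and_eq_true,
      Nat.blt_eq] at h
    obtain ⟨hfl, hlt, h⟩ := h
    exact Or.inr ⟨hfl, goalB_sound hh _ _ (look_mem 0 permCodes _ (by rw [tab_len]; exact hlt)) h⟩
  rw [h29, cond_false] at h
  exact absurd h (by simp)

lemma runC_sound {w : Matrix (Fin 5) (Fin 5) ℝ} {z : Fin 5 → Fin 5 → Prop}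
    {bl : List (List Nat)} {H : Nat} (hc : Cfg w z bl H) (fl : Bool) (fuel : Nat) :
    ∀ (P N c : Nat) (r : List Nat) (c2 : Nat) (r2 : List Nat), Holds z P N →
      runC bl H fl fuel P N c r = Res.ok c2 r2 → Goal w ∨ (fl = true ∧ Cyc z) := by
  induction fuel with
  | zero => intro P N c r c2 r2 _ h; exact absurd h (by simp [runC])
  | succ n ih =>
    intro P N c r c2 r2 hh h
    have hstep : ∀ c r, (forceN (dig c 0) fun t => forceN (Nat.shiftRight c 5) fun c' =>
          cond (Nat.blt t 25)
            (Res.rec (motive := fun _ => Res) Res.bad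
              (fun c2 r2 => runC bl H fl n P (Nat.lor N (Nat.shiftLeft 1 t)) c2 r2)
              (runC bl H fl n (Nat.lor P (Nat.shiftLeft 1 t)) N c' r))
            (leafR bl H fl P N t c' r)) = Res.ok c2 r2 → Goal w ∨ (fl = true ∧ Cyc z) := by
      intro c r h
      simp only [forceN_eq] at h
      generalize dig c 0 = t at h
      generalize Nat.shiftRight c 5 = c' at h
      cases ht : Nat.blt t 25
      · rw [ht, cond_false] at h
        exact leafR_sound hc hh fl t c' r c2 r2 h
      · rw [ht, cond_true] at h
        have ht' : t < 25 := by rw [Nat.blt_eq] at ht; exact ht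
        cases h1 : runC bl H fl n (Nat.lor P (Nat.shiftLeft 1 t)) N c' r with
        | bad => rw [h1] at h; exact absurd h (by simp)
        | ok c3 r3 =>
          rw [h1] at h
          have hbit : ∀ (M : Nat) (k l : Fin 5),
              (Nat.lor M (Nat.shiftLeft 1 t)).testBit (5 * k + l) = true →
              M.testBit (5 * k + l) = true ∨ 5 * (k : ℕ) + l = t := by
            intro M k l hb
            have hb' : (M ||| 1 <<< t).testBit (5 * k + l) = true := hb
            rw [Nat.testBit_or, Bool.or_eq_true, Nat.one_shiftLeft, Nat.testBit_two_pow] at hb'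
            rcases hb' with hb' | hb'
            · exact Or.inl hb'
            · right
              have e : t = 5 * (k : ℕ) + l := by simpa using hb'
              exact e.symm
          have huniq : ∀ k l k' l' : Fin 5, 5 * (k : ℕ) + l = t → 5 * (k' : ℕ) + l' = t →
              k = k' ∧ l = l' := by
            intro k l k' l' e1 e2
            have := l.2
            have := l'.2
            constructor <;> apply Fin.ext <;> omega
          have e0 : 5 * ((⟨t / 5, by omega⟩ : Fin 5) : ℕ) + ((⟨t % 5, by omega⟩ : Fin 5) : ℕ) = t :=
            Nat.div_add_mod t 5
          have hq5 : t / 5 < 5 := by omega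
          have hr5 : t % 5 < 5 := by omega
          by_cases hz : z ⟨t / 5, hq5⟩ ⟨t % 5, hr5⟩
          · refine ih _ _ _ _ _ _ ⟨fun k l hb => ?_, hh.2⟩ h1
            rcases hbit _ _ _ hb with hb | hb
            · exact hh.1 _ _ hb
            · obtain ⟨rfl, rfl⟩ := huniq _ _ _ _ hb e0
              exact hz
          · refine ih _ _ _ _ _ _ ⟨hh.1, fun k l hb => ?_⟩ h
            rcases hbit _ _ _ hb with hb | hb
            · exact hh.2 _ _ hb
            · obtain ⟨rfl, rfl⟩ := huniq _ _ _ _ hb e0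
              exact hz
    have hrun : runC bl H fl (n + 1) P N c r = (forceN P fun P => forceN N fun N => forceN c fun c1 =>
      (fun k : Nat → List Nat → Res => cond (Nat.beq c1 1)
          (List.rec (motive := fun _ => Res) Res.bad (fun h t _ => k h t) r) (k c1 r))
      fun c r =>
        forceN (dig c 0) fun t => forceN (Nat.shiftRight c 5) fun c' =>
          cond (Nat.blt t 25)
            (Res.rec (motive := fun _ => Res) Res.bad
              (fun c2 r2 => runC bl H fl n P (Nat.lor N (Nat.shiftLeft 1 t)) c2 r2)
              (runC bl H fl n (Nat.lor P (Nat.shiftLeft 1 t)) N c' r))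
            (leafR bl H fl P N t c' r)) := rfl
    rw [hrun, forceN_eq, forceN_eq, forceN_eq] at h
    cases hb : Nat.beq c 1
    · simp only [hb, cond_false] at h
      exact hstep _ _ h
    · simp only [hb, cond_true] at h
      cases r with
      | nil => exact absurd h (by simp)
      | cons a t => exact hstep _ _ h

theorem runOK_sound {w : Matrix (Fin 5) (Fin 5) ℝ} {z : Fin 5 → Fin 5 → Prop}
    {bl : List (List Nat)} {H : Nat} (hc : Cfg w z bl H) (fl : Bool) (fuel P N : Nat)
    (cert : List Nat) (hh : Holds z P N) (h : runOK bl H fl fuel P N cert = true) :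
    Goal w ∨ (fl = true ∧ Cyc z) := by
  unfold runOK at h
  cases hr : runC bl H fl fuel P N 1 cert with
  | bad => rw [hr] at h; exact absurd h (by simp [Res.isOk])
  | ok c r => exact runC_sound hc fl fuel _ _ _ _ _ _ hh hr

def cert_alpha22 : List Nat :=
  [167637418087064315414802965748190593859976928040906139741624489779599397299561628891804398690489205970462499242561435860608956251791152274577105987682,
   5229262400931418666895691580614492329721757372736702205312107851511855514177276544155001323475488379790437482584794321119172129357758519280065366427737,
   111424811248098093153905800154820703892418146836751327171876590787419342035205582325537074425482500387091756621649824363015554466091095693631899635508,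
   4842109694127220882462224699279618532118392830604760414128490022086151619987775635803965169136383890400078723649955993023182926932266597304600536187,
   3382257354378408386479719443436684614076507380312340761828948942572697953422991498807290882332194786662617874604054677524263626493934413244439904420921,
   168136900904842937550021653275877833946196107638757437615974454820329322193067597899542987358233040045888585539972939852945892055051804395212786143029,
   170449498875689018959085335985416466419846501051034081249686286643489047679185673727975818554424525981291272387156151091977025718436818256503310425,
   3666965355595837053250897989660598155189001890667671125593355693769343416307096829571561547733036044495023898718738029160361298398205862025324091849145,
   147150036105742901006914665707799475196991011508789946328713008672360199684475909458900166526549348141592924411953637928838022618228213738973018004603,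
   5433852399087496322865338664180876692517982574340772114213872009659505862136633128100578431987344339825495176603734628393242021750227619170710384052281,
   4609878145939460853761209622361095428648188761856530797145941250246366748976714125737093303283064265751214512063297573457926439513545835027841674208782,
   4839573845600440117678336522583803505897158209701025757374547462302372586325262299625271463953660495595849320310686770861265023581854416978185359155,
   5584686584097741945303032170145907873256110230521292584326233414373416944501841520851949701169304693283805702758455520858363546489826001646413451528281,
   5364116318089698831685282723891537993188821355899637462799147646043816281211923500738894331905318956362621905083706832272054365336473411234428800677687,
   105595649514578089633882121209315073615997243310723152790364358250496133975972707282000143004257058756081547730642215794452205984015274118204009907289,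
   168136900904842937563798357381345427222836026154023451364456092794628678972314235991059854321717692302229301283576569618890869395843752886433978870875,
   5229265485998726799622762077787217481721125741981394933234778813641260383865023829913968625194964700813142716343745569926634539829055523706080345490489,
   3481553932933567802261681233128858367449459273629690302552125798549315483197035648339670922842809838479232132033133812513627039270509499737477921957520,
   130585972748428580920002167067232967599343127815344500577377079507791669345394651006753915397496849098026868209392725497273723681153565265477004986165,
   3379060669018902608490825387248981734952802560605970973229171543951584651805577338358735688675545288897098507379419365692904831960736955901866601147515,
   3379059778261090533944782499182759698841770990206570744851914621692683747264144259339913501692757672594059584543195948070746092201651949697381350542133,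
   133801373767712581891278523428332945330167164545716756612467025951062616369037679734237585847609197714636885655382656663307782415547706908822036586287,
   4281326480236459444404045928761793050486377391088819993127899210924057707649110127818408233425875163283054675050578323980297513129311185377407251770683,
   130591640778823913492542860079574236737350305945152750468391242518621792189253525309950199661948606847997382940863116182207123133622071275919401608719,
   178018009238692741853244954034858903672478054744893136291029920620507895123111566936427399710169187865753396672120115957768324034707039047886483077883,
   3564990291560350784736285155450837495554572898642503290246407468251724099331705826456810445215530293442492434650584392963952453419712546257848417816025,
   5380280834835479307944472596359619150215329519355597951809891439116113558834477387174348870243512633571350633808907652060805158158853758602611072187483,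
   111425978854945787960125220149071399618427765056151795137979154951217493505451268813669876290855703068658544323549081278834948912946453843764352945209,
   5239651410529602704534343984305074459703423380780607029092546124738008043908479755496505838264552602911989279946913958251791930785500750222973061450843,
   111390539076773198575320839609620562775845994810953550724580783874620787528683055424818143323230452905460127700913223392993545408483211389826760128311,
   3379059616858985239859497703504629468374997518155791767331898308157703236612668609628817406434910054718022137510476386546814274223298302429317021396059,
   3564571810798723114483615085389025272805754942883380203324733605990625126341151479630887875564070659915940559832197205057220024219709835502537745205038,
   145557920432676875864262132599280799924095698440429711043875639311852482982989580158758917402684897017143718354540601578756430553690166469029839317,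
   4076539743801558207727201893204633484658430224112908198304163976267990690800888040461609652671703116478313978200636844923979018111454208463853871074393,
   3379060729424046947275731568421542443999861314069901138403059735036094237654143968779701766074466388701805224218962752734138991123280557053689155642894,
   3379060281926419428339513898693045787896860696682309462419557098854279906983431464612251747899129211998221453673350075196009758177702718232887778139859,
   167412456361383143484122766211532105318078948869001410795236810973062748180845788875610682516649834475029169563993629278181130784535055281777895054,
   111425978854960143026571485587913893229003687530432666495734217047712367400094852511853553826330987013566000440341604196915462363119347683403020403769,
   105595649514596652414562585728846090540469224318672386954251327019938698126322857700415043986269032948559641389424010057856835901826289416394843507803,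
   5248436731518873902037218737677312384648169844161460779553092606609767242297165722263264887111467080383064604008501318461943410180173322133562853518427,
   5144920273658821751936663252896832606304624741249564816768841833916064540714558504584952366157866108385236783234954657191246318873840767138369933108,
   3992920904666783912515741426816366270633492871167431311664066544584449300294102672158533130806988300826036997543843625371408611510388403038416098526329,
   3379060531263186099023466874447441502425090901704591046618282488276552119727593950090016493475385093568210395330157044030147769085022079625414919120526,
   178017814129408347104321449766021731665808427008961318431310878319668485384302402594055458198586643184433964960177388620560818048188991734956015281514,
   5563917159217133645187875299695701898230171226734865551052468938529173580848563701841474719958626553815215701434411346996006562992109373861441995897,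
   171046361944917797045734940915983407118621347428936160512253756659404904425892087769853294449814783719296014177228047208759030350778455160941756986809,
   3485150186522855387526422521449898239625688658536070136579280639549006630695513202968689029206857500450458725185747610795137240535191341786319782380665,
   3996617453837682817469914417944160690279642128249590254433560168398297158123075833553372821712226478725638871985839873638912169773728897879618061672245,
   167327655146841471779196330839393233871881495517522887427839468838917753998653378650026077174543210943562392736906288238436157259897263588931346229,
   166342421867588277197241016321110411683290516640718528560933874290420022598345465027521302851068917945783648160198060293348408319721726574953990425,
   130043487250781247551571470401977447470748049205028702313219205347405779638161796418727773276864955534277210832471240161127765525573384503816225849,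
   167415523952239228240955155682914390611424889396657907059001059279241536770288843062638520074777983824150487292197734261233796838718591582660068409,
   160480701322681998590326281299636571139538577111624321771516311098746685501596815562271994457935069719612788907603365511579248801588903989312783417,
   163133389329398042755181291401114474563939094993562650844944489067567011671017765765077358265887604227147151159536790126000779679943885477631663080569,
   151379960629836784759041805815313254989522837257084104119503362663313499651780445771065846109138825881279760431457707167275372069364058884337468505,
   165553448004590218223030610124358380459997018171894285601645600050271249519570819100206970376555900080184017113805480639199177176470067006504207417,
   143701207132719391791097219130741781553973190054809715823721477434767031644508012896633395114224018578963928035607838225285364799659036704368723033,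
   4200533693831587031226336921764146632926334583074349012459410928705294441015527042770391623794902845628520796450306100548115645206025517578297277449273,
   163133389099899466745598115325412730163949419389219635302253045769201912989297418848664384247724819211806672081283975936957655056801756937902513751861,
   130102152493492563178146121820786574375456494787497306229628658739343485561266990273406725464287318564977627119198757272060981581528931857297605689,
   5380880698905867863732233080224547709237533085050634473525689110064948471978510962703313627057431342954775762959334737016920652746549486345062476448825,
   3379060297265065579094929918682420369751028953763661283700467000825763389456056297045759159847815578451552865327705244936065052374484411340537587631193,
   3379060238599250207178164216174201144567960568931555781518727757919390722022652910340038803000331306809812131656837128684857190768230178790844679620405,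
   138529771206819559308868763826383080727319200471475613599349324095935458585715808381446923232093216731542685361629469733932348929595336593022097852213,
   168165578834808227317085454066943277509917272131945727344749051471090757037415167581794692387673108275849664495443770705784548406368466642022115476570,
   135886113549066442175826025831950916530590299311661578371395611616448447506978622756170547974884043600963798022767671075539451926610450794952550058617,
   4767119568733182287965425687614120715023751847259101892660187878891963085637890044196896280567120333387484572951100836956186819005599689033349638195449,
   163703000521252299216129216479816907068029984810241081623012945627655534820677167551418340615228091518367914571090713030242086173597058968249769780,
   167631875583573582561653076827065841112547361326651780472002760667463299899682074416835091135301972310097558186759646594062245709372244500193278494969,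
   3666887968930349869928953445815490239110876940612276923433902967060453834980660229243365207497422865483192620103243847265948427172142840637458778327289,
   4610378192744334384855985502370268284069655148043486744274020632795334213439060291407784867125155491610901418317131885157303723991434537268800815131771,
   5436274513495501695157582743613830988144537245346543761234411298517164907663236930639933749327122142872250272197954385537314758897088416272482377525,
   5301045485464835354224972289616848218790901465915316109308134971273035678008919972458030394412810566979502401806106903708168236007398604974376531385,
   3488446798835518973515383580730673495712973874160685724257367502356096924365477847559414605015019543078226469501454329020425040440868581936956693351673,
   3488346841798443251734991698400032385569483955960949603454770313422360413384550213252155262657281532314781352797212383902178931823730561114618540092507,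
   4858830430074299873116688136950752420502099585462587732147603478662115729734273723907435914990864334673555058849178798369032254639852680206119706421,
   151369989422119433514916898343314482163256799109488760834783568510896571033985740932996932928544792249190426137784844264321531191393572130184129580281,
   3666966327906115791903108254656698985215596812472181510070134977720095066727971508055963054370405337323283454720836392834610537332236665900200896830905,
   3221015462731965261049172753031811210497722803906967008735487099703073441860692642259892431537319401659406052635]
def bl_alpha22 : List (List Nat) :=
  [[33554431, 33554431, 33554431, 33554431, 33554431],
   [33554431, 33554431, 33554431, 33554431, 33554431],
   [33554431, 33554431, 33554431, 33554431, 33554431],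
   [33554431, 33554431, 33554431, 33554431, 33554431],
   [33554431, 33554431, 33554431, 33554431, 33554431]]
theorem chk_alpha22 : runOK bl_alpha22 33554431 false 30 17182819 0 cert_alpha22 = true := by decide +kernel

def cert_alpha23 : List Nat :=
  [163900476774429072783320872849288724158914642851714380631573477108824542368785583971151611173315406063862858837015399971267552890645130724842514530,
   163020170750753305308111506137784421253855840589528279628613664906443804915833212784790551808748017845221704020396488632269093852253910173182331001,
   4327435054091680266308617732667002765661563985286286882723574818322967822819556904597576278491522253530396902945354438607595424920563672683136649305,
   5297710335855606506855938187916084434338539852423743830553890966514070626561155758300458445962195031534435367612697548899717883776961216278309143609,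
   165553447969161684058627885261552345574998225470602535314423983687016379613331016660924819012989427514052019081971687172751967009853940699400242297,
   4698334586860690687919505117125467628338184659202988330985547095957800005274697269521428524870768873063739347692238171627695882138795642606236959833,
   177240504837451676154848020653797544801046721119493937498783529098655116179708251631065543280312139532570866513344167297234539192520359825544698725465,
   3630952107366403012371453933300690209020599971397348588326324648702824251861923167818981820679264774125879548377129046977428716982067551813488138794425,
   4101708003132686064807869630194441415356588007609134476630635567359031892440286560301010924032963981386734396904233704189551310268932344651181833628996,
   5297710335013173889876092312876175789878491677123766098043496232006289390651251454480641402493777703014492316026900858546935410933774035801667112757,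
   4698334586857782800669741418366817279621663657031071353593910564886204915549701653868966548871748756091906071131041850201191666540195872723961087065,
   177240504837451676154327553574447170007306578330179994703089132423004954861406511957532324044196483328322862175842642598533971366093624615350770402393,
   173376042872215944065665227165134718276417304628418193263757866227827875892868789320869306222115120863457092208168242786172738160704751465733194841,
   173005327097050419671093270030834161494041719800729980350481558569861171937484406248142709462589470469875156813976257172046621172373679902704443865,
   166929533082262337443378945636168759010358475605475325696035427437363035620862835098372138107378524596860752838170238143036351563741346510833294161337,
   4327532608733877552340418195714355832973901561274792964302144276612765393753340565141654133119843855895458531474886473254161234704107772696058692665,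
   5297710335855606533513099456099114016906398878682210624094672646629043229822893603742373138306171996795250328712684389495757505364917884013239108665,
   165553447969161684058627885181251060103187508084009709873793220837132835773039782137092283810826748765634178671717596447691875499958357998145111161,
   4336345890913189081898609900468095900394388158028119145740584843813075956714931731612058196173605809054315559587810899860785952444878180260999562329,
   154146460476692051529004867146735124077337624711939961428805606285745053523937062568808492117792840405708457959572862854990780617998591483629174955449,
   3564671878579963383821823969979590664243160158198915218074395329411536861931902082093792176939517854522014105294847315945321055145156053459509920893177,
   4099010812480480373610541744933974934657744468117345015975922481621088880674531068766124912407421056952904405805941084670055978752104553359652828261705,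
   3770176680935477633087269382163996938023399669678947711120914182188075008128314559896609497864369561903233055469685687372674413198837670463631356142389,
   111424887461923952438480023375947490843022303165695917051656796960670744358880158296455959693858644076007874089830817409959673682764482696152530381979,
   3769597007673268838977090408185952493626776170702413696777226962495178156892357784638100646230785708729348963773280922327326448251760953746354769379419,
   108067031171809816041049321094160129192764095616677021059714982362255043060387967723585559040945414969445526943023852047]
def bl_alpha23 : List (List Nat) :=
  [[33554431, 33554431, 33554431, 33554431, 33554431],
   [33554431, 33554431, 33554431, 33554431, 33554431],
   [33554431, 33554431, 33554431, 33554431, 33554431],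
   [33554431, 33554431, 33554431, 33554431, 33554431],
   [33554431, 33554431, 33554431, 33554431, 33554431]]
theorem chk_alpha23 : runOK bl_alpha23 33554431 false 30 21770339 0 cert_alpha23 = true := by decide +kernel

def cert_41 : List Nat :=
  [4322232084982029705405910107770125684556460726017019782277690600071956875100555615963979414357590630655923959097272727285826894687940648910156595536112,
   125601128563461948263985616364441098766471872607475252798608291163462612840574883482573913725392286401616030144660534749281665250581273477578261561,
   67695286162544881586071057977287636379533621775008621196154862548171890904081913415929]
def bl_41 : List (List Nat) :=
  [[17284591, 17284591, 17284591, 17284591, 33013231],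
   [17284591, 17284591, 17284591, 17284591, 33013231],
   [17284591, 17284591, 17284591, 17284591, 33013231],
   [17284591, 17284591, 17284591, 17284591, 33013231],
   [17825791, 17825791, 17825791, 17825791, 17284591]]
theorem chk_41 : runOK bl_41 33554431 false 30 17182819 0 cert_41 = true := by decide +kernel

def cert_beta : List Nat :=
  [4816905043002276835656409455871811259618604931644861946986391738693465918247823841422566402656726655676326252232905368369817249817258244797244473293357,
   3481453131383662427240239045841483462446027298226436297929443953311418582769557835057993780019960523666459137649304121768055478805029392191980419747632,
   163602453015944518879485935830261368686639741518694791453432373598572388254753179957197738154454761158608886280368105105483378318031646674345036591,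
   3481453131312240894110063688154708156706154775752426416880980610577656080482693070046412416468363805571239115536636588424252448382703005719580953184346,
   4729726668516233009674439083666948663630118444551252840175714117132200364368536413882884892886313427139089617405146990875678917893239868031443700527,
   5348737930326864113641461976464882828005775585507880233477666326495486778684759723233089774133684642212293789255072153574898153104967940346498188018777,
   3996117952657233824525596828495492147151125477073760905009580573153611336679969633783305710898466393026104715258881513449937145361942310872067077474553,
   166932654848771384632731370044691513802025403787327851202445991940887574828171121528502168995763824147080453290023381519961185331407019701516366842677,
   4816964092338676205486670309585577221448472734980686809965501822930142360449018916186323944028687217625360542337332445799433230082726906380330174553,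
   4729726668516687283890662264597038441964619235012079552288421988694591581961648823570242375874746225076234698013638594803613733820106725965967885401,
   108795440058575325073794162999280209346831531107984621178769310568428919186609943021242482739948770030909426752978243143632166231280678303097713558617,
   162535446107889179055877160065839691120300068966866347586578941924910765404961973581023273796937167323967063865974179679461923060658958030373104731,
   4801355348744665517773959897196702611695771512041265700359245189118643917853582682361491115714913197621000187154530113905389016531948100589624298585,
   4701459383990667372498790340480024387310756407889800445323725217656551717646832225694209116678756648249332223581289839129346424402369060444603221081,
   4327630160396555164729277085414642433599892434833333820725816214438166686036571878044471541555103856062698590584326049456168777785974139894106227801,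
   3564571902542246446087579412047341151695136722931047331200356016409365267668501187899508283510446415129717201544585718718211621313083479197532650800217,
   5357394284365067392560621527494818168163348437917042887115809612280643881670564077530239869424489630415555560901743436479167306768051134261161595227,
   143958822874450178969814447899108561349430230281227405225815613368371662302087085658595173548947258112569519466318686668962076925780290572785764336793,
   177118920862563261414948475130820857759354603885661240221986442498182320802001743813209174931391671844727043182408021277293227625539496345412172435611,
   3485149281591762336029755065054816474134588109046625194938090773188903947103671721364481690160916721696548893913606596494035165691235291415105039139929,
   138481043384142898923832125546438404560723967592747297530878081168823958296012874909362883534746643372255771736747706727926260640985366277200285867823,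
   3564571909115752609783849239961051345811395955066901615173203418247996105465191448980664440051860988798951496212889730988282885430529234172650607152377,
   5428170679541026931771315296467540253427566529038843311248889123370958232609499913375199563777293695180599341547870909471321966400192058622831900831063,
   153646492908472647906607104116222851364648146624125887936492369221223388246925549790593821560464507326384337533273321590432098131833687747742443571449,
   4701556938621326183030408681114736214955530983423760796302997296342994898258708140769408965483702651240016502275423963325200673320896887526753634393,
   4327438099726797907353906831220939266342837980475072079897389443744671145590522217795785263829971048648093297584927333598377201422972038010693027929,
   3666866431949321875471387335277384717342163992583021713976881675028189840677997319115014022436304324765284914800552270947513826078148759224345164842073,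
   143958810680119472893473986815512292790745241309370679310595750459459797053143139624821328167324400724365167423205386109445134565772966009598420757832,
   163832953689342483661639415562646480892371123260759162564815265408007625333323150253143292624611640265674541452933086980216090519203005587543741819995,
   4801550458034874976825027884466484880051915067786584896366226893685090610100783772651782761716890365354506729862994374512044200090034550275256517721,
   4701459383987850872967432958725779691032272883228351409669727193832146785748310061069899904644907443889078629160099677544630320403449392261287185497,
   4327535654368904427700953279403566399135326494467137227194427075977563719696251219563835442525527087664773283393554136943149867732583288057217746009,
   3666866431949321875471387335279966967220250901172677633148884686902519546470826542627844681792844972387301755995181916300793963909584662396317912335449,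
   143958810108603276625027918863062195498517378502758273928665091080296012317156600224801342045166576232600973656418385082333492630055118985643562937673,
   151901256346383317914092585699811506080252625215976919641417229818829391452066620093949520925168310525753440916938571751899771279508421832208411739,
   111998355119149714426805828704452968861228253861787675638260082171691044092962346898795594748735618157749973176223589512351708074302428140763411121305,
   170725579623119806645183940908392342864996002349083969530332920140070660678024843129274396817575317762028458385818923769436975834741130798426939216987,
   4610377820987355017437514953714937747563110314933511833778262940051261522682839601002803174979749241628285350534254899684597821681061477643629980910745,
   155450127646702522381082053200482634982283601937208787141299244666462586588246396846517995122326782578327352869287449912797690055312538804710733324083,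
   151319704867691839372023570017115232076628123768225463754038181957962561082875796085042290536672529075613383455711949203490770663465036709679434041,
   5430653413898769581552223521493946225903141862349236744935532189875484210185247069154569216098931253902263592228793773802604763331445129582312521368698,
   165654241715895189316319544600121269306909977585831959950791313600978679279118390396856853202180483397132832048649757922480067595713106908049154864,
   5201039770607428166868897882609373189251182500032459511376455938279555113480618630764190588486880826692590989123130960925469785667027815105832224889,
   4842305773655946995809387297275738441058791829115441121889523206389854015483519868449558570859517873514803170530480409781588818776017005589560395897,
   143961944051391246301519739166826556817813153715393511612420174046825416709542277821536284330714981800878225349708719331685218873074989469530855638137,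
   176519545123039801609255116968037960635035462001766891002513044726030076132904637068170841623955985276769699655579133065525945113543578307062591405211,
   3488047132691473664993866839432013908802343714166532002451255149593397456919065653622025107874858920528006876841782880817911198707190567987749733172345,
   166929533100128033289365192725664698462174073529775860548942681219031965441716038369070915574535527690094253972953358586194175911170736084941316133685,
   4816964092344522149410554806266389997579821617437047735355371216103781240885310575460205193530106416343362247907843252456001509128370713167865807961,
   4729922825937606637734403956666485416718542689831361081080038161113488938346099165657136729818484212721805861964241020219096984420664746092213273689,
   5500627041878237041719777125386575955773838288789037848072623114820202066727425584824413565099697429205699134090093303697978061590897757490646320217,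
   5300841228846019105217152504483400271626427277992431622048665215062371237763359596380109958004231059477640986493063322531856941572645954196711310457,
   5200939166162244270305951074144575525575605012049017517658285511920891069389935871076918199524673521756120022616502216998880266859088279313273029785,
   140584862394525276117046818419886040476986807432031274988804987860897087662565464033233372683448675685134843367253293981063004975047814916550493273,
   4414143306849478759856789056343976825587952184668406388215053153861030086503532698233998765469211323691197690818446815367753304044261647216295092007580,
   4613774926608603586716967148928171953573378211682635683458428340138648190337902041498020223445874044053307926787766495960456798370989972496962884280111,
   144074403785378444196654680896032919537749255964909533148696991289429577716415766264072443013973472022477849074365721541258219082011635819474587200667,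
   5444154032594985852546427608418904993593935949139222374922506158707914952207417535434006761923629755785305961798396439481226717333856510786239151059612,
   166932654848771384638276709432933143521182232155614018609318864095365614890331881056994239153231051755222454508659974834831211095424780389536364726521,
   5316541429542743257605330237816191896750492956634626733841861508490729652693430535413237641608592594719853247432940859908685166597329864146535286873,
   4823298286493564540522582700756125573265606616845398765966289803067262319312359248646289889204290399674428102356552416629767817628910318180349101967449,
   166430150910886837290417555475890417187139673603791095415678729114383017837006395684912007150603598383940258023242390444797744855233358327967597498160,
   5303959928813857320698683503956673857948714461540280590341800978934353052582571639230781113695541061020085419429653394573510929198603330574837941369,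
   3590240778597918306887051677798284970240899266782686708819152498399722641273565230852858370783240522123343202277513610211139050593555588438682814743673,
   163900474356620667548472914571534822380368207692429186842956969024652494779705660625595980931235970932951699768218113738103241790118577900095160411,
   5316446924322637490364776630098060794822582845173219402487871832697546811617155323650065381043259295633326697316388229499590431799631271248786588793,
   5328375352743515566519123463289683120268007092272630193615444743329309516236124918394725051447320185528200757630099768547040074419046473411902750033017,
   167412459338515179450230586717915381465466802914761877130419760422760729272861146505656931617588055784419756935820152444641441253678214228137251637,
   111393465715991912057509878878018149226089704061190471876068365317247506740954644268582977900592800964156604458578941511653399746853283658253814826137,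
   4322631668801869807716977441224195824120104392814917817272751063681628823578170218040151964646508847515622335189455616517283396496194917260461914530907,
   150450309809555694142688663543968505637848428671106234624547250888716085714879879146191928578775622472518796229823012414212009151109029588972433645355,
   3488346317551051580452886326578537132897347172096439604498167353241188564023971142629504698763521768258780457464918452525907399527093922204261101406457,
   4814394305145154839491002517796258768975889038450004080421702277365899498014011618710118610543183654592611515743053308262927775843186114380711558487856,
   114587112037607354782232960422368686281364661020915437429286442874565669841544431662152847775972758891393241124511216031051877332652847225339604174937,
   111424774664383343447923615608629290065200572233478227941619270620907704316060465427596088262487912593740784331216823228848524585587183024744630128763,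
   166236521027279869220471798720603088555985632657479177159010043829645198278882710478780853608241586407779047622842992685196923938612377946716557403,
   3565589667511248590188927951564170626024682750933823781740384139482325833861042282481370461823463584119509365403585901034367762079647698497722663568505,
   165748747778340396166308601812678495031142299958846103646608256008699243055147737383871434221739503952851676296434662771046658208542753414788563035,
   150628764450353343154233954928076523984522681939459413409686920784657936080855089951374762013697788793162628181006445040142513779131845181630436181113,
   4613075676253514573865650124251441846504106441156324208214656450157502686457455973900326302123908619565249620308395889639175161271897566985703712180892,
   169726717725020565674300008256182778911889715157858410134126854152908024888471283081084348643061156266748901612476241403434375416684945235081781406811,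
   154950644713961629741306214546962868676829823411151388646495138502600880248006314042327581904600767261197135311180570388133738922229117761003469243513,
   3992921282046442040370574604406970313695022969296025639273729966295227263035065423429614155992001539746837565839438290869596226508882851228128083281017,
   4729824223158884658647892939510469478411673878637310183955314351038828639334143749413954491124609616542574792485178880874546452713026338239416404789,
   3481453984319756575566980609654197501626784176876790817817801663290016224053537755572076802289629181932232480441437490051425057932342783794576881845337,
   4916587877114537490380761172367260607959889055412236043988728922778778353918219090748822958241151057836369457014928213853582337935795226689191658162997,
   4115198575567834543691421290415399323826098930165380310518460689326929822407353863452566708510692176884688112295625779501087204789432938287534975288409,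
   5485770962422715990032185929165934089531137785132282817822245824161537506499326348094390225866583199070811669356118348999923284001851950841719762969962,
   177240617635661507704640406402825173307012647334462687726533659714543030676907597582176001641725206205864112820188846321703308340797933138295353575737,
   4325943883648307985172713447656543342732612888509331107135259196248351582233167097742621488574619216073474057145865037897706695579016723953028680812793,
   171430342575802910045302293898949279087706456692190112814907170438806413171791279975580400235657507785466566895560262500781330082738568849461151375147,
   5428158192546453563427635423826685852566862259523029169091216188497711508095133659440788788990785102708660640309511495557195913824916999422071121448249,
   154950635027162688549039260649589538050896563862340123422577510208006050427441890806691367050149084037727228876979266814083780466933930982344280311929,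
   174540189293404077176214422815172382650650118647512167287355951711463092218869769099429205352278551720579875545189663811193162237303410365936747743353,
   5216547909379001040205239705708201454109852642190804249527718390339209474740955208184598449977098835108213657473022637599160707149697427113797649529,
   151354380697105630127827828144589904494933985944115164612590086626252755691477198604885913148281248722652772506118018385333168276544128904987845821529,
   3487847423095993970671458002609506930164427661041636854591778222897806944323871321059269869461599522520497644821895762535182566867601785301669219894361,
   5325761706150138132793293894635597671596693907993947455645054285890536604332365186840904394055881423137790024669634899461869790387287835422631555884755,
   150446700287701355908875942869030217851143989117983640499720458549185218895485058947446656971064741490361794140317594260867560830981671416833724449881,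
   111393465715991909218296027483139727789015868007681679809324476593116980978064212459851469875235779698527848858146002331652286678234241548516598023257,
   124781914861177622906779677330990552473603244734941820575443233800328926023232536533744147233098686230923499678214670309137045549167968441970652947547,
   4814294409203605128587976391993749866517572467185498051109101960375144270594365378099571519313430530731639276906759140875216730534859005735008112136283,
   111393465715991909218296027483139727789015868007681679809324476593116980978064212459851469875235779698527848858146002331652286678234241548516598023257,
   124781914861177622906779677330990552473603244734941820575443233800328926023232536533744147233098686230923499678214670309137045549167968441970652946523,
   5370690743717746034228360464679972114050926498245115072380726612372625461313684379638015497839919314398648936853944915014980653861980327094282989785179,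
   166433760432554816111053532208260605751821547711552932936427828589459933232244704936763886699274945620601280049417092911945325959448287146410123691129,
   3667889952752952611229817184690247092001228665185399409812893783284810316569861878438634023756388437014410105910918428795880692566886828780602847725849,
   163900507102250710795854058497409733570047808795849122885397004555086449818374112336557703709120233500288353212360780813939397912014073323301911675,
   3485249680232896327046142443051303526816520508433899063254236702704148013180175556199445271436432300800489880100212608246050659362648219813098397533274,
   3587043656961898726281859244693405864953278847305863815058851439081291993527402563438633813101972270268306949578603113551589790180155495489027363119924,
   169729839473663917023241312150569412405897516793115862658177501874358369493236642946309842488648166787062628042390732657483319241237107766820911255348,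
   4919185918013281075986574220524899820863436319873349854989339240098747111834592364491016408503778631230469281578640767363041880029581764401123357198457,
   170226197531934602297920307910681505588458961762554781202621245471344011268880930356900226445079614194835655009693129961739823442100302517808605990708,
   5328375352743515566519123463289683120268007092272559791415978971055314383690180962341866695044374145883580191687888299370160702792506634187846190367865,
   167412459524585898415245338945215452385069626783479683356814833866706450973129043617859774237968512334881758794667584652738891085457886443177284405,
   111393465715991912057509878878018149226089704061190471876068301286820099460192594552964469596511996630437410530783827728856446046493329846363709607065,
   4327630160399465270109367491786287387244592872578635127610319783900749851158121993833679013091245115482837533331885793200251067636087039501752672347,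
   3481453131292837367369809743712929399842165352393224390775831345564807500458932322844426606266293975391268487041755507211768930004275371058137656263769,
   153743364668081605697700828185517610881605817808609215462337075557364186546322238582577245166948406799393988710142127540543176000839754317516979079983,
   5200939166162244270305951074144575602532648364381984729140785707513886782436301635389740387979625660919922509679143989218458757396383070433545815161,
   3485150134713484575996225251926132194416742509779541625713630775973210517271990916515016285242129530627351662926648192646039142172577746331960286970969,
   3666787877813717501404205127365896027793413609898732127332463405742464189801492742951287300338425825070487678595852811167258144671521653617660721700661,
   4729824229578324462941415366404774598367087049746281071225750818663874028316514260135871398876190201029751625432735085955475872890292623051143243243,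
   3747236000410950854591673682870003173678081496212865413448186142373675388871350276193263002653475798917341875481]
def bl_beta : List (List Nat) :=
  [[30306403, 30306403, 33553507, 33553507, 33553507],
   [30306403, 30306403, 33553507, 33553507, 33553507],
   [30307327, 30307327, 30306403, 30306403, 30306403],
   [30307327, 30307327, 30306403, 30306403, 30306403],
   [30307327, 30307327, 30306403, 30306403, 30306403]]
theorem chk_beta : runOK bl_beta 33554431 false 30 17043555 0 cert_beta = true := by decide +kernel

def cert_gamma00 : List Nat :=
  [4801355348744665517860605824974053027544389521801649309463053202957391410192378303150868932461928038503738819798912465962695013286691671777092151394,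
   4932571230554804434404487048131867008290806199428402634552768133494524357030088772985420856303366855605640231893079680604181703743713760831845398807641,
   91536319616199842435815818306896417820591128067703350887556920420848855959186882021699224226464857]
def bl_gamma00 : List (List Nat) :=
  [[17182819, 17182819, 17284195, 17284195, 0],
   [17182819, 17182819, 17284195, 17284195, 0],
   [17183215, 17183215, 17182819, 17182819, 0],
   [17183215, 17183215, 17182819, 17182819, 0],
   [0, 0, 0, 0, 17182819]]
theorem chk_gamma00 : runOK bl_gamma00 17284591 false 30 17182819 0 cert_gamma00 = true := by decide +kernel

def cert_gamma01 : List Nat :=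
  [5335271921495825069869046841789378334950042285449009718478029772330814390445161903556776299754224559153555609751980952976089658205178032878918150242,
   5364216311558526465713702980146499361677836576893577604795029591851418382540994867223658713589281390171004666227014338910799619935514290269208695965785,
   4714598414305415928732351175464844088598698407082493810133069860915961197803657628490731100726771448082894303269357683567478726513691785102598029247577,
   3481454081874411951885982853401641801834536427099335823073769954586717642065141321656818317055388385547177991600422471406117082554660635799412391634452,
   4860840107632897543855529434271434512891700141276680007467505632723967121926270654315159518546376704037445244488607148564672106427191742626899520603,
   5364715791341462682347704810053381661500061054745329532904742677857281566860688853220986077027749450983172736815274091218845663912609539059353082299481,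
   163949993145106518690484900950607936689188905356462691680820094107276290289499869431402012642053351767547481348640299309524116232535102406807225433,
   170126204032614050746550829284735332821821909694079854159049023733318489919094716097388170083420705015301560155021988284496851287284840098008145298553,
   3564571902449955189989473237174881144581964060194389449734150494084231127268803462808200258000931817981368669693284713345824770277330441840757023409241,
   163703003499566538648406260973228414334915340673255711155313878061641597242757727811698385963956576144404665792697482996550505130942595952710872155,
   3893524437279065895370695797372419925312919382307257193621876378550327948721080280071850163100270725426974400878320982029791522631092473]
def bl_gamma01 : List (List Nat) :=
  [[17182819, 17182819, 20970595, 20970595, 0],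
   [17182819, 17182819, 20970595, 20970595, 0],
   [17183215, 17183215, 17182819, 17182819, 0],
   [17183215, 17183215, 17182819, 17182819, 0],
   [0, 0, 0, 0, 17182819]]
theorem chk_gamma01 : runOK bl_gamma01 17284591 false 30 17182819 0 cert_gamma01 = true := by decide +kernel

def cert_gamma02 : List Nat :=
  [121946619558000207935948267754966712549014286146663230715269330403912819462554122600915230934257316453573893496657012899286167918681440201083015790,
   3091773349823580511939739868040856076131423807644555797702390855599094972029247659922988414360122943762809362429731778633711998796890]
def bl_gamma02 : List (List Nat) :=
  [[17182819, 17182819, 20869219, 20869219, 20328547],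
   [17182819, 17182819, 20869219, 20869219, 20328547],
   [17183215, 17183215, 17182819, 17182819, 0],
   [17183215, 17183215, 17182819, 17182819, 0],
   [0, 0, 17723491, 17723491, 17182819]]
theorem chk_gamma02 : runOK bl_gamma02 17284591 false 30 17182819 0 cert_gamma02 = true := by decide +kernel

def cert_gamma10 : List Nat :=
  [5500627045044295879708500412677233507473770500895009243840159668133333333355267129842082662575503174407019929771978608647283323311983532173257967978,
   5536836518634653907262251327763531128600801249877783514633294257553742008942459086841975146145195561923535945960961629206880126536515932606356366885977,
   3717262187557645279484348245641428638472099685691464024792301974977906040845779824971027800540567923875687186427738478520487532795296788850178809464921,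
   3481454276983701275510683095554666610155710628261405332177952648451000956552162206779327314475274267926676857880470992964959364485980930535295045166358,
   4068697460940622973055730781039156639713959085144668927801047558111445798978694279409926226716812059666887640783778711861143762806947606381196569947,
   5537335998417590123205880775930809541668992527493067081632542199180668560856402904977719210965701288367191301184755179401424427635105309942646085583961,
   169383330171852716226833314216491947656388350589436201842542742275897565180407696204444928165534292107953895410007183507276011152899927460843588697,
   176519545225170587763299550996532822418162378778003871507208156815490285709087720220156096236690295143281035027061483864478953107038018796836403514617,
   4383719798583783724645620624919498343335131729607464636857436121173936119286367847864856537316525790208479482804096765883813048422536810288580136240217,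
   168970954154261833514965856050081551449557537467471535917732962875429512213194933925813161679007182336569858129227397290011630637353710379246644571,
   3165976603386770458603051090042043774540465849099356807441614793048873040229153740728815970198146114868777190936029181699895828702889081]
def bl_gamma10 : List (List Nat) :=
  [[17182819, 17182819, 17284195, 17284195, 0],
   [17182819, 17182819, 17284195, 17284195, 0],
   [29766655, 29766655, 17182819, 17182819, 0],
   [29766655, 29766655, 17182819, 17182819, 0],
   [0, 0, 0, 0, 17182819]]
theorem chk_gamma10 : runOK bl_gamma10 17284591 false 30 17182819 0 cert_gamma10 = true := by decide +kernel

def cert_gamma11 : List Nat :=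
  [5335271921495825069869046841789378334950042285449009718478029772330814390445161903556776299754224559153555609751980952976089658205178032878918150242,
   4712000967169611532165820826583086805855631694938512262520028543516489212060806423587082739534872264560496891741042483636264649429916562081383674447961,
   3564571902446925568841701257633048985409456954701886397510123984984737491506689141956241068590999266862716918879242678744542703873294435883353194400564,
   165651097914612341518860889206453515577985405953162496559790255106240371424887160642034320275696077797189359452537413248298422465187423687564640910,
   3564490814876425205332463806859434940832343696327203074245817581582361635287570220804443660178630285988504182402258923007567483601337125764602786808921,
   167647466034065813553020188419226055208599466564679799157828915597147967497664104297079803652174592753944348919504517610867432470626935858748994971157,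
   163949993145109357904336295829016983679045233257533709742113099808983685866278350248768558112116562180180902855775452232795254737255546382334527577,
   170129325781164369577996062276843626152259190031440858037198560780670025493525369222980438144965365165949976045367429007486801347529216733397111769209,
   3564571902354686984721372120593552985392827021214220150855331819418942910730733634190139781761477566466268176799107790735892195934195003726795833051225,
   4606682042457317941323413112687971177798396595614688465910232274986711586233081464032878324944478568388039579388562916285913999893310275485716190686299,
   4712000967169611532165820829124646685803020508205838134673381357493016280471761369917251895175136519289583795913891648245231621885999682580562584832821,
   3564571902446925568841701257633048985409456954701886397510123984984737491506689141956241068590999266862716918879242678744542703873294435883353194400564,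
   5300835133267594928603548454606512498495532990501199890838596323560395661522518822612248169841374982547038009190291956385781516878565952222965580430,
   3564490814876425205332463806859434940832343696327203074245817581582361635287570220804443660178630285988504182402258923007567483601337125764602786808921,
   167647368479420708823365775314168176921876907960791547903273208683040048964396526663156636868100580663367076218852475822366092070588614470441735644693,
   163949993145106518690484900950595623562252532081708854480788799227962202870977848979318278800364524979493888470324232351319464696397350335560254553,
   5380281242942274077902405011690313979472378617340239578319566048892150766881117969746825821258224099288973553808726760578172282393763312439623133922425,
   167412456361383676009995893290565627001593205286705808674246560811525568541975016532308552655779241666406074856120309371445461061627214911627297881,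
   3481553529853960403115873793767467717740690200235541819033331234700792806104230767020866607472059642661457007644492346356021848456672830022296225940570,
   3487846837768115401017025809215584564925987108426174036179528274504595381499430844487849858784111271187009652709709263010130772093346643097029924972174,
   5301033291134589754882404318866960589809084683848039032620686961122737093960965003389321166005776807978620590530781219409906112212706377001389361968,
   5380280761266213873299722977800529317488766275735364279798836873001301645173129161820522994045704560249033155415804532382422225840817519075207345671289,
   170731823138266390504859088679074917258882906484839617199328571590515814090443536252630646657985206587931312575002001901328190251416148823998756621401,
   3992920806635149532233212365095601664104939859753655824064552058696906922399073721364650437192627069541133587179351101008540888925661124841010434737274,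
   111424677097719295237039134313736341949857817965950406527931235747081428330699792235166213345067598705745567670172009736039796475074836849298013981488,
   168133788841946064934450156615322311858511831791882486822486439027879711465034936554588306914319503102780424895533492964826460410027384917635763817563,
   167412456361383676009995893290565627001593205286705474991457349412028749080423689568890747136844612036720730651225581528953509428968048421669930073,
   151315927941475653094197032327560215412161266456102744040977178855108961735698815184134204218907956258039992220215428355868559760322783319755392122,
   4814294409251100360288829479633929732395839227104907122814634872946132481232203801748422495454777294397707447557755714872959882682172458210351497938041,
   164193171028751974678964781327020288052481537603406784822016908949788265092816793695653759836850586300017013104099266126133400219872935787697865817,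
   5238496016680073574916134926138312743213674694301714597032104612613612767388026056257169444427404181433742583299931152006273769658004688767825282169,
   4714598414415569794359639908783405730583103233814063175838179737558023095682692338430469110468682466026276888189512966813079374997138139249297828415737,
   3481454081874411951885982853401641801834536427099335823073770845789957297666171203087163513714448005603577795027543594622836329005216745095347032024596,
   4860840583973923898224461224676285250374351775279082147508269618801384056950034512311622549598943699809535570389933308447274476948428265955800476763,
   163718133280684285960318139955242360275270417930460495999290242854531297816793483069488903191504480611577597024487711938703550369099292098453472345,
   163949993145106518690484900950607936689188905356462691680820094107276290289499869431402012642053351767547481348640299309524116232535102406807225433,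
   164193153165962954037548981069650695174327960734260241037584413113163780727573180229090143471015139748809009516160458837485189090810970500825842809,
   167412456361383676009995893290565627001593205286706209171815795982166017608544923323330040662877183538800439926421776037644044931730344217018598489,
   3481553529853960403115873793767467717740690200235541819033331234700792806104230767020866607472059642661457007644492346356021848456672831148196132979802,
   4735798713355958881012810298047089777869216561298549868015753147445737132370612469728446282884932387807592252936488965246564357471471817705380734606,
   164193171028842835067549714551917037245222869529370702072132694260701698484336184023950820243331096068510078915370307976464888928303121021853403226,
   163702890367386671927298064583802731865853199075378916552192683088465661244022533285418213966282248969189494803452207986779064264316699327214292058,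
   4714598414305415928732351175464844088598698407082493810133069860915961197803657628490731100726771448082894303269357683567478726513691785102598029247577,
   3481454081874411951885982853401641801834536427099335823073770018244091911783007907925374779287628015741358670482736420547151882037731051589791701362196,
   155546890545476540593477606172363228221808771315734472720088017325428265734860742433549196249741949686945312446250166962757712000356832051985252445275,
   4817076889893719224882138822716923983825065276700301688228981045622034033927682868153713012874390188335960911360100485569290848799745690557734093913,
   3564572978977491142106714636571070917652104827483046191043999482108447434268246755214664693000994080815297629945034491695406159006087773856747523115257,
   164193153273535088439198137683869310648863465158768606945495581806923368909915804963248314685219103626539645866026284350079935094414408016984855059,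
   167412456468955810411645046919057820938143304779253338951176225181286673815088869695204664884031531916115752879994561751947321593104144631722117369,
   3485249680137534541200670620562871001433313163373326609141335778428406482862441792898351506794113648211569541875550696452819754414627665010670097892442,
   150453431559331438187056031568214335090378408804861000647171647359983367668375324549602105811177927797718553128120362795640923754375829430586067641998,
   164193171229359468563121316634616999620427965445649862235204079062410476091113125469868129424879561702303000441633858937511391603677076037499423993,
   165657671406171627514286857541499317441996686984655305712891232492464536682125653675683360791303000967018345213511278512217155889497680774861753625,
   151837974598795516665964713872338547261469731373717868022121082310542263542812691542304000125841496832864853062226664081096051523003932981723204857,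
   166727250538484522506836780485610650721791018177942717289196041469939377699403409982908478854658866993907143366273739255543376960378549565176319225,
   143958913482285405290076186466351529089687209695836461108285222679958510812009441167798449005011062729076727836163050395663972304094855587816640250970,
   3996616956918723670318009191891004947797562822891440614172556602424522792722608227804296658759866229860912787876999994745332049292664994299685538124891,
   111424789895277697580702049463473878325503251583285129520902675623660109246163224995430086936272115274281467050418762244621344691173517746921372983088,
   1957240358095223846745488171685636264495539571803]
def bl_gamma11 : List (List Nat) :=
  [[17182819, 17182819, 20970595, 20970595, 0],
   [17182819, 17182819, 20970595, 20970595, 0],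
   [29766655, 29766655, 17182819, 17182819, 0],
   [29766655, 29766655, 17182819, 17182819, 0],
   [0, 0, 0, 0, 17182819]]
theorem chk_gamma11 : runOK bl_gamma11 17284591 false 30 17182819 0 cert_gamma11 = true := by decide +kernel

def cert_gamma12 : List Nat :=
  [177118920932152086339926550841404098875761556563953492568936915669486242140492808018720061108800218931186941804061998036345578148082027351215929643630,
   4606680868662732066281847591761190414974700535734147003929026317312171787731255983942682340841808134212332733780326934029896637784253985427749770527833,
   136998154031374832098813537318539576949283948550354774770292145351366085448993906020675263392695528004770504228706392098155318923896497861542352611012,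
   173553129082480179903542771519721909946544657330257775316923009991388598980349814257195809179807267463683337068888920573427210989658932753720433906011,
   5640088361210119802626625284809021287815657916321115046770179841181106223481941799948562238594661457264212519559311878121712135309674954297524570096730,
   3614968730950830015778629841676103899526904165827901862020922934744328065608140973621167656666772629945293313406648347198871577107431989367012129670234,
   131766257318990794644086597179082698351866625484503470446866496769724740983829122136272588620493177520067930906020380141948861590300577772128049335111,
   55996214480942766053328314174183184726233308640081864963772508]
def bl_gamma12 : List (List Nat) :=
  [[17182819, 17182819, 20869219, 20869219, 20328547],
   [17182819, 17182819, 20869219, 20869219, 20328547],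
   [29766655, 29766655, 17182819, 17182819, 0],
   [29766655, 29766655, 17182819, 17182819, 0],
   [0, 0, 17723491, 17723491, 17182819]]
theorem chk_gamma12 : runOK bl_gamma12 17284591 false 30 17182819 0 cert_gamma12 = true := by decide +kernel

def cert_gamma20 : List Nat :=
  [147993709792429058190903245442629572756037251704648473745953528593617656761411101511127472998045626945263942387892969554650326832255467481189407012,
   3802270635201650302486197289020334980441278164715154850192142565193535159125999541511625204900235580675786239999253591291498349365338]
def bl_gamma20 : List (List Nat) :=
  [[17182819, 17182819, 17284195, 17284195, 0],
   [17182819, 17182819, 17284195, 17284195, 0],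
   [29766259, 29766259, 17182819, 17182819, 29765731],
   [29766259, 29766259, 17182819, 17182819, 29765731],
   [17183347, 17183347, 0, 0, 17182819]]
theorem chk_gamma20 : runOK bl_gamma20 17284591 false 30 17182819 0 cert_gamma20 = true := by decide +kernel

def cert_gamma21 : List Nat :=
  [170725579739313178888680934909885866301820100576029353045938850992173504882105623357385667115128412832259909330099303328872276699491553431893359024420,
   3481453594101184878712731443974192178961396595307476170338735314271183353801735919868442024748417796911415798717218660844121928796784796081395145802841,
   111390340917179353100273923446772046560771322586171736436886767664941940876319600725874105816438068791698712945080747816990780441786702598302854112910,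
   168133807133535060269957140921443526726491706450494901870086595636705625486165431445221947990362600172127509285402183547026758940227154622219100502107,
   5434709305474650327994117838947186942560998177670287424117986999566120960262594633819891267398295219081134471262747495196908797817748029015476260997210,
   4407718078346677789864689384011504625814497210355693402210452041126996057946047202323975317362316427972433232858471493850223587834049038056408990778458,
   164338972667003743569059120308859592773274533589372235318521242414871831466280509466045301766083732056354883083692562648055929043362924958549510490959,
   68864285286465463702207601029676209044802875853174380047751516]
def bl_gamma21 : List (List Nat) :=
  [[17182819, 17182819, 20970595, 20970595, 0],
   [17182819, 17182819, 20970595, 20970595, 0],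
   [29766259, 29766259, 17182819, 17182819, 29765731],
   [29766259, 29766259, 17182819, 17182819, 29765731],
   [17183347, 17183347, 0, 0, 17182819]]
theorem chk_gamma21 : runOK bl_gamma21 17284591 false 30 17182819 0 cert_gamma21 = true := by decide +kernel

def cert_gamma22 : List Nat :=
  [116241711693321650277315755445738845713806786929080306089441046179923323553334216100155827767267719578696443472416253900198862344194416738425606088132,
   2929162749199653105636912739238860860227551107571249450607377289228070545824657072316218458476632411]
def bl_gamma22 : List (List Nat) :=
  [[17182819, 17182819, 20869219, 20869219, 20328547],
   [17182819, 17182819, 20869219, 20869219, 20328547],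
   [29766259, 29766259, 17182819, 17182819, 29765731],
   [29766259, 29766259, 17182819, 17182819, 29765731],
   [17183347, 17183347, 17723491, 17723491, 17182819]]
theorem chk_gamma22 : runOK bl_gamma22 17284591 false 30 17182819 0 cert_gamma22 = true := by decide +kernel

def cert_II : List Nat :=
  [3385453491779736350951271923346556080899027487496849242356041610615132612733221721695377318152274092493970420120281421550965476442790197149229623938113,
   166270324375311269031416186878722797925062483976995202430037064713785603159928239729065341966245138667155096931469309744686878396493792722509446088500,
   5629542197526071185464296710920700941143601669513265998193943990260107263909800104714019178088049265333069070931168595401991569693109512527470889305145,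
   5320550486451327886357297881428769372454625262335456917787571234922046797614762095721417222971467978999459866540647143564654245742314533703206791316537,
   4911975703870351086766496745838239603897150832069206351638522126191020440921104553238806496341350614249275613758533302233558265299639244473331748799069,
   5015681522963338176606661378860374374273738047712886076920934264787168675866267499788147421536829281999372463133618737623549655374483668952152221452345,
   3379059684326009984200033491724337015359407947606663865510197927638871259747978127943155757464539349609968429826624691585445307849862500440320334923833,
   3930388296890974040352607558125986635285721096779668795634087265725543061627224794409245502590081827831156236151593550528808156477489298273755739055,
   3360384484668340189548103803755042872861177398197463761354514180996382258219184761609501312078997580180719060576284998039525658383386176197850536903069,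
   150346706722768121892026278076705565405218802085050324380565661999855296924785534271168348895072304730754782436705896327346000493180352921309765016603,
   3379060138554344494808678109360972657235881580366307619363934957105474763845299269277898419053234167913102602998181067768515844053715521394741784644665,
   4727398771601618316331920640166724651330111385115840993764933554711370046250409935462755162394639744187983286427924853151999784712087158633902329843636,
   4549092603798626014137968583357229214990991345850217395715056053144874420688600084788308234764592314089329646770348806737469022059718662256021708598,
   5438754266340861929364918120453150435595523426192133574511553805218319877184947459498508082080754162446324026933941141722473583034546640706537751997,
   152486182736748274685398946480450202093674151391417712995447883275054868770033275206412828680108847492866352589761460897661113317471464908369704813821,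
   103884579102294343256435180586787638517033040708948198866509824610490308986705860137882003999478315308942148912385332737040592174389677792996068295165,
   143357335684638971844527313193025278980894839124031238309009016898430530220770266849123953571169988942596692918439923761030244034642646930414380830747,
   170828625363896109881312998358612643981118540705312007855551598434928966458275616826855036748794400458314770378675888153395589751736739421296736103451,
   157095510356207997028140293638925731980185084660159391064086812110033715376935881107436717149698807176104269792472423504018561730326628481507882897821,
   154553309357998914755437353642607138500872126869606512848194348213560301078673608005832741259349865811281835842376043859727101957291279744512787133,
   174568318933315537424671120063953840830329915377523268435196811945326385513685936132931979856258988404097760884989131489760422194367448413414432873721,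
   5220274702886319911987911838881017803555711924233450273439237345907997000820573772510420064641988602605920832540531678711826419182523844188329534037273,
   166248458419399202479984954794904065685568879580615269892381800706841807232025022052718352200545425266307323279168472920361851392046683508836857384057,
   154356620962722466328767180820878692064699107077848652609599657426157780750310281166396150231590969372743499490012549911051145116017238723623846525,
   3359785029282915662182592639507684711295959422717396572776390418605866864912803912139946408114092590788896152973753247247638663858590006375582497218841,
   5300932665390123483076001785892543459591170754234025207978119845029304590870182833713132539618961038375700135595589582538492419922952970756529190260,
   3360013257743053681376162394451015331486415454145958209171106839921802491845036403505724533252521005863834681488334610701054946158929455485764492133465,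
   3359913264238051796268496489611051150414617153839041462665925888219260667311266566668273970622510414503881689806720370640194694907411259564048665725979,
   143874887037485674518754678355683780705312397238372441125203064819282301613721373813892504672953869963697863159064808817866062840904041203120333417499,
   136388496119475023528008088379459256292824928260109543387644369543021829948362985644819469672427832882686048835710912847967954433060831423555489334717,
   4719675979981632063057384911180812266783967949410311826139641861581026160135925004586447912437621087337904664576170699269460710408610685507462791397629,
   3359907215464867792745626559294086791999533195662869763473555389707808365179722284776684012224361000726908704538575338505946733415090899726416449274365,
   4646140826324288163639715132185793235453990385771183981259098560138022334023898098082560566215526513467226663737116066809045641799775729332511178876439,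
   3491044284417721898019157862171667475896096527855832978518289792075197372206944824936128646426111182194563987140793539732581076721618942334694374075803,
   5248984972671943655915387664686235749129790044974969798539638136643559618088175679858641344963119245880564564215181437888642532760505234852951387163,
   5550224805714485837051103704436199620498171629839650266033597805363800841779239588034054729122559438563088605609045331411896843911902932430575199781565,
   4113636838551353938946417955768619936916444167938358219300425676384678186321736314059149641312944852160748887649475618115284125968283570400581867807001,
   5815427998410485824642018836911866720098468583053036454653164654787645368865142231910677884541976300566946890617234156599995808428478366212048848844432,
   131506437448225085865824364800252443349245605601661373723585093025713247928382592601649991077020786652727374789452657237726419341018378815684628251,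
   181720213989225059539595732784630153206893999573747559500818871587188762169297171664614600275571447841592577271357049591381822094202053225688790535257,
   4698337633576025142026915603934110307959115923081289370740211208532328838842287817627100286062940367087917001448462468682822987550850581265265442843,
   5687679311897982486428631941221461115769037601047536024935846884024257396622879684474433642053945592778647250583664642862757832849796438324639325917629,
   5085989501130608611820533914759368244797716170755944568263230488326883139514950801198850428990547356272817882335031903235340261482844033572769072418725,
   153380049022154243065983916146879166944819534421530214005098440269240747689531776588087122434969939902613311462020736071951666169874369461822293925,
   146743266700407911390851605137526955071920226067033858788414128349619557545703222685253703719739376731569282633419523169647765210710183438481130585,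
   5688162311761273519223857696734821452887042950284527571053494984666223944859633606685654551618659286044290106870352139405314744229375315621995592549433,
   153069067969036085429290004451096043882736145569463674909745735458647405168516842725743428493918515295240284416572577360917187445062064208178325418,
   5686962387393334530733589446662665751801251067630980591177627004157753717538693307397140115150252099609011764504860405422227044058445426969741108878809,
   134272373105501388622513065293347021155140473493614202297956573799696733444672328216622071938787167210952843709010313345258575411643391323943699120445,
   4842499721601296401103482796329687308086968774804987835795064776884010057670206861115467139229379997281595909768574759057135614901587027991406543165,
   3295518561636325814699476387715620613915893300152049555785560793114197177245090334258081173030845903538844333638018606101859420236771463087338592175161,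
   4604495920413635227448523684970844566501262522701835243344842979870824183054369390131028138396574620294313030835761354254821692658766465651611584750827,
   105682819460800551698715993110675693996719240112450519676488555663809756604082862003660917094588396172865843353714873476517955511160676267362301808432,
   4134673268289497709152082827103216630697650296465702952875597640585829925753550430991308582713438005086672304408241719174700636217357055339398531007899,
   5322568138999284483779895583736508072539613555435296335072678713880714914319795440865287095886992843333581427189684607113362338778129811911020148864817,
   4114994229181197806208257632055863941000663128049889417109662152751695499887318577602909473633461857802886296942268757505154089958360804679127172940921,
   4415885102984352977307550807792964636199136823875931320166407798616737815150524130467619223346209275627313240669897313157734007607389163239685884767835,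
   3973867055563555958506285888852125437410028612258663428645560031940645282015208223755217315556289661668368364613329609797850300096016513157213306520633,
   172986463270784903331304758196780271498647564419920806213575838996841229915075816759296661772919923847635714295831442312404387086048894907995047131,
   5197814365883104851016972437146275274710012711100818649241105455817222023307227003961090607879917020593730254694444857984090150423150314501654682905,
   145193870598956339650541392969928637783793447324811090794765201005583657367647502467431236046286190331819232330440814603427246567129362531044150842525,
   4299025073333850242152301958045403857992107663378391713286959487326694499304006711939666921591134159873260491323236684364624888888496727656585831549049,
   5688760514540179284202889773090190974017136349390677373613231377116396277438039481582675550503358748427473161388323544370660067528193009852900975015432,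
   3973564644175611359193517756091978836330709584168545723229266981937684312427545971600571082669721879321089701035348198765962297691472662163427768143781,
   4910404468979141272191843610210242445773336724526176701100063140623212088637448042229549284970965038399385723817799729896668330685709838333721670997,
   158637414604242634417306880041374436386308005165699464207679280780448737554809285620777975275744812967406803680718847299846214871250549645813389233209,
   3314695557486977129161687852108616280302446030534254148968762659315938790032558016896859204233500351859188160241776761276600732184834375215018441508953,
   4399310127914821386101670114202337031469214351061274084815118695410994269570044426229857032834963141026718820370737819012405644360576496722955133418420,
   4951682952860384472439638732370875147521357458960183760908110540012159769189814795926397577428564687699562099525971396615251023447355623098689136920359,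
   105682429242220135605784004274168335588955074645194434131835529747282647485968746393446749674199652885710765297384458041303151239595508020169256502393,
   162535196920626022873041601444381366261384564893631318460079651615731418802948371021246462798822598297387723402614443295999909616163498437924240217307,
   124193326793382522097765350361339133816979111752342903901782711938597348508358795817177599120190890771991074618788700125549000110505388796286598344283,
   4118190913218698130983963262399371957130297454184604033464244550188014145756400600976826416819262720947523257758670113326342417674381622620925738970715,
   3989535863283130555324420966825866736610110768397635073241178878046288490647582334436085683386404991627470473774415149997144836781372479188667472307915,
   5316440799557234975618233872914496691016215077472895707601652528557762348244050631616988363157689023814120453160583820317105558189701401158809061163,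
   3750490794051489504006077184703074089833698770901978964590910527497777055469128367370070653387106274408922406580129693154798895101532350262289860665,
   5481801196952708767256170463333276255847782215506251041260333345935124704244912039415712528456764752413907309423609614466528482735910442245966099972125,
   5047627115329815784660157472693440439973412598956981262565984997302035276146964456339844167394074013696525252278959970819485624444625206366868520079141,
   173432038257999544995373858029076693529195516063408647630835153690601063754707303469421597704733458763147187802543650737107722669656778040611641002794,
   5320050580641096996735508084586416971779151279922563768737818347256625093380171174059797501358359038770097650591909094619029920982711782258918057840697,
   162589599460120557296213787668923912530955470468448141531052457714968363734822788042708162064424165660776128087708911516602430560938508414250286056505,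
   4588544035669730824941023304582210039478473296073363933830249967939755886242827286592576956538397625578209101555520736720211703417801901008945352699291,
   3279554320622831459143964722007707186407031398841646848452337249206673040373060895416816036330690051029675101272590374477369989268491314833522464877979,
   143801905941229413461528110610194301187815356214249191143047745023116797892880996384024331401726702164581625276798339694988280987395097028737501111,
   5438649560085105059158935742335993437207143946657636453782804320239350975215039548876370219345778128460256415530352585180122622024541937247060035673,
   166330059264694441529605489481843890946921683501999233991601254006569826805200139231194938145134863686104327947387389077503757480164086903498562830397,
   143372079927338720038021461904162628573134629460248609972718259604452297576561159410093498989581810394847893092216214950035007698648002775849745875549,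
   5202866597378607758686870211742933492680638913191951733473930761745104594011572974817740451353026981531271256189321886029754734848814936364628160441563,
   3379359341227478693675744442749037486275839166256569045822783057758221579414036499971046693445148415328333717478233138254003888139391086698551153515931,
   105068219468102320294946330631731977140117697037431967897330472128008355037483060273778508900317643233289091798831986575626565241589178785100851090223,
   3836538209846683228972509664239628837205185269003650374949037990744802931037061872356279437433313889039722694290199420887065050410369203434708195204123,
   125393777994158219303301297238735955199293631662232043809322472500773181715313018273564109810522655369254044092499056050788424790723761816379320206393,
   3382257201873975937202688820862749753178340436963461240440114672204042769421189768898202195532635329908238537297463503309451217600436394539872857910683,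
   5526546496414364109130493555467566603156667210045045790585979908685878128106513138662280304237146327886544336575912271039862838031307485726105048235035,
   3359785666773063763754948624827500838042888483346888023795811766188659018572902584482401269899394071577746365494967578064615320266289359155966034053038,
   3359785298149232266425857378793177958458454447880156301284640675684708322307365781317211532418175282128267775849063453069226183652270525801669038750747,
   150045403134896754860376625622354150505494044943904443457899380017355417268211048089894067484150675270383895912123165864834110915423553788691762587,
   153939406815202000011708896726440973348213261412593634281041981534286412755659965451004949314792974070754498909238092490264229164000329212023419241561,
   4810492283219488562920837260641092244972493422971683541159501154383357871180063435033246498265341013870531752939506988424694883309776361027074234812473,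
   157136065166651744410262392347068890489954579420713151233319841791579704385199540417243885398155565192576715513345290165700099680623981799509857437488,
   172826516245623267215429813695181412029524724867202642249707500754811082518250950334789144919253380447592248745262119720186549757242354467036760933465,
   4327426556926368849613657582783779022288763111778642263428695008384821679097533495073861254145409777915289796707224897480465536062603323178516285529,
   3360384432444700548163207979700048382257433267813198947104688778780188910921299845008940767905057349614623068635863616936724239117851969955454673519673,
   5817226711455509087206569130021008497712512196400055149087435715467838836308443674340686647095366501805565179640038929005884021909561789394012754716699,
   150364998912754107979788522564535567405160677539155621147614497642724590754665737519700777151152055605109720245175227704679938162306133277674477299,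
   139664715662913360807661678547160857205671909896821054964498473246940124226467797217309299907235987651903751590968664183116636201478995028767006792985,
   141164881880148057072893972881009737381367197068776908937316651993751776813439095263680518935475313586990378868127217400088717169771630416808223001,
   168908032037662291928370260197308678824058536308504940031752093647631899609999409745145079020601851622450806090590074592926181890901207581344576953,
   4601563435477143862785871438989035794885428718749444837180394353702367203823780543107438879904665227168039456006099943357999766111580931710709249465,
   3379060281562636389925219353090664006529028105163261610350252252700734667291438343769892687030854958280044048022057952092022889130916567830813412792413,
   5466391067371603945894733973243488197023068960809309768577087276130451328201185558401716463064265378639628865979250724437574531940019928946775000385333,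
   154237204298169816946416388757874930358106183726376521895542508343324564280753383320901521801068063125053911397254106978984250345876492792704828569,
   143354588012876435642285559388422688690031755429058756300370406904167969914412973456431038593985825019737586898885270419673813347966362041794613910777,
   4215930297320400944178656929185841571602366782794614163926784687529424590381286735349246949632939187619236262654800689471333150126904830571920654691931,
   4317954193267344467603042026071095964895505459420377542940456271105810659175461608599643994112539585240269649490967759501250911787874805338421327189,
   4564486728598699833942306807021514079151061061175750654527166607734516144624102662664652989933665810572603386693668771297019974340014451320525390905,
   138458428828169154142303965410370335918615702084754410007047834730322535509664835279223055434915922033544893504128082535258588970660427911747346042909,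
   3295494149261852171132286007647917718330060740051671870680126805606795382505108247121040984231045185838563814186562034052442214442450079214056165639225,
   3359785004879273421929827020591907703437697494068980647448295761598958652858192198767958144795240972658950015647639809836371456073741516920874191691703,
   3360984326425491018228085119428904790685086712286305588098547297490236314763008116694317218585104783498017644492527188548031574311388729359402532289947,
   172272126300101767285173809164778227798989284454138176732942775901421540844247769851644456354207625394127953663760108664145568537792830499162696731,
   171698971844146123178327142735537612027459306818020553515061132989610476971196321527755247976562693461315882034231797796999900718994355868155315289,
   5817226710939052291954088615274743191725519914168257605375253212876036627538511437529099065387446573665824029377653404171770649334017639383330844607545,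
   4932568109962514301199170780827647467508545301662905684108319122516375614317942630821509853684353624056248654210575024782071603188958588787382689780205,
   5201708033088209617681660256122212849102003438725691151220772868594932233424224348620603564211952659486740076982661927745934944030917127797326507908345,
   3379259750404481679682103585927192145448885270381621594902617887605553887489954589903700392606458351230238296972110485638482874165481287414952869863195,
   3819788655714052766800706119570949825891982486575463988376214085253884465982482400937849926016383284456930915176434444132427035090749080705248744009499,
   3975945665186469635599623251529867049315536461623783177792285494839797626921886902285277748302865139216344600809660653889478556392091909568630781416807,
   5516232697851168703692619763215806407643501986056672111129188891301823666303433705857214766335971623520265905838426863472509848740849088521019769108,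
   129487114218220716735382553151852398047037411728508863231869018685302558736838580018859884813564289234551900601857483048620105534835859715534802355257,
   135884139189809038656692487958713458184811732063521513800029189805774080485974576198724206210466036767732165543411250555048947641158270326420077053049,
   3975344533499764556191948633658749523296129289539676045512803672842507245873596358695195841922431772520198312601669092385796451539214642172142658453725,
   5201685497971456213966739799048951824060267072989357725640861022399183817521467798194277472334587642955359637973633012857550171546277551948593460590171,
   132792752705752885359098568783996184610481012883569541894475254206369155600198469580995795949338970371815263416829499818001438033844747418203433563,
   3379060726372461625593553479063435192747490523813889053884774421405404143236110261584619250980387802875935643168173466334481952004541517099790287012953,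
   5297710308515364510518702432638054531430309284380364303257765563351803338430501828585120213969077300073375489693522029889318285809638777882496166939,
   3379059778829641080560825088641069438874144443287827004769173595732333808280735016270309227158152694910986239220637460431326256515056745338422679340089,
   141186126608671174585527809201794602913707999771189390924115492822636314368641031864323439616685630908525015823750011327397641452418673371042055984,
   134813379438166532525192198431693322880437427955156117987923995734003356883337645480344679745854172904651725479194170197316068908202744685833155222777,
   132699926845535753027238262232204629625338183208011647522790098029509432112506075967617118166260486071326744394697061020473487271737658965241136185,
   125393784549801608736853175988263844357549765326547243896085926790380578671313281742799605147471792349776293194664481621220697135918009168609810817081,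
   5444035394044416924464359698526076457495975780854112295304145185771045372995765711747662750467332719201579890646545905796441825849705220970771914321307,
   3852072950616681434135035722320613614986907762372244391499487253831474119627333344417430461139924524181355613711630554759727963067533330706650696485945,
   5196142745454208758489421318285698651834187407698663906118266411743746250066930943630498379922384317221899509406886425402152016914615667435446010969,
   5500627018526270624028593863554440736684129841881154625663664654954683661333054736545351852743321002693884225221422705879601978568142265610512958553,
   5027056330202390335614112083191147373151350930077514429510764696545665481849360138472529668448758217070262662506023119687330768339503300233893814273113,
   156680314833234869930242032875019913013929300457871862759262173380892260424182216159670755440885651395118785266885547912439051783629558027918018642621,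
   3343480109127119610933040970098883877908348309311193388414696287937480541060425661134426029849871359858325417506921527881208273886365257171443283268989,
   103884615432612185894977040985191311204110757873683388909574855966141606540968921030644641674873227089148617514462679611287003939283518185521498486069,
   4626361835430092267793781027745176248997674222399245509099176220146792430566465762079051726757579482622724455718567103425999573165984749609002600066651,
   3379060784200665819250367746873397301395886052011267939842041820659024851169869510759408950224271524754533496390580443164496640500267999227016490937755,
   5086404906569743048132828935078349602183235628920304696913978784818876374621391828801765616561605829377903392192798373544128408784257034732550038449179,
   104994067149569740728839013123380951504867367378534325246878567697023844375181458098618993819273891812264841992544639941971950515198938281179820429373,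
   105000414306143530315896321373312447486341422785019625132237959818172780601128287587697604034248863108338718391927133406616111796211936307774223983835,
   3487846391432533445967953454904997288909360083379090081799028029433834807839542657701166025058244123164990202008499642997339864908749282480342932413467,
   5258063654679169235589683712472570880309316768720320116398425113209659760755757843482675427696130264127459762797580084297881465792315870120259893737387,
   134665713807650800403879734334601784333243259722354350796790009858394214231836510697134375561734302045323501579015326925711892465268824457403927465783,
   4588533695276674951872870579403352226317299971002322418307740435826183729665282001341923752096605335497679311929004542622389129577266491792980024823897,
   4428889776437954489485362867272328684407564605390582672136481183133366264963795112614609679898505843004389759382331633354306088364312585046487039665835,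
   3285937311393613810132542566922777502255523912090970064594693034708099274390930236207579523723188917852206637078564859702574992175004575379437360157117,
   150780194829667133196849708013272652641088316896628621822122168657476139486242395990543696633916355916719435908813302490398153676364261237829731052763,
   4811094614461692299759571902797235823566765691246998587219580757002165368910903386801419296693870475450011672083852713895762086411071004944573031743933,
   147358394279897397634995078013636703876967951118631517688043684440090931575349435242273264221708401529883631651152817490698508912261681603927435412537,
   4588530573545185341815646688991435397936060310188613069341621821839356943581307780280059843456612473964267458010548414239875127799168252453852916247579,
   5381878974513570122193890459784723976760516836043204207759114797666487881177999102560761933508516171089918884697361130621894717102716613371215692262811,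
   4332408979159080789924138336960306142133487620473678624162356909702094467477098853837370031633283746223103945705625136006924024132913815062057514536759,
   4358043368457856042552160336838267848078654008034901797079022552367460105793976864505309986896433711618161748890055454123462757068621078934951330873,
   4358944409444803265824484971926766936581019499091433106690736125547849838039333688816078926586739267938837199092393862739758722172463326561762582496313,
   166744816438339050990780153842036176794575061400748930130197006921820165063814416946723594715010894895501017417704774864766886661977868822643797494573,
   5195947699368924906944667751460716134837257596813945238033032443217534339146539224825909239478672125247484204919783454059806956954502068659678970493,
   163133584465197497249622244965031806361115988875301010729085574948685349421190522439928242774046368924906101764093080933739240419785081759698535875641,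
   5535097366009461384325854046159163336082969412777493338253033851524846622912823120679954323586620843305786744357613487125597385411800155558551587961,
   124163570289198939167484147693567856291207635222150721562155129693502366293455508740731198616910416097153815046109498297578431773068824175031394666937,
   5117252528041330797519372977311913835023816715005367460508081163225052397876272814571836065939405500888383626765211098020963117369474634864299486619,
   181788336468479032256075488041416503995262062619421856002227796825344877402192639196153909363141070856211010542241273785863574846505432292748876940349,
   3723887058823627755515966615446460947645752362605426618984758926525065742973342841204792059318406195520023230014116378267555314650654562506225273433499,
   3787557721303489482793417333104479399392007567780936958527208639143742931071927329654564814075617168981304401747914396942121586262309388342647925290548,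
   104993302660263228573347962826577191006146256432806835776449323588190060884627008251665839280091288371409096903198914620853288301066641691234639341079,
   5497511392073959324788161011853308186895697349407797191320078625461380317998631066937768037727263644252092730458384096964824079480646338491721306331,
   4951183319514087318233814598330277067945768682893560412961431380324635430644234945221500962551638569733268697831096246451143229931051836569017803184989,
   4606682041010844221351005067461478287184653999970414356777473806437782603452949484307461194662273843595817590231188258883202602860240388084717558228234,
   120652047710741546170361992524272271636259914697184428862707255609742291290327216937389601817899166653485682561002374662748049085752645309966657697589,
   4814294405567861495199243108934346835911207724485068412122016735845800153647743443185420230303082853480845892810052037000035602480311547213939939217469,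
   135701082613481617309014488280194033880955343175293787344072033472893303913102700627835723794046965798704854027211762229338426684027912565682144377,
   5219684839123907295219338675417774080292723300846007722585335474824190826193284517204548037657700709061364021453304401620670828747970627027801710036025,
   5628839941299625124554914944094143098440220561020189465292642766107792042513001431974692890374551524191925070957869683080373643456462632277271377874871,
   124163606965331150178927789478835562477211087281676991784330129720658971443523647250912086321312370744692611349344740602508111843601203769323048439600,
   5201785394023311687953941829346812477631561375545889680753519201837195458387533050842242488677581588339305443829981594740121744553174915498268621302811,
   3360003892503354091727684676307685777793977152839764171087041119086751095188331198801239464668105190187351999180921292022608654554170241840292744455351,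
   128593569840927379611757048891653841601350230092551697733466613956416858254627722908495639042238043864952420833057558143159107191700441719301725735963,
   4118190908473782308823497447532939986278819593979517922751765422559091012730399921038993250525010018668242457655953158223994108626723777515691299194459,
   166330058776969832903907012273155164798460887385371401168224940045572916567742961283427479985418810217117960727262248620653396707010848955141375946331,
   4619080768475044085763026416314968232836645780355610569831191265384658476050539428906602610841388955660068708551552218937584345461589469177549974410205,
   3420203896424798809920585996400517053340908979873505680660495259955153115107236632184047141426760481717523805794829073901562875636207619015724065948761,
   5310780386364947822135958325545535460451844808225501371472668469393714499536008143772252711404878350831232948656736473235406183227210550032918102376,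
   4094438109082268701319884470718720381364431633572400641516637676075035170026484390953173571644474019189642835836595859086936034793756414678193417520185,
   3379059373765141670770334515217170471960192652513496955005184046581234604916426979322728280172648058190545060182909521735430659903219723835437677053744,
   117805923775338244644518515950543623866153999575528341306603850891640157558777523385438744712244639205496981314062827567292242427274233728572884776,
   124193308511356001606786305019374945905672466953303135543210431086172636573344228271797990576062068760855005106720975735565380219231698896715806442553,
   166138775453197862204666514497541514518340568309270742856080012410100227799169764904496442480816015214066985145957763721498057455547093834039571867,
   153651781197131764653628730481247011280941916918891820525901192298544918764972104379666816492677549946620591346230230415085777312813471126988751929,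
   155440740941888151881058013492490794394527841632610777722974342230475088524448366594941727600136907726887148965232048609048600902003626440427688920121,
   165553447620918578433762453068591914326530460208936806724885697639484238724363765832511413410212127870665913043975858032268222641391336912468345913,
   136383965108877436678861815182007949310863140440415209562007084532293012555086248298165319455361681647285382145142373029062848347546984156150924345,
   4801486438605112088562387025243583531915283204224863154926443660954114841187894635851069924919620541425079452059912942332376164209428602076434302009,
   3992820980631347723861289863770184329057400955987074845931011083989173080758973100154770694533722241199478359517383482906605160470387534943705502222809,
   167328241536893329705199094652996245786510446280290695937894440098995362675628778962143985178944964969453575750180345031940004599104644933355793331,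
   4646141137279724671052717553372169686469867658695800391690664716860378430647439320753772769871968644562560520495464985826427929714198719859597293886713,
   3333863973293641762820556640989375686395588687774036859297881034056035029581322154614149157837673246912801324680455720107505618558322487143978134761051,
   108795443107158018645616013246253386497095342617517408327914461896294438503306584730945427730903404785238920284317071667360774110359074917227202497456,
   3992821489739456267087336417563825165969216006883210761872755284894702094141266242186718241243853889932342608612024829940478482061275270728913637108763,
   152090268462727001782908205965095410719421172524394855565742632596904198921566076528686140868488291108294774093871693463743444157028590828102118427,
   5201824024878716382272365470828474037322271766215453292471117330260094164748368509004805687628094457127716063848062140625317519879570186362142917166201,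
   4741238706325769678115047157945366875064425950976592677395300709925131912635165802042169833973328916375283034925167750097301121975716153796429507995,
   162556573997295992537048905691752889304931145392512997547282298883235763072637876976133532140286377125110139651521940550286302454672113986914281227353,
   134662591606629856964158722896306986782779360300660953616466802889150876200077212225019594279043913241204400658745388721945613108039694937680329756251,
   105595647699139398131404574668171431969764540635549162120899356178587242990563068357876585861792380596588031706639725667958942153894591980887083123801,
   104993872040323530210894014383478682212409861364196503263628190673737787546392048946834966139749032869120694295520663925994789639374752022513044541467,
   170725773977863593835947062535053708440252386740466636621725213571021414028180047079252743950659066025383880261802016578232116011438462325100557397211,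
   4708887964801408122580396267867035180679475100307139743853043152676401998512325894916202674472086719274265163548871690774339950903423475332813237265465,
   5407056113934728009367367785434570264389753812277009755794059182113172593503981212734687832173507750768520946179508618458089238806274498752328998705,
   173622392168144419475275931941933784634200332577547361806901633172367258835130306800986749010692625855522246150225348373524626522097222118662588301373,
   148424515734725101734501210752448594535754036651396409937702020151857223914801061955226432367792382845344818446840145036981734548578483610359727161,
   5451625368807821058770213752459055013286191501434017009759313457490457047732961456292570045696276879017343171704270235719177772899714567619224407180377,
   3361583422265777705229743020149704200539590704186929234853439981612073088312295902368663550818354279683677592970116662790223318667276170810856492500121,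
   143392001114570580343318741517047937486316195171395062091594020737765214874027789056687270289032886366725017407846087280117109041522977077242268608147,
   5202866126788973172357222759805171759022937191786412478270293138786376835514973751384014791747736446101265281907052392580087789325203175745131172687451,
   4118735215429584085583021093957974192979360426653713807443881845800480829082804923921920611435939777273010493048731317782201520531129030253843900073,
   131766059041107130720980217998889847755909110096002715168781033693857835056177860592457750735661148476840391739727318297313895205767090033674484423929,
   5322034524257399045881403858696837570632176525436626329800477072919674005003610509346583689001681876784284253906756714116799714663059763928624828515385,
   3359785099800642816049916736204191995952819033440023464040583284419014263983762534057327167269257887221558682663987523452375576680143427295240231380261,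
   3973564644366147776295725168573491686872836012129149356362663836431450948604646971045304928442304834199149202912432513993398094200273770126545681179951,
   144310923741771060878184173662613853457765588651180513340587665107566502291867995730649509351264259747884887732546599256986616592657422907856713262,
   169626723886281277333113535564572909527241674226317650652416602096280483617698831861151260193709686512265733340270557931418912929118926596938663173369,
   5416336781251304243783096700262107048888107323947927874659171202901961960195815501443534588149538752753329200020744830933520354272029104360519697497,
   4215911567332102234622391069664744554497236888340417044343054165543291941203136173345864418385650879193722816606421358581278321051194870940119191487545,
   5047645937486801119715729156585175463267691029041265402414895436408070474558314247048750371273264066997387680204802780792741235697226575041237814929076,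
   105595649532964722217497143490619427140666923375096334895166617988790638297117708235533319359854211355790055509124449279521276165629569936087926735929,
   4970342187235952704026168141324284370662361468595095085351506295659579692920761913761586586816944355474128240103020388746314012797969905353668852673563,
   4933186215035267674709702051134135479490786492125379397739802761590415273805920938453899879518700235125824551347056884310930980492081908468174788239146,
   5201591445389112227462740469347919302816040717071552289090771887127121841723096228725733537483165759949655677547007529322321824711168581270358170246393,
   5202866597324984011842835756510895236719425984163316439530089049396424191268513936102732329417399780208693129884221956297765047659423202615844937131664,
   4302476137835614856602793578768452866247310846174707826037369241095081769918453680395454289820993037485700510518419840447418105606958133747980867283,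
   4589704782489120274243963807626811391746918544168062022796786771953978227993242527209423000108946997998875020305205482720872661122866572540071767153913,
   163949255227599790181545350666120677548297753657738013417235590911992276084541535445343770150853884670439009725617069095302683650246190710059934107,
   167254608766078389231528281679541081432997362053149459130843868547803367740879512136509968803179264586297147800828684045558908638225301737830423469337,
   170744798007809961009059580616362667299131305238414447430459480040026669469672571567443026810364949360533846134361614714142713408184792110434167627001,
   4012600798222606336406648376173184888245478683125106882295308060124502150469728778175322689827989033888634383064793104859280346417604475710978326437113,
   4801955921467747392515884053020640938253602442358350521412909612929681109503607461666114441085811606061499919737173895116223931372006197429271764789,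
   170145519844325865705114970683715631662852279043496178015540671087578682131811539418494217521542269937978214323181751286692231873198422447306046512377,
   153662589448967678467969790408730108969097124568774489919075633936498891858305509299494175859387703857269120513699179317564692373455254117364056431897,
   120252445636411698511107354591386270275525263260925630609415199320645560792176657785404072985943912089837934675433541411486279076986710478195200695545,
   5368133936534365344777380572353364599374163541079708369052574414375432493548511568522781007014270039476973918445931485484702234222600070922704756375677,
   169867859292396262395977006677430804655579049920542733894651866870120596423299722636948799629730320861339378835868741071642673097080761380324352281,
   4217131997851274698936867150035483308300690483781901162044647371147357971885678675311561704419424648522570217630341892549263622390567204452912543998233,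
   127973134348498483640524403037340472445357363485656043437632511804048226382193488795571203469791078725709203974487293642323169646318849436154674257145,
   125592721561912285276462481711563118639486114438412147200634852504018153414552222312073289954601263101198123633074326373899629854746231986202116317,
   3974145782056350191173716299364707686117631750477595140655227088874338958181411679252436982086052581014621586601350930149044744958828497444108124790009,
   3974170361157510007616086655686647111171456559958732569709434383453629707260446317722074548847539086065723565843550000508681473596892777758781569658267,
   147153157952259743041557567216783571318276165399424735069544351755437267315617757760902535535183370184409295891142733834232820111538017470140028024526,
   157938825005292191460101291118044650751522354367666179499669246384312294410669542176176977519934265766952508694404889736673221655035893665801719093373,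
   4654436661636849432895662718023517131320732823292906207250318591968067334518519477329330690096359047240665469571920278982432186817967745068781424543165,
   5014369544093906148867408079228137682630651574481173477813793155828298951848291193794161793687673549934723594282065937434666420386292913773157955111001,
   153489887925523999822189298465359075557205533997499069128689269291729107077567432389977746189667031867221766640324042321126205684332487732923143230077,
   3337086786402345955793836658048906043526710580849630769436091754268219469310586181377185625433965337019371301827635254895577697033423383058345902086269,
   5201425991497355623483265297489194697355027280835591818922502165642598240297154459650765562675759881579681660490455269386319851104063168003561638589910,
   133309282535817883390745145917324805450109832172626374333298420134582657017938287818187817159726961159942202831822550091802284644476698101919513048782,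
   3484650906087450589396467040987703827609136507401719550530572118906246305870321264821767067925347236309210537725269030443613476883333491743247650197949,
   4957366954883538607405802601020129638741686390955071831474003823817220433332752563792387971904178875658418213161838507203429621398111815659437845531,
   166276569987618303580211133729991548770880974253826214154138277905275945143572883967226110505994499949150673819826102768839725590151530400700897988697,
   163236602262626130261358954342742551646568689839322451303679292903541903563058146689433443370175311290934469436074619184419647553230612457401210701913,
   103683526017964807791708707375067151282936154305096199759957913479836205028908448612371285668422182484519809896646179040596012513422221223345964289145,
   124197509461687633810113184901050464906433701041674492391535799815164855288206693738407491788361918847123124197620473898678944149655975415647311414875,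
   147136533165715933154339043192735828659261866356567412779302413008721354997983847723145368735383810153781417032808408100916158794344504063438595291,
   169278192149651756284161355757072889037608924706658532594714087807705850864743255314432030123837316040244829716848502945958214760596868201381400697,
   3324306756338319371631489637563909929918332268466038255991292372704484791199200159307027373515302283461771447473301196243243503556051189954540937157913,
   119016214863741953080323230379572370636779079690624660582347075758166916262313144660531426761628985716925897215378651748425632542714428055248120669738,
   131834611565137707201201589804486395667888597898548198476024528829800925232300943205583891934501744491789112068484571880595820594497007611546386335801,
   166433174970566935699204278654399685050303109814096441667316167052342448915982150128780727084899758524423859042047521432575390906057298624879600770297,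
   4053462584073181088731485904387609760101192096070507959518511344592462068490784859124535847892614422350065971212209965151688988734174692178883247149145,
   5688759929784609995917129866368475152519015374670873557747634012535382450415003226434632733564400029949508692607902205848638232119763678326862336002105,
   112195032096943272591863562224459807907889169093992813082877148969013450433603234728566576177298107828273307428167016277763261864309213727614916726580,
   4811194494337472541240232694421475206712011033408964529312137219252811755274774783697332689485721866652377058434361951547664466637178778657349388823579,
   5400828602904412936952633383022082758686100895545052754023186782680068928936701035761154463920680639825470307127287736663016064348212780429737595293,
   3385452813153084144670712001978228513277162687341003616046667352581279106824727921399914337582808434215744107806374155274595796844522260022210786822233,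
   162532855503065060649597496259495916104128991460842271362942193276145241552167169046329507450092190621908261654900546631804507984431322652492256350007,
   143357140575354577095012851946545404790678823865063972586166355124194929627204510591097692229135764607219858221920351054460408003387745665390243507227,
   105000316738015556022357891109487620666809475608653454529091901659861806575925120218217146396949982342034152224107483160037738565295882267258729294875,
   5342320878696872036477414067061101136319208189248612393254360734039615772634975141830430042698844356872960068200746799831763419216733682752605091621915,
   173116334852770292049340300836164460474235688237130620212085486552372984759233733144670221682982966225955974744235066472072403622429217293219175603481,
   5371227019042023055717426112350302120819495538378484025059052274825551357417349955332786976014521400503054893716001417376215706334378851222892750019833,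
   4757330060040314921893866946259605094566466156884613858452285532282516477275757538227462025160262133979575578187882671697179157116328443119613207319709,
   126492210476724336048092725891846744583014984669725603384617891714771096464717777663812815633770243735410085393357610599784980536864144535419152005,
   5220371478350938540727842368520950214370890405408775739420899806333444107160132497785583929857277753925989847678396337805897361276808368370129761994809,
   4031281054229838934459846040800203167212910585450078030380909709651989755561860529516112243522244865852116438511127036714394797938208552527925561098557,
   4063092827480466274644541389356118113665556602593565466248890106958551866855220095679010555936317754261518928476248746299785596362911705610276714015963,
   4011343402632540580964860193692036103694443340644255817381053742470235786813671310934785659279063496776493047821808044301899244972706742187030629031161,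
   5816627372978634188483416901721272004282894549485020925805658864395513636386348766491238242625095533074744147650877783159967487201289571213095426319784,
   5054659670415161367317910362400007743643742055027673512186295082241664283879199381459425374099978553562061381445360594671006334041389869194951374656283,
   4657635652053426553213991475099748360273419167003013618185445264464471966433996839220443894786562746446152437780606044485057672447903172423052285949369,
   4587306678460191989667492678102988995475812775896018266325012199693184911775251774190445747979667557514420417437490297457083895542116969842192292055855,
   172826516231869395949299761537298976176905293658991968253892199146555091296438292949672168146289246146035074050481379129513954488074403763153020630043,
   3360007013867947476723221133826324352438527118270848602069884879000382867415321829147029449801723929244771328524488849945965528197783182205263878883417,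
   4935987237866063383755654594372291732340231342292268967674044252237556674205022664195088868971102368373847208640806960314931756366341993204369860635,
   3996117059422525261972176584181267421140950642681770075668355806419689333765618257540585487490050596954179947452219493128018185818089953953177029478489,
   105000219196859781028472797241649760891624164824474720050356181721607646553377804909846898531175067427660290393019446203549254089743435329265849143092,
   4626961094814386514939067713651672167697883969152355031440038596299277471646818599288999305348604173373970872734911706097003040701094273957789657770011,
   5249003335670871312102446648369345837007629447352097344755201992179166259465369605494460910154034322215945761242977523800179520792011824404627222107,
   125977532944682540521417596935506542340521528009214890770805485125568701016689715667545993265844392627839564634933464024690663920570068420776402782297,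
   124173307557153940685199947299322124529163454188991648176165588154654317783118937915553345540692428486006451834239002796324940249318036644983376932059,
   4012599938557527129912117718446491671458453979327056822238724675558376588628197681572329748434358766607007799637620746141292236681153160307188864593691,
   5558295228585957189738026639789483891711715830291366924200766586733659471790246814523424883746919716689669336325579781841626709037361594542358606881589,
   181788335387780747252817163425268990817792937293169983010464455453639399737649217615206519880429268410587196415223372026178600095615406757748889684057,
   165556495883126728227680255824193435070612584636263150629560993002418293996759783146384063040143496381986248110761691936996275613114318596344136091,
   3996117059422525261972176584181267421140950642681770050074070258140211757411042643912105349307490119358087451106142270721818749072253929833712598419513,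
   5546946960589789914851142110391370152334875985298752229811736315095991373928450988507143199582753549695731058833780630350264143269967346914517962526516,
   4364139584934875515095701725195386522935283745358381687198197181026984484311171242871084929906148410818986918081087070927478049707787642340934077881593,
   166141919673210726800166598982461145324881196579874853401797658664375637655818277807814045048003130002507013412494201026505188608202306433215598813,
   3359807124688909632622489152723046231410829955103706176802547239189387134500796463910896772740139892803217310125637536856869649433996397059690703587417,
   172826516245623377480453956408594516488574918234541127427067296309046237151734441616969437263942804004637433208802027367801935549781183793452811793819,
   4587428498416013659140953858399639181168497172728941478759611128522401940322137221728396360916410775514422735153967848219893784313404007995984877520985,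
   5016302769802233143783472499254330252263874787235596212929666830376678096453330913425506802990305808251786801763156484958940524020139021653188451265563,
   163752080938322778738102806267662003700499038821544651670454828927342472504502521556213622454877980908314555597608922954493233884519363368476527009049,
   157170429355635024793669397946521756411726707125043296758766619029992365273330898094930625716199759959232680030824300510858548289688991590751119705149,
   4712051445639544439745456142580726403429379893422494342918729866035478421144165300699535174097804431643374957689115792377057343778908031452113896893,
   5533648324265653117304340561593399200475865692009352856033347672756218439779268380337197474310646280747115298141470912986884867563622113511047649331257,
   5395154813840927762833525103185968380945484350890133013548113492568745468189776308864770132769849247846965266227674724531350536902721976231588366457,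
   176350445201356026594022008776326828357093231008756124259530211014178315545953542346720344124301730336291648234712958639490709091854971112550780930137,
   4633354457675077323505387095567893368520864729842413723726088723869253681922824843917347469990490709837277241625541139580821243298349942714102299494457,
   4012600147751292581652278489010184136315401974196437626714429510590316657441804221610428449303930483249698048658794463926155099994094926764755312537179,
   4732476496476354312050638622441541014336588181647543530094729853144107651795590902071307196938005490558166392072096979036336668390202124411350721732398,
   5569883106953028050303888730689841063572073252042176563152102233256655175866760185819729057969985266512406546884410983944298920811519784810318547630169,
   5202288093112348108494959456860242990986598957138652832384669256318354179471768030292225811073125044567244202044176474088070732422214948426539685317423,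
   5217757026756367420610310299704023373193206360739876432150152083561051855680251630685568528770723374482435539040106003678394508463897399783553008823899,
   5364098665307429545991030033952010213778808354009102851922653008596471460130646433767727676303693779690564245960361164224284001310605598904469532643549,
   4911077365968891004616826788518384968990871355386728469052423945722110484690448414681549189414003666037219840485624499870650440640653606733349931518774,
   3837345195031398831353100070914594375537113953062028670920959234079910552617681729053359369961225029019862641199595104843709509141161433515440457452325,
   151382478674623916468821557395413087934461913442993614688565979234963557400139144301797395708959299489109725588444071558435077346159501112674067331161,
   4707389623051887016284179751244908977842274790408265789463499365623672933253830746735163423700073844240630599699827820426094425714427635773619549377533,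
   3360984439716057794540383267528813457489348476159002341672687240578776022977724248888717606142951509489931442888757030004064332633741665998358859310614,
   4609878905038514704479263820974797737025590722971136571861495764374130322253388887991587214768528758581541350468920047131779196047657548927083967299611,
   4626360497636478430181634389250651122566329848771609957134324617900261529221973683602276017401548235898730527945979286290769878404159711693065584405531,
   139664115085989100931498276591355976600341913816471253306999686042512299032093841430279914817956459810457772921233440456797536121760600610313428077359,
   144690947227417282258208777890422524987107160650212810186578470061782605311307094697155840748213951931989822049222362562391967651332037298314709145,
   4431162372805643925779731657705272227307849527175543945632027452413312865377839416881747695584773477771388357849053790257969089756743561622100099958873,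
   4609878319710684140306539755212513794260385675365865209227928293270570951682667012260540758405313068876793498648314712523347745609990312553221594318905,
   181713382939730426412648975042885896944959796569694895502001109848195141631583016031464808182549482800734289426007831137510612123933291371200561631003,
   4587308902977230953435567552744970091178645524282814390185944140937730833865920247773827486413914166886737027737433164383651592880691441319926611400731,
   124193229247668811648282269224452398340824479678517357777863259081106043354864023390533421904305949322834826265720441878788620636293729444792466591979,
   3996117681235911503647264581344743740608859203177525974035646476511620917260935466464975279041440162873225134199692369613424102436956058488131905023387,
   3382257494537924701062500443534724559608721796090324094556023683568362789458092766373480784170473456588790299622897447610914544425769829181938113514294,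
   3484650417022819429285797430541308314987347792816805859886820272008459720501440859304120096005911395561955073054482797967613233241543446072832097080347,
   3996046685940413387237913128779108746728584191232637881677840052018070938331464973901045375235897489998230666366834048492335256887128269415423919852342,
   3484650846988247194603728349838014572721577228669278573790026747673657397848074465672165457812513854946733838100461279083686516415275674849995196009264,
   163752178481740610149219276194202522834036616419295447702197620858803774122950292994730522932153423631312243528326485266612606751428847869040063139867,
   4011343990781580996616214794520696699341129031394271053416535376071336693179726433106695453586249497271815082119161821669358707282388815702501878930713,
   4911575917181574942983712100309183112111495882591103900941839653638949930805403772558642442735930494462228919494067344171587055621760270076942196527,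
   164188837821360025397412239562007580086008478933662437750712919730691113386442577375661885480032996935147553599625707232841856530447113724257600957,
   4011945700945093296657272238451562420999600363490938003358756037793406261727436395549256592176992487765646316978475971100635875209596586068344951808281,
   156959741236787445789903152474159463640856592122084490749096391470471473054010612841089335122873399191938116251284509785665028346734259499991852883193,
   4372332810238336355602308920343224668663511782859624533431096212541894688343892501119699894284545778181701728204291244542107746658746451042184184896953,
   5202323505445709377664267956029417478039521670278168799042517833105160049603750516956299593006514987570600023380121844728690093987835023893692792799549,
   5335927421767824988036502884843260089827921692025191076768867747685497923366645318994563526078458840193054432659579968918332530471463401840683184123675,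
   3974283329531902538955494306560194439638197524565475070545586200826282498895375798437875217334412068472214972134441842996977624297075024222626792047865,
   5815428035635850900062499400602968510260955736426072954100959490220946925335510468556017459485535948235553163662855504836800538221371054796407486721819,
   125356659208714738546522691364410374534416532327422499352699850292217081033541713757849110949750612236767389141583809029207635638659626342603151339291,
   5201106023474802351366478835451434997928552206837149780388768355421915650467492769013366571563181198556837956456473657151295445620816014757557989442621,
   3936646215378461611703527214501105762088274361310741555824081827099735852900694667454837846582701430604174002830564015896422224553037211944636311185,
   162608329950878809470114195493086131080882850314158941201417913573653786273637229867195579985919266033088739025689305532761573806015736005059348438265,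
   3623204937318137416615489241991317249660326217146016111051920483661143080700316280239884751190428995566870952577973554236824872047560980323522164715291,
   131914760943423481834288434947605103672976311650211950451817029776347038971051550901703252916943667061792295614598313904970408001638062758315865895,
   144368122062350656869969564503580228197307356969536390551041418626007749298617105241562503797739867267532958255780772331847739164372224174632536677625,
   4364375702624064342159662438158194330339544684143305370843958848498342203086574570877802060699831708428531933600080491715612424153801235873887921872121,
   5080193780963860666844808431612133744939120578530160313064130351133967140546215012260578734324528362550986283039036322811766939466616916995643257820541,
   166849361380261563144134659664748888434884322059157751640293346935135216362191852512581694551888428946101071664064103073668082110091487244434072901,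
   170325238226291242290357548577111026714176091309091564947338086811983912748194398303546897454356474599977848451155008445460247276536729265611602988121,
   157557304199120194890620777668720586470978623156741492769164072752652383609195851824145166105691547544241280115147812490601172520311515123881499918781,
   5688198106654244020788366834591123194433647157743654552067679198853157117865652985497648447315859918253279354351269598928529895264743935213027213383037,
   5550104346292460327335771817627309367851232377382418793498442266051118622819928531180552823037397117862750210180009285625882853975390898510877479450041,
   4698529678550051707640656857067468670224786585132457994181317793428107643089264399389759209911968846707785465090383521759285266476298456535676978429,
   151312991753902203793656707282497050591500694826391147639310777586682745880754855379436517967395016693465663029323994819935036884722567508866840464473,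
   4878203698421978281461675124904880119488000852059799639292457772770190642915560085340877206969994904060702148678906430968512895610018161212852960037977,
   5201067518139823645199817812066834131089029664140854923860519921477431158819260648650193031415410629911480043027451371643515203531089262287076514693629,
   176126301636876851343152854397904895963640380177731581440189699919019853369221105843413155195284746924619643973701102164973920889441990072251524607003,
   5202866597324984011842835804138334417279754402601525849137745083656660386058299602274508032801000628207748524138959115760550175897125636845267198250105,
   5688161140534516130975113756147333893081856460517044716014170243339817597148185416227696493286056333255641524462264732077315142208019040940350654687734,
   134369597130293877987591898903313879646084333132572198535532125197064368669909570804341581848692592750876990972261435869228317143196636030516795641642,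
   148660870108464615606600328117622581970404478471337813800799901262219313033551948274439946344630485453522648077179077358525147138025002666645960821849,
   5364324651803275904594488537497979049480531304467352142958111960230670207597762361883764664142314981508798724401271436741825556173573486626734392744061,
   4611985039676704505611163050856065985779443830543641150683891534091722071373933245155622637236376041942777467713732296181245094634247517142221327481,
   4236330770316778970631770065395156328091097603237607981926587443641970614630399833210779736547667758245829139478157377326577414621698359862330783763545,
   5323632565448375745101534283850047983628094526529804682008970758897949997357697010237058435659178859951559359975737173970059128393416932661824595767,
   4322923721146199809322409401832048328406395658621877502091148846742336912084260188825326424520003320945411488217414375706254507009651070633263109501,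
   148547956922266220332890610025125265577190556601360441421214596690204255444416664971149841809250419251680794855786677570519183977701093339480108569213,
   132496694305887352047630410962806865605623037316978943363122535707267810651219459691569923489185449525821213404091928722456505013353108306119429241,
   159413697396572238647479230875482884863895404634617311196452785634685052314855197368800342091586181713717263573125461597292741872488021866123955289,
   129555176072518463021288637508199794519429722551012236094950266836092979134921052988146696703675631906296276451074713153317342955896795509181287545,
   144978963373305550022674248555947962867709638378121167290098652409601124828865008984089220525676326929301297327424134915634864640491846322161706896441,
   128178383482308400269216329131990603253700376283404514889537379108924738466148642098664417791544531762708309399124520816228006718817848110382287397113,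
   5219867801009563888627889521629478571804621431013561634376554102126073791458870837934892670254307977485942661753405356438355561259589329234177518811,
   175926509729656446130663358273428641438187318101011070330729592760484896954683617095968175685932926745973157011181365680390253544499974249228885298297,
   4667223542047332665115805292020275013157976315656953410021741807551175622445853860123044572115822415925917754390544977717895436916534465238495944281209,
   176126301580516883837025256022015597961864251370280649101974190847267162594446213355814004326832741477345232588333084126307215920358278855686066637945,
   4312992893339025876069558084692302766821284995349275101805097683474140241825332415973994094812845079767424591625756299264257604454359382180283676724345,
   3398839073978233930113908148726508518507853221955862688333018311512885266799593820227868803687479306390397988247227662504523402430202243633759917212921,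
   5645712516644124565446254700089872548333538952066452127173464631795183794327016780757781394099716522236263047444134592049172005517386212010976412409645,
   5516836355878919797783398113375648571784238175504191718538112278585883136466557404347210694143826076092616930387861464357861844994651667076505371897,
   132402272670619719733109706198257108909042582812696420209744935577453306012024704402724080290697912613607367945289656963593957588106753670970560716025,
   163132246449516311883145766930791604294531296636988346495019247681844905754613564047015796642365377268326925989252387109608303649101850221575838969,
   3420167166890205357080935285076556643405503160068346517517873804145569056785849022822576244833458334447873895094397255776997407984659151120572179782937,
   143375904610701184431235368390800098208802176509930101384098196449174719258189873132606335949170469339792069026249810579413886559875080152179748889779,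
   5420065197018477160291861638991452222181877628463971941281564908356102400220768959458669686661260528646099059275385509655236584392707018709494689179,
   5336385790366460145837147329047380531607764258514593641683555545818515870441274636077292562929264936595343677920899767552902111387475853849809890057497,
   172989607735011241274971197055953654362454341478265291267307736603269355247063162512770072695241473577180532831660992157956747067165349459198706937,
   106281320337486391456276406918078456223491116354950787050810199587979775964256662067933910626818438317948896367660707520342333085013676258251708473625,
   4312992856895455806629306387002250397793844213995612858513012676849654343146748943387549407936750094054845389091081440893430143818057643112624035163355,
   124196451602517058891873999305556917332887174266960436484647600160760070914935694433356630081996435396651025880048126991797378359112776545195783128313,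
   143373855963153985091857085424591870030662697999515956552406206662217637869495786508944659741543925672765462791293213162610441263461483506421575413531,
   5669038555285798228663043146942876626522730502873477997886013092712507432203863724124538681471669218617447045139865667387135904272854654878033626558235,
   5229625695570579675404906573015086953857095619751593217791240043001644881830704495506892611415795207387064934407516257323996838526822653999682336185,
   131188093473792209594096515269523159371663646519622891314404456406183089900921275354822419096893984583443732083402785112130118447754265345455587820125,
   4012600316010765535381766434445332482782040025348675850965490815738188616041368797004949321488255054331410145946331578468300944111162583429013897977081,
   3401008393598376117339961019389322942877598038836769996233773824728056338777327253422854898364439617028919619392978684305499585847235497083676442802097,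
   5436230535409947058790004802002702604618762526070722391772537411626915291238550475831906323895790354696367575975716627018972429477078426749875629825843,
   5633257039064910190612526391464066399717125015856951617373980725511499511012899580556581581750872361747130609558781879635128230891136431211053588608177,
   5642714283414379917332779040918155147862442036117437932591789226330966706710665948648716930521530400122819438301460021719669805048872948967634653756207,
   143392586442082178186937029601140870077205513258942637138499894197260960809495930066578485283515762795954454836993305947325109821785601248976676364069,
   4215934028577618889697115203318755270219194456357368225092957661674165851396614785477294197235488035942944765228966477039709365334959884802169366653339,
   5201667394304955598840904867320757346751177048925635247923660125338812732081976961258488815185144327763869667966222864564247658071631606894492845876015,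
   5201667397353521327378459744184195920483075841719963117387207839946736779951548673588643567654110973222949011565645552331665048376043706801212551163099,
   151163963163435785013244337943484419816789916148142706782061309488797361234479713764035581739272236550507040454009120482198968854010194248779877965403,
   4225929493571357252674693320253148369282126735845267414735870268189745884093942411552797129423537019686191090272889967054362601216395220231845355801,
   4607281283968934152368814751865089740303261921075132539873041848377701844657997670717972008307741205059851319338983663611472373509410179068835118751993,
   4841961350724992320903589263664369707515626358239046625866600316504780327118620993361649614804255516093173340502296165246141592333922611314734088398043,
   4740068512540205735822705273856314066402032753875125045603592135614397206567205812808007484962845720787026914972596675357604315701645960208043805113,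
   150061694115361577193640634116895410679025506505206617742467405467044739919911753336572685618187463708676734919231532289069407618528032844772619705,
   5591661062911279641520091623719808896008736871591055869937474317540332081406544837728309673775071682874035929600688855089075814666782764435909335293369,
   177736286827353915466125081211375028707003817544232073124898195884111147532208140379011358705868087865116112442269013033327168551344072912885274352889,
   4012601022694490187879501554436634106078227086152858114312753050322351734648662230230810321502824556923009442548864735389629509933967056065939381690649,
   169705582570349146315080760131137956849787846635742490489874197583982843071606213759330047729666533206850411922611669190702349056210067395076941357,
   158278998422862616591757334744385876986154697616794390647673353102661245620023597584664700198844666836714179212195724516975551719730291002188156345593,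
   5430090868668406873755092711163070354868561282766926267960906093800610737402504954654930715778049758084687512699383767325721379466549131505754676473,
   145008463612001134564293956371567699148866455905159117301228115353803915239121153140155471988152455832511309331489770202526691153310347863396181057785,
   4831655969656750922029662134384011322576638485478816578933129297064926400014841436390740527293990384994382631036413042888245538370272538988343697657,
   3215267549648567740634516925029108992398918279291919157109761415183288475065]
def bl_II : List (List Nat) :=
  [[33554431, 33554431, 33554431, 33554431, 33554431],
   [33554431, 33554431, 33554431, 33554431, 33554431],
   [33554431, 33554431, 33554431, 33554431, 33554431],
   [33554431, 33554431, 33554431, 33554431, 33554431],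
   [33554431, 33554431, 33554431, 33554431, 33554431]]
theorem chk_II : runOK bl_II 17043521 true 30 17043521 0 cert_II = true := by decide +kernel


/-! ### Optimal dual potentials -/

lemma dual_exists (A : Matrix (Fin 5) (Fin 5) ℝ) :
    ∃ u v : Fin 5 → ℝ, (∀ i j, u i + v j ≤ A i j) ∧
      ∀ u' v' : Fin 5 → ℝ, (∀ i j, u' i + v' j ≤ A i j) →
        ∑ i, u' i + ∑ j, v' j ≤ ∑ i, u i + ∑ j, v j := by
  obtain ⟨M, hM⟩ : ∃ M : ℝ, ∀ i j, |A i j| ≤ M := by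
    refine ⟨∑ i, ∑ j, |A i j|, fun i j => ?_⟩
    refine le_trans ?_ (Finset.single_le_sum (f := fun i => ∑ j, |A i j|)
      (fun i _ => Finset.sum_nonneg fun j _ => abs_nonneg _) (Finset.mem_univ i))
    exact Finset.single_le_sum (f := fun j => |A i j|) (fun j _ => abs_nonneg _) (Finset.mem_univ j)
  have hM0 : 0 ≤ M := le_trans (abs_nonneg _) (hM 0 0)
  have hlo : ∀ i j, -M ≤ A i j := fun i j => (abs_le.1 (hM i j)).1
  have hhi : ∀ i j, A i j ≤ M := fun i j => (abs_le.1 (hM i j)).2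
  let S : Set ((Fin 5 → ℝ) × (Fin 5 → ℝ)) :=
    Set.Icc ((fun _ => -(10 * M)), (fun _ => -(10 * M))) ((fun _ => 10 * M), (fun _ => 10 * M)) ∩
      {p | ∀ i j, p.1 i + p.2 j ≤ A i j}
  have hcl : IsClosed {p : (Fin 5 → ℝ) × (Fin 5 → ℝ) | ∀ i j, p.1 i + p.2 j ≤ A i j} := by
    simp only [Set.ofPred_forall]
    refine isClosed_iInter fun i => isClosed_iInter fun j => ?_
    exact isClosed_le (by fun_prop) (by fun_prop)
  have hS : IsCompact S := isCompact_Icc.inter_right hcl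
  have h0 : ((fun _ => 0), (fun _ => -M)) ∈ S := by
    refine ⟨⟨⟨fun i => ?_, fun i => ?_⟩, ⟨fun i => ?_, fun i => ?_⟩⟩, fun i j => ?_⟩
    all_goals simp
    all_goals first | exact hlo i j | linarith
  obtain ⟨⟨u, v⟩, huv, hmax⟩ := hS.exists_isMaxOn ⟨_, h0⟩
    (f := fun p => ∑ i, p.1 i + ∑ j, p.2 j) (by fun_prop)
  refine ⟨u, v, huv.2, fun u' v' h' => ?_⟩
  have hm0 := hmax h0
  simp only [Set.mem_ofPred_eq] at hm0
  by_cases hsm : ∑ i, u' i + ∑ j, v' j ≤ -(5 * M)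
  · refine hsm.trans (le_trans (le_of_eq ?_) hm0)
    simp
  push Not at hsm
  have hb : ∀ i j, -(9 * M) ≤ u' i + v' j := by
    intro i j
    have h1 : ∑ k, v' k = ∑ k, v' (Equiv.swap i j k) := (Equiv.sum_comp _ _).symm
    rw [h1, ← Finset.sum_add_distrib, ← Finset.add_sum_erase _ _ (Finset.mem_univ i)] at hsm
    have h2 : ∑ k ∈ Finset.univ.erase i, (u' k + v' (Equiv.swap i j k)) ≤
        ∑ k ∈ Finset.univ.erase i, M :=
      Finset.sum_le_sum fun k _ => (h' _ _).trans (hhi _ _)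
    simp at h2 hsm
    linarith
  have hmem : ((fun i => u' i - u' 0), (fun j => v' j + u' 0)) ∈ S := by
    refine ⟨⟨⟨fun i => ?_, fun i => ?_⟩, ⟨fun i => ?_, fun i => ?_⟩⟩, fun i j => ?_⟩ <;> simp only
    · linarith [hb i 0, h' 0 0, hhi 0 0]
    · linarith [hb 0 i]
    · linarith [hb 0 0, h' i 0, hhi i 0]
    · linarith [h' 0 i, hhi 0 i]
    · linarith [h' i j]
  have := hmax hmem
  simp only [Set.mem_ofPred_eq, Finset.sum_sub_distrib, Finset.sum_add_distrib] at this
  linarith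

lemma exists_tight_perm (A : Matrix (Fin 5) (Fin 5) ℝ) :
    ∃ (u v : Fin 5 → ℝ) (σ : Equiv.Perm (Fin 5)), (∀ i j, u i + v j ≤ A i j) ∧
      ∀ i, u i + v (σ i) = A i (σ i) := by
  classical
  obtain ⟨u, v, h1, h2⟩ := dual_exists A
  let t : Fin 5 → Finset (Fin 5) := fun i => Finset.univ.filter fun j => u i + v j = A i j
  have hall : ∀ s : Finset (Fin 5), s.card ≤ (s.biUnion t).card := by
    intro s
    by_contra! hlt
    obtain ⟨ε, hε, hs⟩ : ∃ ε > 0, ∀ i j, u i + v j ≠ A i j → u i + v j + ε ≤ A i j := by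
      have : ∀ p : Fin 5 × Fin 5, ∃ ε > 0, u p.1 + v p.2 ≠ A p.1 p.2 →
          u p.1 + v p.2 + ε ≤ A p.1 p.2 := by
        intro p
        by_cases h : u p.1 + v p.2 = A p.1 p.2
        · exact ⟨1, one_pos, fun h' => absurd h h'⟩
        · exact ⟨A p.1 p.2 - (u p.1 + v p.2), sub_pos.2 (lt_of_le_of_ne (h1 _ _) h),
            fun _ => by linarith⟩
      choose e he1 he2 using this
      obtain ⟨p, _, hp⟩ := Finset.exists_min_image Finset.univ e ⟨(0, 0), Finset.mem_univ _⟩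
      exact ⟨e p, he1 p, fun i j h => by
        have := he2 (i, j) h
        have h3 := hp (i, j) (Finset.mem_univ _)
        simp only at this
        linarith⟩
    have := h2 (fun i => u i + if i ∈ s then ε else 0)
      (fun j => v j - if j ∈ s.biUnion t then ε else 0) (by
        intro i j
        by_cases hi : i ∈ s
        · by_cases hj : j ∈ s.biUnion t
          · simp only [hi, hj, if_true]; linarith [h1 i j]
          · have hne : u i + v j ≠ A i j := fun he => hj (Finset.mem_biUnion.2 ⟨i, hi, by simp [t, he]⟩)
            simp only [hi, hj, if_true, if_false]; linarith [hs i j hne]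
        · simp only [hi, if_false]
          split_ifs <;> linarith [h1 i j])
    rw [Finset.sum_add_distrib, Finset.sum_sub_distrib] at this
    simp only [Finset.sum_ite_mem, Finset.univ_inter, Finset.sum_const, nsmul_eq_mul] at this
    have hc : ((s.biUnion t).card : ℝ) < s.card := by exact_mod_cast hlt
    nlinarith
  obtain ⟨f, hf, hft⟩ := (Finset.all_card_le_biUnion_card_iff_exists_injective t).1 hall
  refine ⟨u, v, Equiv.ofBijective f (Finite.injective_iff_bijective.1 hf), h1, fun i => ?_⟩
  have := hft i
  simpa [t] using this

/-! ### Permutations along paths -/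

lemma perm_of_path {R : Fin 5 → Fin 5 → Prop} (hr : ∀ k, R k k) {j i : Fin 5}
    (h : Relation.ReflTransGen R j i) :
    ∃ π : Equiv.Perm (Fin 5), π i = j ∧ ∀ k, k ≠ i → R k (π k) := by
  suffices h : ∃ T : Set (Fin 5), i ∈ T ∧ ∀ v ∈ T, ∃ π : Equiv.Perm (Fin 5), π v = j ∧
      (∀ k, k ≠ v → R k (π k)) ∧ ∀ x, π x ≠ x → x ∈ T by
    obtain ⟨T, hi, hT⟩ := h
    obtain ⟨π, h1, h2, _⟩ := hT i hi
    exact ⟨π, h1, h2⟩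
  induction h with
  | refl =>
    refine ⟨{j}, rfl, fun v hv => ⟨1, ?_, fun k _ => hr k, fun x hx => absurd rfl hx⟩⟩
    simpa using hv
  | @tail b c _ hbc ih =>
    obtain ⟨T, hb, hT⟩ := ih
    by_cases hc : c ∈ T
    · exact ⟨T, hc, hT⟩
    refine ⟨insert c T, Set.mem_insert _ _, fun v hv => ?_⟩
    rcases hv with rfl | hv
    · obtain ⟨π, h1, h2, h3⟩ := hT b hb
      have hvb : v ≠ b := fun h => hc (h ▸ hb)
      have hπ : π v = v := by
        by_contra hne
        exact hc (h3 v hne)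
      refine ⟨π * Equiv.swap b v, by simp [h1], fun k hk => ?_, fun x hx => ?_⟩
      · by_cases hkb : k = b
        · subst hkb; simpa [hπ] using hbc
        · simpa [Equiv.swap_apply_of_ne_of_ne hkb hk] using h2 k hkb
      · by_cases hxv : x = v
        · exact Or.inl hxv
        · right
          by_cases hxb : x = b
          · exact hxb ▸ hb
          · apply h3
            simpa [Equiv.swap_apply_of_ne_of_ne hxb hxv] using hx
    · obtain ⟨π, h1, h2, h3⟩ := hT v hv
      exact ⟨π, h1, h2, fun x hx => Or.inr (h3 x hx)⟩

/-! ### Configurations from clusters -/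

/-- Cluster data: `cl` assigns clusters, `μ` are the block minima. -/
structure Clu {ι : Type} (w : Matrix (Fin 5) (Fin 5) ℝ) (cl : Fin 5 → ι) (μ : ι → ι → ℝ) :
    Prop where
  le : ∀ k l, μ (cl k) (cl l) ≤ w k l
  att : ∀ k l, ∃ k' l', cl k' = cl k ∧ cl l' = cl l ∧ w k' l' = μ (cl k) (cl l)
  diag : ∀ k, w k k = 0
  zero : ∀ k, μ (cl k) (cl k) = 0
  conn : ∀ k l, cl k = cl l →
    Relation.ReflTransGen (fun a b => w a b = 0 ∧ cl a = cl b) k l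

lemma clu_path {ι : Type} {w : Matrix (Fin 5) (Fin 5) ℝ} {cl : Fin 5 → ι} {μ : ι → ι → ℝ}
    (hc : Clu w cl μ) (E : ι → ι → Bool) (hE : ∀ k, E (cl k) (cl k) = true)
    {j i : Fin 5} (h : Relation.ReflTransGen
      (fun a b : Fin 5 => E (cl a) (cl b) = true) j i) :
    Relation.ReflTransGen (fun a b => w a b = μ (cl a) (cl b) ∧ E (cl a) (cl b) = true) j i := by
  have hinn : ∀ k l, cl k = cl l → Relation.ReflTransGen
      (fun a b => w a b = μ (cl a) (cl b) ∧ E (cl a) (cl b) = true) k l := by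
    intro k l hkl
    refine Relation.ReflTransGen.mono ?_ _ _ (hc.conn k l hkl)
    rintro a b ⟨h1, h2⟩
    rw [← h2, hc.zero, hE]
    exact ⟨h1, rfl⟩
  induction h with
  | refl => exact .refl
  | @tail b c _ hbc ih =>
    obtain ⟨k, l, hk, hl, hkl⟩ := hc.att b c
    refine ih.trans ((hinn b k hk.symm).trans (.head (b := l) ?_ (hinn l c hl)))
    rw [hk, hl]
    exact ⟨hkl, hbc⟩

lemma cfg_of_clu {ι : Type} {w : Matrix (Fin 5) (Fin 5) ℝ} {cl : Fin 5 → ι} {μ : ι → ι → ℝ}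
    {bl : List (List Nat)} {H : Nat} (hs : Sing w)
    (hc : Clu w cl μ) (D : ι → ι → Bool) (E : ι → ι → ι → ι → Bool)
    (hD : ∀ i j : Fin 5, cellB bl i j ≠ 0 → D (cl i) (cl j) = true)
    (hE : ∀ i j : Fin 5, cellB bl i j ≠ 0 → ∀ k l : Fin 5,
      (cellB bl i j).testBit (5 * k + l) = E (cl i) (cl j) (cl k) (cl l))
    (hEd : ∀ I J L, E I J L L = true)
    (hpot : ∀ I J, D I J = true → ∃ ψ : ι → ℝ, ∀ X Y, ψ Y - ψ X ≤ μ X Y ∧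
      (ψ Y - ψ X = μ X Y ↔ E I J X Y = true))
    (hH : ∀ i j : Fin 5, H.testBit (5 * i + j) = true → cellB bl i j ≠ 0 ∧
      ∃ m : Fin 5, E (cl i) (cl j) (cl j) (cl m) = true ∧ E (cl i) (cl j) (cl m) (cl i) = true) :
    Cfg w (fun k l => w k l = μ (cl k) (cl l)) bl H where
  sing := hs
  pot := by
    intro i j hij
    obtain ⟨ψ, hψ⟩ := hpot _ _ (hD i j hij)
    refine ⟨fun k => - ψ (cl k), fun l => ψ (cl l), fun k l _ _ => ?_⟩
    rw [hE i j hij k l]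
    have h1 := (hψ (cl k) (cl l)).1
    have h2 := (hψ (cl k) (cl l)).2
    have h3 := hc.le k l
    refine ⟨by linarith, fun h => ⟨by linarith, h2.1 (by linarith)⟩, fun h => ?_⟩
    have := h2.2 h.2
    linarith [h.1]
  ex := by
    intro i j hij
    obtain ⟨h0, m, hm1, hm2⟩ := hH i j hij
    have hp := clu_path hc (E (cl i) (cl j)) (fun k => hEd _ _ _) (j := j) (i := i)
      (Relation.ReflTransGen.tail (b := m) (Relation.ReflTransGen.single hm1) hm2)
    obtain ⟨π, h1, h2⟩ := perm_of_path (fun k => ⟨by rw [hc.zero, hc.diag], hEd _ _ _⟩) hp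
    refine ⟨π, h1, fun k hk => ?_⟩
    rw [hE i j h0]
    exact h2 k hk

/-! ### Strong components -/

/-- Reachability in the zero digraph. -/
def Reach (w : Matrix (Fin 5) (Fin 5) ℝ) : Fin 5 → Fin 5 → Prop :=
  Relation.ReflTransGen fun a b => w a b = 0

/-- Mutual reachability. -/
def Scc (w : Matrix (Fin 5) (Fin 5) ℝ) (k l : Fin 5) : Prop := Reach w k l ∧ Reach w l k

lemma Scc.symm {w : Matrix (Fin 5) (Fin 5) ℝ} {k l : Fin 5} (h : Scc w k l) : Scc w l k :=
  ⟨h.2, h.1⟩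

lemma Scc.trans {w : Matrix (Fin 5) (Fin 5) ℝ} {k l m : Fin 5} (h : Scc w k l)
    (h' : Scc w l m) : Scc w k m :=
  ⟨Relation.ReflTransGen.trans h.1 h'.1, Relation.ReflTransGen.trans h'.2 h.2⟩

lemma Scc.rfl {w : Matrix (Fin 5) (Fin 5) ℝ} {k : Fin 5} : Scc w k k :=
  ⟨Relation.ReflTransGen.refl, Relation.ReflTransGen.refl⟩

lemma scc_path {w : Matrix (Fin 5) (Fin 5) ℝ} {k l : Fin 5} (h : Reach w k l)
    (h' : Reach w l k) : Relation.ReflTransGen (fun a b => w a b = 0 ∧ Scc w l b) k l := by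
  induction h using Relation.ReflTransGen.head_induction_on with
  | refl => exact .refl
  | @head a c hac hcl ih =>
    have h1 : Reach w l c := Relation.ReflTransGen.tail h' hac
    exact .head ⟨hac, h1, hcl⟩ (ih h1)

lemma mk_clu {ι : Type} {w : Matrix (Fin 5) (Fin 5) ℝ} (h0 : ∀ i j, 0 ≤ w i j)
    (hd : ∀ i, w i i = 0) (cl : Fin 5 → ι) (hcl : ∀ k l, cl k = cl l ↔ Scc w k l) :
    ∃ μ, Clu w cl μ ∧ (∀ k l, 0 ≤ μ (cl k) (cl l)) ∧
      ∀ k l, μ (cl k) (cl l) = 0 → Reach w k l := by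
  classical
  have hex : ∀ X Y, ∃ m : ℝ, ∀ k l, cl k = X → cl l = Y →
      m ≤ w k l ∧ ∃ k' l', cl k' = X ∧ cl l' = Y ∧ w k' l' = m := by
    intro X Y
    by_cases h : ((Finset.univ : Finset (Fin 5 × Fin 5)).filter
        fun p => cl p.1 = X ∧ cl p.2 = Y).Nonempty
    · obtain ⟨p, hp, hm⟩ := Finset.exists_min_image _ (fun p => w p.1 p.2) h
      simp only [Finset.mem_filter, Finset.mem_univ, true_and] at hp hm
      exact ⟨w p.1 p.2, fun k l hk hl => ⟨hm (k, l) ⟨hk, hl⟩, p.1, p.2, hp.1, hp.2, rfl⟩⟩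
    · refine ⟨0, fun k l hk hl => absurd ⟨(k, l), ?_⟩ h⟩
      simp [hk, hl]
  choose μ hμ using hex
  have hatt : ∀ k l, ∃ k' l', cl k' = cl k ∧ cl l' = cl l ∧ w k' l' = μ (cl k) (cl l) :=
    fun k l => (hμ _ _ k l rfl rfl).2
  have hle : ∀ k l, μ (cl k) (cl l) ≤ w k l := fun k l => (hμ _ _ k l rfl rfl).1
  have hnn : ∀ k l, 0 ≤ μ (cl k) (cl l) := by
    intro k l
    obtain ⟨k', l', _, _, h⟩ := hatt k l
    rw [← h]; exact h0 _ _
  refine ⟨μ, ⟨hle, hatt, hd, fun k => le_antisymm (hd k ▸ hle k k) (hnn k k), ?_⟩, hnn, ?_⟩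
  · intro k l hkl
    have hs := (hcl k l).1 hkl
    have hp := scc_path hs.1 hs.2
    clear hkl
    induction hp using Relation.ReflTransGen.head_induction_on with
    | refl => exact .refl
    | @head a c hac hcl' ih =>
      have h1 : Scc w c l := hac.2.symm
      exact .head ⟨hac.1, (hcl a c).2 (hs.trans h1.symm)⟩ (ih h1)
  · intro k l h
    obtain ⟨k', l', hk, hl, h'⟩ := hatt k l
    have h1 := ((hcl k' k).1 hk).2
    have h2 := ((hcl l' l).1 hl).1
    exact Relation.ReflTransGen.trans (Relation.ReflTransGen.tail h1 (h'.trans h)) h2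

/-! ### The individual cluster types -/

lemma holds_of_list {z : Fin 5 → Fin 5 → Prop} {P : Nat} (L : List (Fin 5 × Fin 5))
    (hL : ∀ k l : Fin 5, P.testBit (5 * k + l) = true → (k, l) ∈ L)
    (hz : ∀ p ∈ L, z p.1 p.2) : Holds z P 0 :=
  ⟨fun k l h => hz _ (hL k l h), fun k l h => by simp at h⟩

lemma goal_of_fin {w : Matrix (Fin 5) (Fin 5) ℝ} {c : Prop} (h : Goal w ∨ (false = true ∧ c)) :
    Goal w := by
  rcases h with h | h
  · exact h
  · exact absurd h.1 (by decide)

/-- Arc pairs of two 2-cycles with the diagonal. -/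
def arcs22 : List (Fin 5 × Fin 5) :=
  [(0, 0), (1, 1), (2, 2), (3, 3), (4, 4), (0, 1), (1, 0), (2, 3), (3, 2)]

def arcs23 : List (Fin 5 × Fin 5) :=
  [(0, 0), (1, 1), (2, 2), (3, 3), (4, 4), (0, 1), (1, 0), (2, 3), (3, 4), (4, 2)]

def arcs2 : List (Fin 5 × Fin 5) :=
  [(0, 0), (1, 1), (2, 2), (3, 3), (4, 4), (0, 1), (1, 0)]

lemma arcs_zero {w : Matrix (Fin 5) (Fin 5) ℝ} {ι : Type} {cl : Fin 5 → ι} {μ : ι → ι → ℝ}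
    (hc : Clu w cl μ) (L : List (Fin 5 × Fin 5)) (hw : ∀ p ∈ L, w p.1 p.2 = 0)
    (hL : ∀ p ∈ L, cl p.1 = cl p.2) : ∀ p ∈ L, w p.1 p.2 = μ (cl p.1) (cl p.2) := by
  intro p hp
  rw [hw p hp, hL p hp, hc.zero]

lemma goal_alpha {w : Matrix (Fin 5) (Fin 5) ℝ} (hs : Sing w) (h0 : ∀ i j, 0 ≤ w i j)
    (hd : ∀ i, w i i = 0) (hall : ∀ k l, Scc w k l)
    (hL : (∀ p ∈ arcs22, w p.1 p.2 = 0) ∨ (∀ p ∈ arcs23, w p.1 p.2 = 0)) : Goal w := by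
  obtain ⟨μ, hc, -, -⟩ := mk_clu h0 hd (fun _ => (0 : Fin 1)) (fun k l => by simp [hall])
  have hμ : ∀ X Y, μ X Y = 0 := fun X Y => by
    have := hc.zero 0
    rwa [Subsingleton.elim X 0, Subsingleton.elim Y 0]
  rcases hL with hL | hL
  · have hcfg : Cfg w _ bl_alpha22 33554431 := cfg_of_clu hs hc (fun _ _ => true)
      (fun _ _ _ _ => true) (by decide +kernel) (by decide +kernel) (by simp)
      (fun I J _ => ⟨fun _ => 0, fun X Y => by simp [hμ]⟩) (by decide +kernel)
    exact goal_of_fin (runOK_sound hcfg false 30 _ 0 _ (holds_of_list arcs22 (by decide +kernel)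
      (arcs_zero hc _ hL (by simp))) chk_alpha22)
  · have hcfg : Cfg w _ bl_alpha23 33554431 := cfg_of_clu hs hc (fun _ _ => true)
      (fun _ _ _ _ => true) (by decide +kernel) (by decide +kernel) (by simp)
      (fun I J _ => ⟨fun _ => 0, fun X Y => by simp [hμ]⟩) (by decide +kernel)
    exact goal_of_fin (runOK_sound hcfg false 30 _ 0 _ (holds_of_list arcs23 (by decide +kernel)
      (arcs_zero hc _ hL (by simp))) chk_alpha23)

/-- Tight cluster pairs for two clusters. -/
def E2 (I J X Y : Fin 2) : Bool := X == Y || (X == J && Y == I)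

lemma pot2 {μ : Fin 2 → Fin 2 → ℝ} (h0 : μ 0 0 = 0) (h1 : μ 1 1 = 0)
    (hp : 0 < μ 0 1 + μ 1 0) (I J : Fin 2) : ∃ ψ : Fin 2 → ℝ, ∀ X Y, ψ Y - ψ X ≤ μ X Y ∧
      (ψ Y - ψ X = μ X Y ↔ E2 I J X Y = true) := by
  have key : ∀ t : ℝ, (t ≤ μ 0 1 ∧ (t = μ 0 1 ↔ E2 I J 0 1 = true)) →
      (-t ≤ μ 1 0 ∧ (-t = μ 1 0 ↔ E2 I J 1 0 = true)) →
      ∃ ψ : Fin 2 → ℝ, ∀ X Y, ψ Y - ψ X ≤ μ X Y ∧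
      (ψ Y - ψ X = μ X Y ↔ E2 I J X Y = true) := by
    intro t ht ht'
    refine ⟨![0, t], fun X Y => ?_⟩
    fin_cases X <;> fin_cases Y
    · simp [h0, E2]
    · simpa using ht
    · simpa using ht'
    · simp [h1, E2]
  have hinn : ∃ t, t < μ 0 1 ∧ -t < μ 1 0 := ⟨(μ 0 1 - μ 1 0) / 2, by linarith, by linarith⟩
  obtain ⟨t, ht1, ht2⟩ := hinn
  fin_cases I <;> fin_cases J
  · exact key t ⟨ht1.le, by simp [E2, ht1.ne]⟩ ⟨ht2.le, by simp [E2, ht2.ne]⟩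
  · refine key (-μ 1 0) ⟨by linarith, ?_⟩ ⟨by linarith, by simp [E2]⟩
    have : -μ 1 0 ≠ μ 0 1 := by intro h; linarith
    simp [E2, this]
  · refine key (μ 0 1) ⟨le_rfl, by simp [E2]⟩ ⟨by linarith, ?_⟩
    have : -μ 0 1 ≠ μ 1 0 := by intro h; linarith
    simp [E2, this]
  · exact key t ⟨ht1.le, by simp [E2, ht1.ne]⟩ ⟨ht2.le, by simp [E2, ht2.ne]⟩

lemma clu_two_pos {w : Matrix (Fin 5) (Fin 5) ℝ} {ι : Type} {cl : Fin 5 → ι} {μ : ι → ι → ℝ}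
    (hnn : ∀ k l, 0 ≤ μ (cl k) (cl l)) (hr : ∀ k l, μ (cl k) (cl l) = 0 → Reach w k l)
    {k l : Fin 5} (h : ¬ Scc w k l) : 0 < μ (cl k) (cl l) + μ (cl l) (cl k) := by
  by_contra hlt
  have h1 := hnn k l
  have h2 := hnn l k
  exact h ⟨hr k l (by linarith), hr l k (by linarith)⟩

def cl41 : Fin 5 → Fin 2 := ![0, 0, 0, 0, 1]
def clb : Fin 5 → Fin 2 := ![0, 0, 1, 1, 1]
def clg : Fin 5 → Fin 3 := ![0, 0, 1, 1, 2]

lemma goal_41 {w : Matrix (Fin 5) (Fin 5) ℝ} (hs : Sing w) (h0 : ∀ i j, 0 ≤ w i j)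
    (hd : ∀ i, w i i = 0) (hcl : ∀ k l, cl41 k = cl41 l ↔ Scc w k l)
    (hL : ∀ p ∈ arcs22, w p.1 p.2 = 0) : Goal w := by
  obtain ⟨μ, hc, hnn, hr⟩ := mk_clu h0 hd cl41 hcl
  have hp := clu_two_pos hnn hr (k := 0) (l := 4) (fun h => absurd ((hcl 0 4).2 h) (by decide))
  have hcfg : Cfg w _ bl_41 33554431 := cfg_of_clu hs hc (fun _ _ => true)
      E2 (by decide +kernel) (by decide +kernel) (by decide)
      (fun I J _ => pot2 (hc.zero 0) (hc.zero 4) hp I J) (by decide +kernel)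
  exact goal_of_fin (runOK_sound hcfg false 30 _ 0 _ (holds_of_list arcs22 (by decide +kernel)
      (arcs_zero hc _ hL (by decide))) chk_41)

lemma goal_beta {w : Matrix (Fin 5) (Fin 5) ℝ} (hs : Sing w) (h0 : ∀ i j, 0 ≤ w i j)
    (hd : ∀ i, w i i = 0) (hcl : ∀ k l, clb k = clb l ↔ Scc w k l)
    (hL : ∀ p ∈ arcs2, w p.1 p.2 = 0) : Goal w := by
  obtain ⟨μ, hc, hnn, hr⟩ := mk_clu h0 hd clb hcl
  have hp := clu_two_pos hnn hr (k := 0) (l := 4) (fun h => absurd ((hcl 0 4).2 h) (by decide))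
  have hcfg : Cfg w _ bl_beta 33554431 := cfg_of_clu hs hc (fun _ _ => true)
      E2 (by decide +kernel) (by decide +kernel) (by decide)
      (fun I J _ => pot2 (hc.zero 0) (hc.zero 4) hp I J) (by decide +kernel)
  exact goal_of_fin (runOK_sound hcfg false 30 _ 0 _ (holds_of_list arcs2 (by decide +kernel)
      (arcs_zero hc _ hL (by decide))) chk_beta)

/-! ### Three clusters -/

/-- Tight cluster pairs for three clusters. -/
def E3 (t1 t2 I J X Y : Fin 3) : Bool :=
  X == Y ||
  (J == 0 && I == 1 && ((X == 0 && Y == 1 && t1 != 2) ||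
    (((X == 0 && Y == 2) || (X == 2 && Y == 1)) && t1 != 0))) ||
  (J == 1 && I == 0 && ((X == 1 && Y == 0 && t2 != 2) ||
    (((X == 1 && Y == 2) || (X == 2 && Y == 0)) && t2 != 0))) ||
  ((I == 2 || J == 2) && I != J && X == J && Y == I)

/-- Classes used for three clusters. -/
def D3 (t1 t2 I J : Fin 3) : Bool :=
  I == J || (I != 2 && J != 2) ||
  (t1 == 2 && ((J == 2 && I == 1) || (J == 0 && I == 2))) ||
  (t2 == 2 && ((J == 2 && I == 0) || (J == 1 && I == 2)))

/-- Comparison type of two reals. -/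
def Cmp (t : Fin 3) (x y : ℝ) : Prop :=
  (t = 0 ∧ x < y) ∨ (t = 1 ∧ x = y) ∨ (t = 2 ∧ y < x)

/-- Tightness of one inequality. -/
def Tgt (e : Bool) (d m : ℝ) : Prop := d ≤ m ∧ (d = m ↔ e = true)

lemma tgt_lt {d m : ℝ} (h : d < m) : Tgt false d m := ⟨h.le, by simp [h.ne]⟩
lemma tgt_eq {d m : ℝ} (h : d = m) : Tgt true d m := ⟨h.le, by simp [h]⟩

/-- Potentials for three clusters. -/
def Pt (exy eyx exf efx eyf efy : Bool) (c c' a a' b b' : ℝ) : Prop :=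
  ∃ x y f : ℝ, Tgt exy (y - x) c ∧ Tgt eyx (x - y) c' ∧ Tgt exf (f - x) a ∧ Tgt efx (x - f) a' ∧
    Tgt eyf (f - y) b ∧ Tgt efy (y - f) b'

lemma Pt.swap {exy eyx exf efx eyf efy : Bool} {c c' a a' b b' : ℝ}
    (h : Pt exy eyx exf efx eyf efy c c' a a' b b') : Pt eyx exy eyf efy exf efx c' c b b' a a' := by
  obtain ⟨x, y, f, h1, h2, h3, h4, h5, h6⟩ := h
  exact ⟨y, x, f, h2, h1, h5, h6, h3, h4⟩

lemma between4 {p q r s : ℝ} (h1 : p < r) (h2 : p < s) (h3 : q < r) (h4 : q < s) :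
    ∃ f, p < f ∧ q < f ∧ f < r ∧ f < s := by
  obtain ⟨f, hf1, hf2⟩ := exists_between (max_lt (lt_min h1 h2) (lt_min h3 h4))
  exact ⟨f, (le_max_left _ _).trans_lt hf1, (le_max_right _ _).trans_lt hf1,
    hf2.trans_le (min_le_left _ _), hf2.trans_le (min_le_right _ _)⟩

section
variable {c c' a a' b b' : ℝ}

lemma pt_int (h1 : 0 < c + c') (h2 : 0 < a + a') (h3 : 0 < b + b')
    (h4 : 0 < c + b + a') (h5 : 0 < c' + a + b') :
    Pt false false false false false false c c' a a' b b' := by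
  obtain ⟨y, hy1, hy2, hy3, hy4⟩ := between4 (p := -c') (q := -(b + a')) (r := c) (s := a + b')
    (by linarith) (by linarith) (by linarith) (by linarith)
  obtain ⟨f, hf1, hf2, hf3, hf4⟩ := between4 (p := -a') (q := y - b') (r := a) (s := y + b)
    (by linarith) (by linarith) (by linarith) (by linarith)
  refine ⟨0, y, f, ?_, ?_, ?_, ?_, ?_, ?_⟩ <;> exact tgt_lt (by linarith)

lemma pt_xy0 (h1 : 0 < c + c') (h2 : 0 < a + a') (h3 : 0 < b + b')
    (h4 : 0 < c + b + a') (h : c < a + b') :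
    Pt true false false false false false c c' a a' b b' := by
  obtain ⟨f, hf1, hf2, hf3, hf4⟩ := between4 (p := -a') (q := c - b') (r := a) (s := c + b)
    (by linarith) (by linarith) (by linarith) (by linarith)
  refine ⟨0, c, f, tgt_eq (by ring), ?_, ?_, ?_, ?_, ?_⟩ <;> exact tgt_lt (by linarith)

lemma pt_xy1 (h1 : 0 < c + c') (h2 : 0 < a + a') (h3 : 0 < b + b') (h : c = a + b') :
    Pt true false true false false true c c' a a' b b' := by
  refine ⟨0, a + b', a, tgt_eq (by linarith), tgt_lt ?_, tgt_eq ?_, tgt_lt ?_, tgt_lt ?_,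
    tgt_eq ?_⟩ <;> linarith

lemma pt_xy2 (h2 : 0 < a + a') (h3 : 0 < b + b')
    (h5 : 0 < c' + a + b') (h : a + b' < c) :
    Pt false false true false false true c c' a a' b b' := by
  refine ⟨0, a + b', a, tgt_lt (by linarith), tgt_lt ?_, tgt_eq ?_, tgt_lt ?_, tgt_lt ?_,
    tgt_eq ?_⟩ <;> linarith

lemma pt_fy (h1 : 0 < c + c') (h2 : 0 < a + a') (h3 : 0 < b + b')
    (h5 : 0 < c' + a + b') (h : a + b' < c) :
    Pt false false false false false true c c' a a' b b' := by
  obtain ⟨x, hf1, hf2, hf3, hf4⟩ := between4 (p := -a) (q := b' - c) (r := a') (s := c' + b')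
    (by linarith) (by linarith) (by linarith) (by linarith)
  refine ⟨x, b', 0, ?_, ?_, ?_, ?_, ?_, tgt_eq (by ring)⟩ <;> exact tgt_lt (by linarith)

lemma pt_xf (h1 : 0 < c + c') (h2 : 0 < a + a') (h3 : 0 < b + b')
    (h5 : 0 < c' + a + b') (h : a + b' < c) :
    Pt false false true false false false c c' a a' b b' := by
  obtain ⟨y, hf1, hf2, hf3, hf4⟩ := between4 (p := -c') (q := a - b) (r := c) (s := a + b')
    (by linarith) (by linarith) (by linarith) (by linarith)
  refine ⟨0, y, a, ?_, ?_, tgt_eq (by ring), ?_, ?_, ?_⟩ <;> exact tgt_lt (by linarith)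
end

lemma pot3 {μ : Fin 3 → Fin 3 → ℝ} (hz : ∀ X, μ X X = 0) (t1 t2 : Fin 3)
    (h1 : 0 < μ 0 1 + μ 1 0) (h2 : 0 < μ 0 2 + μ 2 0) (h3 : 0 < μ 1 2 + μ 2 1)
    (h4 : 0 < μ 0 1 + μ 1 2 + μ 2 0) (h5 : 0 < μ 1 0 + μ 0 2 + μ 2 1)
    (ht1 : Cmp t1 (μ 0 1) (μ 0 2 + μ 2 1)) (ht2 : Cmp t2 (μ 1 0) (μ 1 2 + μ 2 0))
    (I J : Fin 3) (hD : D3 t1 t2 I J = true) :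
    ∃ ψ : Fin 3 → ℝ, ∀ X Y, ψ Y - ψ X ≤ μ X Y ∧
      (ψ Y - ψ X = μ X Y ↔ E3 t1 t2 I J X Y = true) := by
  have h1' : 0 < μ 1 0 + μ 0 1 := by linarith
  have key : Pt (E3 t1 t2 I J 0 1) (E3 t1 t2 I J 1 0) (E3 t1 t2 I J 0 2) (E3 t1 t2 I J 2 0)
      (E3 t1 t2 I J 1 2) (E3 t1 t2 I J 2 1) (μ 0 1) (μ 1 0) (μ 0 2) (μ 2 0) (μ 1 2) (μ 2 1) →
      ∃ ψ : Fin 3 → ℝ, ∀ X Y, ψ Y - ψ X ≤ μ X Y ∧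
      (ψ Y - ψ X = μ X Y ↔ E3 t1 t2 I J X Y = true) := by
    rintro ⟨x, y, f, g1, g2, g3, g4, g5, g6⟩
    have hd : ∀ X, E3 t1 t2 I J X X = true := fun X => by simp [E3]
    refine ⟨![x, y, f], fun X Y => ?_⟩
    fin_cases X <;> fin_cases Y
    · simpa [hz] using hd 0
    · exact g1
    · exact g3
    · exact g2
    · simpa [hz] using hd 1
    · exact g5
    · exact g4
    · exact g6
    · simpa [hz] using hd 2
  apply key
  clear key
  have hinn := pt_int h1 h2 h3 h4 h5
  rcases ht1 with ⟨rfl, ht1⟩ | ⟨rfl, ht1⟩ | ⟨rfl, ht1⟩ <;>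
  rcases ht2 with ⟨rfl, ht2⟩ | ⟨rfl, ht2⟩ | ⟨rfl, ht2⟩ <;>
  fin_cases I <;> fin_cases J <;>
  first
  | exact absurd hD (by decide)
  | exact hinn
  | exact pt_xy0 h1 h2 h3 h4 ht1
  | exact pt_xy1 h1 h2 h3 ht1
  | exact pt_xy2 h2 h3 h5 ht1
  | exact (pt_xy0 h1' h3 h2 h5 ht2).swap
  | exact (pt_xy1 h1' h3 h2 ht2).swap
  | exact (pt_xy2 h3 h2 h4 ht2).swap
  | exact pt_fy h1 h2 h3 h5 ht1
  | exact pt_xf h1 h2 h3 h5 ht1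
  | exact (pt_fy h1' h3 h2 h4 ht2).swap
  | exact (pt_xf h1' h3 h2 h4 ht2).swap

lemma exists_cmp (x y : ℝ) : ∃ t, Cmp t x y := by
  rcases lt_trichotomy x y with h | h | h
  · exact ⟨0, Or.inl ⟨rfl, h⟩⟩
  · exact ⟨1, Or.inr (Or.inl ⟨rfl, h⟩)⟩
  · exact ⟨2, Or.inr (Or.inr ⟨rfl, h⟩)⟩

lemma goal_gamma_aux {w : Matrix (Fin 5) (Fin 5) ℝ} (hs : Sing w) {μ : Fin 3 → Fin 3 → ℝ}
    (hc : Clu w clg μ) (t1 t2 : Fin 3)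
    (hpot : ∀ (I J : Fin 3), D3 t1 t2 I J = true →
      ∃ ψ : Fin 3 → ℝ, ∀ X Y, ψ Y - ψ X ≤ μ X Y ∧
      (ψ Y - ψ X = μ X Y ↔ E3 t1 t2 I J X Y = true))
    (hL : ∀ p ∈ arcs22, w p.1 p.2 = 0) (bl : List (List Nat)) (cert)
    (hchk : runOK bl 17284591 false 30 17182819 0 cert = true)
    (hD : ∀ i j : Fin 5, cellB bl i j ≠ 0 → D3 t1 t2 (clg i) (clg j) = true)
    (hE : ∀ i j : Fin 5, cellB bl i j ≠ 0 → ∀ k l : Fin 5,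
      (cellB bl i j).testBit (5 * k + l) = E3 t1 t2 (clg i) (clg j) (clg k) (clg l))
    (hH : ∀ i j : Fin 5, Nat.testBit 17284591 (5 * i + j) = true → cellB bl i j ≠ 0 ∧
      ∃ m : Fin 5, E3 t1 t2 (clg i) (clg j) (clg j) (clg m) = true ∧
        E3 t1 t2 (clg i) (clg j) (clg m) (clg i) = true) : Goal w := by
  have hcfg : Cfg w _ bl 17284591 := cfg_of_clu hs hc (D3 t1 t2) (E3 t1 t2) hD hE
    (fun I J L => by simp [E3]) hpot hH
  exact goal_of_fin (runOK_sound hcfg false 30 _ 0 _ (holds_of_list arcs22 (by decide +kernel)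
      (arcs_zero hc _ hL (by decide))) hchk)

lemma goal_gamma {w : Matrix (Fin 5) (Fin 5) ℝ} (hs : Sing w) (h0 : ∀ i j, 0 ≤ w i j)
    (hd : ∀ i, w i i = 0) (hcl : ∀ k l, clg k = clg l ↔ Scc w k l)
    (hL : ∀ p ∈ arcs22, w p.1 p.2 = 0) : Goal w := by
  obtain ⟨μ, hc, hnn, hr⟩ := mk_clu h0 hd clg hcl
  have n02 : ¬ Scc w 0 2 := fun h => absurd ((hcl 0 2).2 h) (by decide)
  have n04 : ¬ Scc w 0 4 := fun h => absurd ((hcl 0 4).2 h) (by decide)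
  have n24 : ¬ Scc w 2 4 := fun h => absurd ((hcl 2 4).2 h) (by decide)
  have h1 : 0 < μ 0 1 + μ 1 0 := clu_two_pos hnn hr n02
  have h2 : 0 < μ 0 2 + μ 2 0 := clu_two_pos hnn hr n04
  have h3 : 0 < μ 1 2 + μ 2 1 := clu_two_pos hnn hr n24
  have p01 : 0 ≤ μ 0 1 := hnn 0 2
  have p10 : 0 ≤ μ 1 0 := hnn 2 0
  have p02 : 0 ≤ μ 0 2 := hnn 0 4
  have p20 : 0 ≤ μ 2 0 := hnn 4 0
  have p12 : 0 ≤ μ 1 2 := hnn 2 4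
  have p21 : 0 ≤ μ 2 1 := hnn 4 2
  have h4 : 0 < μ 0 1 + μ 1 2 + μ 2 0 := by
    by_contra hlt
    have r1 : Reach w 0 2 := hr 0 2 (show μ 0 1 = 0 by linarith)
    have r2 : Reach w 2 4 := hr 2 4 (show μ 1 2 = 0 by linarith)
    have r3 : Reach w 4 0 := hr 4 0 (show μ 2 0 = 0 by linarith)
    exact n02 ⟨r1, Relation.ReflTransGen.trans r2 r3⟩
  have h5 : 0 < μ 1 0 + μ 0 2 + μ 2 1 := by
    by_contra hlt
    have r1 : Reach w 2 0 := hr 2 0 (show μ 1 0 = 0 by linarith)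
    have r2 : Reach w 0 4 := hr 0 4 (show μ 0 2 = 0 by linarith)
    have r3 : Reach w 4 2 := hr 4 2 (show μ 2 1 = 0 by linarith)
    exact n02 ⟨Relation.ReflTransGen.trans r2 r3, r1⟩
  have hz : ∀ X, μ X X = 0 := by
    intro X
    fin_cases X
    · exact hc.zero 0
    · exact hc.zero 2
    · exact hc.zero 4
  obtain ⟨t1, ht1⟩ := exists_cmp (μ 0 1) (μ 0 2 + μ 2 1)
  obtain ⟨t2, ht2⟩ := exists_cmp (μ 1 0) (μ 1 2 + μ 2 0)
  have hpot := pot3 hz t1 t2 h1 h2 h3 h4 h5 ht1 ht2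
  clear ht1 ht2
  fin_cases t1 <;> fin_cases t2
  · exact goal_gamma_aux hs hc 0 0 hpot hL _ _ chk_gamma00 (by decide +kernel) (by decide +kernel)
      (by decide +kernel)
  · exact goal_gamma_aux hs hc 0 1 hpot hL _ _ chk_gamma01 (by decide +kernel) (by decide +kernel)
      (by decide +kernel)
  · exact goal_gamma_aux hs hc 0 2 hpot hL _ _ chk_gamma02 (by decide +kernel) (by decide +kernel)
      (by decide +kernel)
  · exact goal_gamma_aux hs hc 1 0 hpot hL _ _ chk_gamma10 (by decide +kernel) (by decide +kernel)
      (by decide +kernel)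
  · exact goal_gamma_aux hs hc 1 1 hpot hL _ _ chk_gamma11 (by decide +kernel) (by decide +kernel)
      (by decide +kernel)
  · exact goal_gamma_aux hs hc 1 2 hpot hL _ _ chk_gamma12 (by decide +kernel) (by decide +kernel)
      (by decide +kernel)
  · exact goal_gamma_aux hs hc 2 0 hpot hL _ _ chk_gamma20 (by decide +kernel) (by decide +kernel)
      (by decide +kernel)
  · exact goal_gamma_aux hs hc 2 1 hpot hL _ _ chk_gamma21 (by decide +kernel) (by decide +kernel)
      (by decide +kernel)
  · exact goal_gamma_aux hs hc 2 2 hpot hL _ _ chk_gamma22 (by decide +kernel) (by decide +kernel)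
      (by decide +kernel)

/-! ### Assembly -/

lemma hcl_of_base {ι : Type} {w : Matrix (Fin 5) (Fin 5) ℝ} (cl : Fin 5 → ι) (base : ι → Fin 5)
    (hb : ∀ k, Scc w k (base (cl k))) (hn : ∀ X Y, Scc w (base X) (base Y) → X = Y) (k l : Fin 5) :
    cl k = cl l ↔ Scc w k l := by
  constructor
  · intro h
    have h1 := hb k
    rw [h] at h1
    exact h1.trans (hb l).symm
  · intro h
    exact hn _ _ ((hb k).symm.trans (h.trans (hb l)))

lemma scc_of_two {w : Matrix (Fin 5) (Fin 5) ℝ} {k l : Fin 5} (h : w k l = 0) (h' : w l k = 0) :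
    Scc w k l := ⟨Relation.ReflTransGen.single h, Relation.ReflTransGen.single h'⟩

lemma hn2 {w : Matrix (Fin 5) (Fin 5) ℝ} {p q : Fin 5} (h : ¬ Scc w p q) (X Y : Fin 2)
    (hs : Scc w ((![p, q] : Fin 2 → Fin 5) X) ((![p, q] : Fin 2 → Fin 5) Y)) : X = Y := by
  fin_cases X <;> fin_cases Y
  · rfl
  · exact absurd hs h
  · exact absurd hs.symm h
  · rfl

lemma hn3 {w : Matrix (Fin 5) (Fin 5) ℝ} {p q r : Fin 5} (h : ¬ Scc w p q) (h' : ¬ Scc w p r)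
    (h'' : ¬ Scc w q r) (X Y : Fin 3)
    (hs : Scc w ((![p, q, r] : Fin 3 → Fin 5) X) ((![p, q, r] : Fin 3 → Fin 5) Y)) : X = Y := by
  fin_cases X <;> fin_cases Y <;>
  first
  | rfl
  | exact absurd hs h
  | exact absurd hs h'
  | exact absurd hs h''
  | exact absurd hs.symm h
  | exact absurd hs.symm h'
  | exact absurd hs.symm h''

lemma all_scc {w : Matrix (Fin 5) (Fin 5) ℝ} (h : ∀ k, Scc w k 0) (k l : Fin 5) : Scc w k l :=
  (h k).trans (h l).symm

lemma forall_fin5 {P : Fin 5 → Prop} (h0 : P 0) (h1 : P 1) (h2 : P 2) (h3 : P 3) (h4 : P 4) :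
    ∀ k, P k := by
  intro k
  fin_cases k <;> assumption

lemma goal_beta' {w : Matrix (Fin 5) (Fin 5) ℝ} (hs : Sing w) (h0 : ∀ i j, 0 ≤ w i j)
    (hd : ∀ i, w i i = 0) (h01 : w 0 1 = 0) (h10 : w 1 0 = 0) (s34 : Scc w 2 3) (s24 : Scc w 2 4)
    (n02 : ¬ Scc w 0 2) : Goal w := by
  refine goal_beta hs h0 hd (hcl_of_base clb ![0, 2]
    (forall_fin5 Scc.rfl (scc_of_two h01 h10).symm Scc.rfl s34.symm s24.symm) (hn2 n02)) ?_
  simp [arcs2, hd, h01, h10]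

lemma goal_22 {w : Matrix (Fin 5) (Fin 5) ℝ} (hs : Sing w) (h0 : ∀ i j, 0 ≤ w i j)
    (hd : ∀ i, w i i = 0) (h01 : w 0 1 = 0) (h10 : w 1 0 = 0) (h23 : w 2 3 = 0)
    (h32 : w 3 2 = 0) : Goal w := by
  have s01 := scc_of_two h01 h10
  have s23 := scc_of_two h23 h32
  have hL : ∀ p ∈ arcs22, w p.1 p.2 = 0 := by simp [arcs22, hd, h01, h10, h23, h32]
  by_cases s02 : Scc w 0 2
  · have s3 : Scc w 3 0 := (s02.trans s23).symm
    by_cases s04 : Scc w 0 4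
    · exact goal_alpha hs h0 hd (all_scc (forall_fin5 Scc.rfl s01.symm s02.symm s3 s04.symm))
        (Or.inl hL)
    · exact goal_41 hs h0 hd (hcl_of_base cl41 ![0, 4]
        (forall_fin5 Scc.rfl s01.symm s02.symm s3 Scc.rfl) (hn2 s04)) hL
  · by_cases s24 : Scc w 2 4
    · exact goal_beta' hs h0 hd h01 h10 s23 s24 s02
    · by_cases s04 : Scc w 0 4
      · let e : Equiv.Perm (Fin 5) := Equiv.swap 0 2 * Equiv.swap 1 3
        have e0 : e 0 = 2 := by decide
        have e1 : e 1 = 3 := by decide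
        have e2 : e 2 = 0 := by decide
        have e3 : e 3 = 1 := by decide
        have e4 : e 4 = 4 := by decide
        have hsc : ∀ k l, Reach (w.submatrix e e) k l ↔ Reach w (e k) (e l) := by
          intro k l
          constructor
          · exact fun h => Relation.ReflTransGen.lift e (fun a b h => h) _ _ h
          · intro h
            have := Relation.ReflTransGen.lift (p := fun a b => w.submatrix e e a b = 0) e.symm
              (fun a b h => by simpa [Function.onFun] using h) _ _ h
            simpa [Reach, Function.onFun] using this
        refine goal_of_renum w e e (goal_beta' (sing_renum e e hs) (fun i j => h0 _ _)
          (fun i => hd _) ?_ ?_ ?_ ?_ ?_)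
        · simpa [e0, e1] using h23
        · simpa [e0, e1] using h32
        · simpa [Scc, hsc, e2, e3] using s01
        · simpa [Scc, hsc, e2, e4] using s04
        · intro h
          apply s02
          simpa [Scc, hsc, e0, e2] using h.symm
      · exact goal_gamma hs h0 hd (hcl_of_base clg ![0, 2, 4]
          (forall_fin5 Scc.rfl s01.symm Scc.rfl s23.symm Scc.rfl) (hn3 s02 s04 s24)) hL

lemma goal_23 {w : Matrix (Fin 5) (Fin 5) ℝ} (hs : Sing w) (h0 : ∀ i j, 0 ≤ w i j)
    (hd : ∀ i, w i i = 0) (h01 : w 0 1 = 0) (h10 : w 1 0 = 0) (h23 : w 2 3 = 0)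
    (h34 : w 3 4 = 0) (h42 : w 4 2 = 0) : Goal w := by
  have s01 := scc_of_two h01 h10
  have r23 : Reach w 2 3 := Relation.ReflTransGen.single h23
  have r34 : Reach w 3 4 := Relation.ReflTransGen.single h34
  have r42 : Reach w 4 2 := Relation.ReflTransGen.single h42
  have s23 : Scc w 2 3 := ⟨r23, Relation.ReflTransGen.trans r34 r42⟩
  have s24 : Scc w 2 4 := ⟨Relation.ReflTransGen.trans r23 r34, r42⟩
  by_cases s02 : Scc w 0 2
  · exact goal_alpha hs h0 hd (all_scc (forall_fin5 Scc.rfl s01.symm s02.symm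
      (s02.trans s23).symm (s02.trans s24).symm))
      (Or.inr (by simp [arcs23, hd, h01, h10, h23, h34, h42]))
  · exact goal_beta' hs h0 hd h01 h10 s23 s24 s02

lemma goal_normalized {w : Matrix (Fin 5) (Fin 5) ℝ} (hs : Sing w) (h0 : ∀ i j, 0 ≤ w i j)
    (hd : ∀ i, w i i = 0) : Goal w := by
  have hbl : ∀ i j k l : Fin 5, (cellB bl_II i j).testBit (5 * k + l) = true := by decide +kernel
  have hcfg : Cfg w (fun k l => w k l = 0) bl_II 17043521 := by
    refine ⟨hs, fun i j _ => ⟨fun _ => 0, fun _ => 0, fun k l _ _ => ?_⟩, fun i j hij => ?_⟩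
    · simp only [add_zero, hbl, and_true]
      exact ⟨h0 k l, eq_comm⟩
    · have : ∀ i j : Fin 5, Nat.testBit 17043521 (5 * i + j) = true → i = j := by decide +kernel
      exact ⟨1, this i j hij, fun k _ => ⟨hd k, hbl _ _ _ _⟩⟩
  rcases runOK_sound hcfg true 30 _ 0 _ (holds_of_list
    [(0, 0), (1, 1), (2, 2), (3, 3), (4, 4)] (by decide +kernel) (by simp [hd])) chk_II with h | h
  · exact h
  · obtain ⟨-, s, h01, h10, h | h⟩ := h
    · exact goal_of_renum w s s (goal_22 (sing_renum s s hs) (fun i j => h0 _ _)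
        (fun i => hd _) h01 h10 h.1 h.2)
    · exact goal_of_renum w s s (goal_23 (sing_renum s s hs) (fun i j => h0 _ _)
        (fun i => hd _) h01 h10 h.1 h.2.1 h.2.2)

lemma goal_of_sing (A : Matrix (Fin 5) (Fin 5) ℝ) (hs : Sing A) : Goal A := by
  obtain ⟨u, v, σ, h1, h2⟩ := exists_tight_perm A
  apply goal_of_pot A u v
  refine goal_of_renum _ 1 σ (goal_normalized (sing_renum 1 σ (sing_pot u v hs)) ?_ ?_)
  · intro i j
    have := h1 i (σ j)
    simp only [Matrix.submatrix_apply, potM, Equiv.Perm.one_apply]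
    linarith
  · intro i
    have := h2 i
    simp only [Matrix.submatrix_apply, potM, Equiv.Perm.one_apply]
    linarith


/-- Every `5 × 5` real matrix all of whose `4 × 4` submatrices are tropically
singular (tropical rank at most `3`) admits a lift over `K` of rank at most `3`
(Kapranov rank at most `3`). -/
theorem minors_tropical_basis_5x5 (A : Matrix (Fin 5) (Fin 5) ℝ)
    (hsing : ∀ (r : Fin 4 → Fin 5) (c : Fin 4 → Fin 5),
      Function.Injective r → Function.Injective c → TropSingular (A.submatrix r c)) :
    ∃ B : Matrix (Fin 5) (Fin 5) K, IsLift A B ∧ B.rank ≤ 3 := by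
  exact goal_of_sing A (sing_of_minors A hsing)
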